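/- Every Artin-Tits presentation of large type satisfies Property H⁺: for all S₀ ⊆ S and every word w over S ∪ S⁻¹ whose image w̄ belongs to the standard parabolic subgroup A_{S₀}, there exists a word w₀ over S₀ ∪ S₀⁻¹ such that w →_{0,1,2⋆} w₀. -/

import Mathlib

namespace ArtinTits

open Classical List

variable {S : Type*}

/-- A word over `S ∪ S⁻¹`: a list of letters, each a generator together with a sign
(`true` = the generator itself, `false` = its formal inverse). -/
abbrev Word (S : Type*) := List (S × Bool)

/-- The formal inverse of a word. -/
def wordInv (w : Word S) : Word S := w.reverse.map fun l => (l.1, !l.2)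

/-- `[x,y,j⟩`: the alternating positive word `xyxy⋯` with `j` letters, beginning with `x`. -/
def altWord (x y : S) : ℕ → Word S
  | 0 => []
  | j + 1 => (x, true) :: altWord y x j

/-- `⟨x,y,j]`: the alternating positive word `⋯xy` with `j` letters, ending with `y`. -/
def altWordR (x y : S) (j : ℕ) : Word S := (altWord y x j).reverse

/-- The data of a labelled finite complete simplicial graph `Γ₀`: a symmetric label map
with values in `{2,3,…} ∪ {∞}` on pairs of distinct vertices. -/
structure ArtinData (S : Type*) where
  m : S → S → ℕ∞
  symm : ∀ s t, m s t = m t s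
  two_le : ∀ s t : S, s ≠ t → 2 ≤ m s t

/-- `u = v` is a defining (braid) relation of the Artin–Tits presentation. -/
def IsRel (A : ArtinData S) (u v : Word S) : Prop :=
  ∃ (s t : S) (k : ℕ), s ≠ t ∧ A.m s t = (k : ℕ∞) ∧
    u = altWord s t k ∧ v = altWord t s k

/-- The relator set of the Artin–Tits presentation, inside the free group. -/
def rels (A : ArtinData S) : Set (FreeGroup S) :=
  {x | ∃ u v : Word S, IsRel A u v ∧ x = FreeGroup.mk u * (FreeGroup.mk v)⁻¹}

/-- The Artin–Tits group `A(Γ₀)` of the presentation. -/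
abbrev ArtinGroup (A : ArtinData S) := PresentedGroup (rels A)

/-- `w̄`: the element of the Artin–Tits group represented by the word `w`. -/
def wbar (A : ArtinData S) (w : Word S) : ArtinGroup A :=
  PresentedGroup.mk (rels A) (FreeGroup.mk w)

/-! ### Special transformations -/

/-- Type 0: delete a factor `s s⁻¹` or `s⁻¹ s`. -/
def Step0 (w w' : Word S) : Prop :=
  ∃ (w₁ w₂ : Word S) (s : S) (b : Bool),
    w = w₁ ++ [(s, b), (s, !b)] ++ w₂ ∧ w' = w₁ ++ w₂

/-- Type ∞: insert a factor `s s⁻¹` or `s⁻¹ s` (the inverse of type 0). -/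
def StepInfty (w w' : Word S) : Prop := Step0 w' w

/-- Type 1: replace a factor `v` by `u`, or `v⁻¹` by `u⁻¹`, where `u = v` is a defining
relation. -/
def Step1 (A : ArtinData S) (w w' : Word S) : Prop :=
  ∃ (w₁ w₂ u v : Word S), IsRel A u v ∧
    ((w = w₁ ++ v ++ w₂ ∧ w' = w₁ ++ u ++ w₂) ∨
     (w = w₁ ++ wordInv v ++ w₂ ∧ w' = w₁ ++ wordInv u ++ w₂))

/-- Type 2r: for a defining relation `u₁u₂ = v₁v₂` with `u₁, v₁` non-empty, replace a factor
`v₁⁻¹ u₁` by `v₂ u₂⁻¹`. -/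
def Step2r (A : ArtinData S) (w w' : Word S) : Prop :=
  ∃ (w₁ w₂ u₁ u₂ v₁ v₂ : Word S), IsRel A (u₁ ++ u₂) (v₁ ++ v₂) ∧
    u₁ ≠ [] ∧ v₁ ≠ [] ∧
    w = w₁ ++ wordInv v₁ ++ u₁ ++ w₂ ∧ w' = w₁ ++ v₂ ++ wordInv u₂ ++ w₂

/-- Type 2l: for a defining relation `u₁u₂ = v₁v₂` with `u₂, v₂` non-empty, replace a factor
`v₂ u₂⁻¹` by `v₁⁻¹ u₁`. -/
def Step2l (A : ArtinData S) (w w' : Word S) : Prop :=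
  ∃ (w₁ w₂ u₁ u₂ v₁ v₂ : Word S), IsRel A (u₁ ++ u₂) (v₁ ++ v₂) ∧
    u₂ ≠ [] ∧ v₂ ≠ [] ∧
    w = w₁ ++ v₂ ++ wordInv u₂ ++ w₂ ∧ w' = w₁ ++ wordInv v₁ ++ u₁ ++ w₂

/-- Type 2: a type 2r or type 2l transformation. -/
def Step2 (A : ArtinData S) (w w' : Word S) : Prop := Step2r A w w' ∨ Step2l A w w'

/-- `p` is the greatest (longest) common left factor of `x` and `y`. -/
def IsLCPrefix (p x y : Word S) : Prop :=
  p <+: x ∧ p <+: y ∧ ∀ q : Word S, q <+: x → q <+: y → q.length ≤ p.length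

/-- `p` is the greatest (longest) common right factor of `x` and `y`. -/
def IsLCSuffix (p x y : Word S) : Prop :=
  p <:+ x ∧ p <:+ y ∧ ∀ q : Word S, q <:+ x → q <:+ y → q.length ≤ p.length

/-- Type 2r⋆ : a type 2r transformation `w₁ v⁻¹ v' w₂ → w₁ u (u')⁻¹ w₂` (with `vu = v'u'` a
defining relation) such that `v` is the greatest common left factor of `vu` and `v w₁⁻¹`, and
`v'` is the greatest common left factor of `v'u'` and `v' w₂`. -/
def Step2rStar (A : ArtinData S) (w w' : Word S) : Prop :=
  ∃ (w₁ w₂ v u v' u' : Word S), IsRel A (v ++ u) (v' ++ u') ∧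
    v ≠ [] ∧ v' ≠ [] ∧
    w = w₁ ++ wordInv v ++ v' ++ w₂ ∧
    w' = w₁ ++ u ++ wordInv u' ++ w₂ ∧
    IsLCPrefix v (v ++ u) (v ++ wordInv w₁) ∧
    IsLCPrefix v' (v' ++ u') (v' ++ w₂)

/-- Type 2l⋆ : a type 2l transformation `w₁ v (v')⁻¹ w₂ → w₁ u⁻¹ u' w₂` (with `uv = u'v'` a
defining relation) such that `v` is the greatest common right factor of `uv` and `w₁ v`, and
`v'` is the greatest common right factor of `u'v'` and `w₂⁻¹ v'`. -/
def Step2lStar (A : ArtinData S) (w w' : Word S) : Prop :=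
  ∃ (w₁ w₂ v u v' u' : Word S), IsRel A (u ++ v) (u' ++ v') ∧
    v ≠ [] ∧ v' ≠ [] ∧
    w = w₁ ++ v ++ wordInv v' ++ w₂ ∧
    w' = w₁ ++ wordInv u ++ u' ++ w₂ ∧
    IsLCSuffix v (u ++ v) (w₁ ++ v) ∧
    IsLCSuffix v' (u' ++ v') (wordInv w₂ ++ v')

/-- Type 2⋆ : a type 2r⋆ or type 2l⋆ transformation. -/
def Step2Star (A : ArtinData S) (w w' : Word S) : Prop :=
  Step2rStar A w w' ∨ Step2lStar A w w'

/-- `w →_{0,1,2} w'`. -/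
def Steps012 (A : ArtinData S) : Word S → Word S → Prop :=
  Relation.ReflTransGen fun x y => Step0 x y ∨ Step1 A x y ∨ Step2 A x y

/-- `w →_{0,1,2⋆} w'`. -/
def Steps012Star (A : ArtinData S) : Word S → Word S → Prop :=
  Relation.ReflTransGen fun x y => Step0 x y ∨ Step1 A x y ∨ Step2Star A x y

/-- `w →_{2⋆} w'`. -/
def Steps2Star (A : ArtinData S) : Word S → Word S → Prop :=
  Relation.ReflTransGen (Step2Star A)

/-- `w →_{1,2⋆} w'`. -/
def Steps12Star (A : ArtinData S) : Word S → Word S → Prop :=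
  Relation.ReflTransGen fun x y => Step1 A x y ∨ Step2Star A x y

/-- `w →_{1,2} w'`. -/
def Steps12 (A : ArtinData S) : Word S → Word S → Prop :=
  Relation.ReflTransGen fun x y => Step1 A x y ∨ Step2 A x y

/-! ### Classes of words -/

/-- A positive word: written over `S`. -/
def Positive (w : Word S) : Prop := ∀ l ∈ w, l.2 = true

/-- A negative word: written over `S⁻¹`. -/
def Negative (w : Word S) : Prop := ∀ l ∈ w, l.2 = false

/-- A signed word: positive or negative. -/
def Signed (w : Word S) : Prop := Positive w ∨ Negative w

/-- An unsigned word: neither positive nor negative. -/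
def Unsigned (w : Word S) : Prop := ¬ Positive w ∧ ¬ Negative w

/-- A freely reduced word: no factor `s s⁻¹` or `s⁻¹ s`. -/
def FreelyReduced (w : Word S) : Prop :=
  ∀ (w₁ w₂ : Word S) (s : S) (b : Bool), w ≠ w₁ ++ [(s, b), (s, !b)] ++ w₂

/-- A square-free word: no factor `aa`. -/
def SquareFree (w : Word S) : Prop := ∀ a : S × Bool, ¬ [a, a] <:+: w

/-- `p̃(w)`: the length of the longest square-free positive factor of `w`. -/
noncomputable def ptilde (w : Word S) : ℕ :=
  sSup {n | ∃ v : Word S, v <:+: w ∧ Positive v ∧ SquareFree v ∧ v.length = n}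

/-- `ñ(w)`: the length of the longest negative factor of `w` whose formal inverse is
square-free. -/
noncomputable def ntilde (w : Word S) : ℕ :=
  sSup {n | ∃ v : Word S, v <:+: w ∧ Negative v ∧ SquareFree (wordInv v) ∧ v.length = n}

/-- `p(w) = min(p̃(w), m)`. -/
noncomputable def pfun (M : ℕ) (w : Word S) : ℕ := min (ptilde w) M

/-- `n(w) = min(ñ(w), m)`. -/
noncomputable def nfun (M : ℕ) (w : Word S) : ℕ := min (ntilde w) M

/-- `Ω(Γ₀)` (for a dihedral presentation with label `M`): the freely reduced words with
`max(p(w), n(w)) < M`. -/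
def Omega (M : ℕ) (w : Word S) : Prop :=
  FreelyReduced w ∧ max (pfun M w) (nfun M w) < M

/-- A signed square-free word (square-free positive, or negative with square-free inverse). -/
def SignedSF (w : Word S) : Prop :=
  (Positive w ∧ SquareFree w) ∨ (Negative w ∧ SquareFree (wordInv w))

/-- `v` is the maximal square-free signed left factor of `w`. -/
def MaxSignedSFPrefix (v w : Word S) : Prop :=
  v <+: w ∧ SignedSF v ∧ ∀ v' : Word S, v' <+: w → SignedSF v' → v'.length ≤ v.length

/-- `(v₁, …, v_k)` is the `⋆`-decomposition of `w`: the `v_i` are non-empty, `w = v₁⋯v_k`,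
and each `v_i` is the maximal square-free signed left factor of `v_i⋯v_k`. -/
def StarDecomp (w : Word S) (L : List (Word S)) : Prop :=
  w = L.flatten ∧ (∀ v ∈ L, v ≠ ([] : Word S)) ∧
    ∀ i (h : i < L.length), MaxSignedSFPrefix (L.get ⟨i, h⟩) ((L.drop i).flatten)

/-! ### Groups, parabolic subgroups, geodesics -/

/-- A word written over `T ∪ T⁻¹` for a subset `T` of the generators. -/
def WordOver (T : Set S) (w : Word S) : Prop := ∀ l ∈ w, l.1 ∈ T

/-- The standard parabolic subgroup `A_T` generated by the image of `T ⊆ S`. -/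
def parab (A : ArtinData S) (T : Set S) : Subgroup (ArtinGroup A) :=
  Subgroup.closure {x | ∃ s ∈ T, x = wbar A [(s, true)]}

/-- A geodesic word: of minimal length among all words representing the same element. -/
def Geodesic (A : ArtinData S) (w : Word S) : Prop :=
  ∀ w' : Word S, wbar A w' = wbar A w → w.length ≤ w'.length

/-- A word over `T ∪ T⁻¹` that is geodesic among the words over `T ∪ T⁻¹` representing the
same element. -/
def GeodesicOver (A : ArtinData S) (T : Set S) (w : Word S) : Prop :=
  WordOver T w ∧
    ∀ w' : Word S, WordOver T w' → wbar A w' = wbar A w → w.length ≤ w'.length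

/-- The length of a group element: the length of any geodesic representative word. -/
noncomputable def elLength (A : ArtinData S) (g : ArtinGroup A) : ℕ :=
  sInf {n | ∃ w : Word S, wbar A w = g ∧ w.length = n}

/-- A positive element: one represented by a positive word. -/
def IsPosElt (A : ArtinData S) (g : ArtinGroup A) : Prop :=
  ∃ w : Word S, Positive w ∧ wbar A w = g

/-- An `H`-transversal: a subset containing `1` and exactly one element of each left
`H`-coset. -/
def IsLeftTransversal {G : Type*} [Group G] (H : Subgroup G) (T : Set G) : Prop :=
  (1 : G) ∈ T ∧ ∀ g : G, ∃! x, x ∈ T ∧ g⁻¹ * x ∈ H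

/-! ### Properties H, H⁺, H# -/

/-- Property `H`: `w →_{0,1,2} ε ↔ w̄ = 1`. -/
def PropertyH (A : ArtinData S) : Prop :=
  ∀ w : Word S, Steps012 A w [] ↔ wbar A w = 1

/-- Property `H⁺`: every word representing an element of a standard parabolic subgroup
`A_{S₀}` can be transformed by `→_{0,1,2⋆}` into a word over `S₀ ∪ S₀⁻¹`. -/
def PropertyHPlus (A : ArtinData S) : Prop :=
  ∀ (S₀ : Set S) (w : Word S), wbar A w ∈ parab A S₀ →
    ∃ w₀ : Word S, WordOver S₀ w₀ ∧ Steps012Star A w w₀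

/-- Property `H#` with respect to an `S`-sequence of transversals `T`. -/
def PropertyHSharpWrt (A : ArtinData S) (T : Set S → Set (ArtinGroup A)) : Prop :=
  (∀ S₀ : Set S, IsLeftTransversal (parab A S₀) (T S₀)) ∧
    ∀ (S' S₀ : Set S) (w : Word S), wbar A w ∈ parab A S' →
      ∃ v u : Word S, WordOver S' v ∧ WordOver (S' ∩ S₀) u ∧
        Steps012 A w (v ++ u) ∧ wbar A v ∈ T S₀

/-- Property `H#`: property `H#` with respect to some `S`-sequence of transversals. -/
def PropertyHSharp (A : ArtinData S) : Prop :=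
  ∃ T : Set S → Set (ArtinGroup A), PropertyHSharpWrt A T

/-! ### Critical words and the involution τ (relative to a dihedral pair) -/

/-- The permutation `δ` induced by conjugation by `Δ`, extended letterwise to words:
the identity if `M` is even, and the swap of `s` and `t` if `M` is odd. -/
noncomputable def deltaMap (s t : S) (M : ℕ) (w : Word S) : Word S :=
  if Even M then w
  else w.map fun l => (if l.1 = s then t else if l.1 = t then s else l.1, l.2)

/-- `w` is an unsigned critical word (of the dihedral pair `{s,t}` with label `M`) and
`w' = τ(w)`. -/
def UCritTauPair (A : ArtinData S) (s t : S) (M : ℕ) (w w' : Word S) : Prop :=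
  WordOver {s, t} w ∧ FreelyReduced w ∧ Unsigned w ∧ GeodesicOver A {s, t} w ∧
  pfun M w + nfun M w = M ∧
  ∃ (x y z z' : S) (wm : Word S),
    ({x, y} : Set S) = {s, t} ∧ ({z, z'} : Set S) = {s, t} ∧
    ((w = altWord x y (pfun M w) ++ wm ++ wordInv (altWord z z' (nfun M w)) ∧
      w' = wordInv (altWordR x y (nfun M w)) ++ deltaMap s t M wm ++
        altWordR z z' (pfun M w)) ∨
     (w = wordInv (altWordR x y (nfun M w)) ++ wm ++ altWordR z z' (pfun M w) ∧
      w' = altWord x y (pfun M w) ++ deltaMap s t M wm ++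
        wordInv (altWord z z' (nfun M w))))

/-- `w` is a positive critical word (of the dihedral pair `{s,t}` with label `M`) and
`w' = τ(w)`. -/
def PosCritTauPair (A : ArtinData S) (s t : S) (M : ℕ) (w w' : Word S) : Prop :=
  WordOver {s, t} w ∧ Positive w ∧ pfun M w = M ∧
  ∃ (x y : S) (wm : Word S), ({x, y} : Set S) = {s, t} ∧ pfun M wm < M ∧
    ((w = altWord x y M ++ wm ∧
      (w' = deltaMap s t M wm ++ altWordR x y M ∨
       w' = deltaMap s t M wm ++ altWordR y x M) ∧
      w'.getLast? ≠ w.getLast?) ∨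
     (w = wm ++ altWordR x y M ∧
      (w' = altWord x y M ++ deltaMap s t M wm ∨
       w' = altWord y x M ++ deltaMap s t M wm) ∧
      w'.head? ≠ w.head?))

/-- `w` is a negative critical word and `w' = τ(w)` (defined via formal inverses). -/
def NegCritTauPair (A : ArtinData S) (s t : S) (M : ℕ) (w w' : Word S) : Prop :=
  PosCritTauPair A s t M (wordInv w) (wordInv w')

/-- `w` is a critical word (unsigned, positive or negative) and `w' = τ(w)`. -/
def CritTauPair (A : ArtinData S) (s t : S) (M : ℕ) (w w' : Word S) : Prop :=
  UCritTauPair A s t M w w' ∨ PosCritTauPair A s t M w w' ∨ NegCritTauPair A s t M w w'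

/-- A type β transformation relative to the dihedral pair `{s,t}` with label `M`:
replace a critical factor `v` by `τ(v)`. -/
def StepBetaPair (A : ArtinData S) (s t : S) (M : ℕ) (w w' : Word S) : Prop :=
  ∃ (w₁ w₂ v v' : Word S), w = w₁ ++ v ++ w₂ ∧ w' = w₁ ++ v' ++ w₂ ∧
    CritTauPair A s t M v v'

/-- A type β transformation (in an Artin–Tits group): a type β transformation relative to some
dihedral standard parabolic subgroup (a pair of generators with finite label). -/
def StepBeta (A : ArtinData S) (w w' : Word S) : Prop :=
  ∃ (s t : S) (M : ℕ), s ≠ t ∧ A.m s t = (M : ℕ∞) ∧ StepBetaPair A s t M w w'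

/-! ### Restriction, direct products, Coxeter graph notions -/

/-- The Artin–Tits presentation induced on a subset `T` of the generators (the presentation of
the standard parabolic subgroup `A_T`). -/
def ArtinData.restrict (A : ArtinData S) (T : Set S) : ArtinData T where
  m a b := A.m a b
  symm a b := A.symm a b
  two_le a b h := A.two_le a b fun h' => h (Subtype.ext h')

/-- The Artin–Tits presentation on the disjoint union `S₁ ⊕ S₂` obtained from presentations on
`S₁` and `S₂` by adding the commuting relations `s₁s₂ = s₂s₁` (label `2`) for `s₁ ∈ S₁`,
`s₂ ∈ S₂`. -/
def prodData {S₁ S₂ : Type*} (A₁ : ArtinData S₁) (A₂ : ArtinData S₂) :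
    ArtinData (S₁ ⊕ S₂) where
  m x y :=
    match x, y with
    | Sum.inl a, Sum.inl b => A₁.m a b
    | Sum.inr a, Sum.inr b => A₂.m a b
    | _, _ => 2
  symm x y := by
    cases x <;> cases y
    · exact A₁.symm _ _
    · rfl
    · rfl
    · exact A₂.symm _ _
  two_le x y h := by
    cases x <;> cases y
    · exact A₁.two_le _ _ fun h' => h (congrArg Sum.inl h')
    · exact le_rfl
    · exact le_rfl
    · exact A₂.two_le _ _ fun h' => h (congrArg Sum.inr h')

/-- Adjacency in the Coxeter graph `Γ` restricted to `T`: distinct vertices of `T` joined by an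
edge (i.e. with label `≠ 2`, edges labelled `2` being removed in `Γ`). -/
def coxAdj (A : ArtinData S) (T : Set S) (x y : S) : Prop :=
  x ∈ T ∧ y ∈ T ∧ x ≠ y ∧ A.m x y ≠ 2

/-- The full subgraph of the Coxeter graph on the vertex subset `T` is connected. -/
def CoxConnected (A : ArtinData S) (T : Set S) : Prop :=
  ∀ x ∈ T, ∀ y ∈ T, Relation.ReflTransGen (coxAdj A T) x y

/-- The relator set of the Coxeter presentation on `T`: the Artin relations together with the
squares of the generators. -/
def coxRels (A : ArtinData S) (T : Set S) : Set (FreeGroup T) :=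
  rels (A.restrict T) ∪ {g | ∃ x : T, g = FreeGroup.of x * FreeGroup.of x}

/-- The induced presentation on `T` is of spherical type: its Coxeter group is finite. -/
def SphericalType (A : ArtinData S) (T : Set S) : Prop :=
  Finite (PresentedGroup (coxRels A T))

/-- The induced presentation on `T` is of large type: all labels are `≥ 3` (possibly `∞`). -/
def LargeTypeOn (A : ArtinData S) (T : Set S) : Prop :=
  ∀ x ∈ T, ∀ y ∈ T, x ≠ y → 3 ≤ A.m x y

/-! ### A concrete model of the dihedral Artin group

The group `⟨r, σ | σ² = 1, r ^ m central⟩` contains the dihedral Artin group with label `m` as the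
subgroup generated by `rσ` and `σr`.  It acts on configurations `(e, T)`, which encode the cosets
`r ^ e σ r ^ j₁ σ ⋯ σ r ^ jₗ ⟨σ⟩` with `T = [j₁, …, jₗ]` and `0 < jᵢ < m`. -/

namespace Dihedral

/-- The admissible lengths of a run. -/
abbrev Run (m : ℕ) := {j : ℤ // 0 < j ∧ j < m}

/-- Configurations. -/
abbrev Conf (m : ℕ) := ℤ × List (Run m)

variable {m : ℕ}

/-- The action of `r`. -/
def rot (m : ℕ) : Equiv.Perm (Conf m) where
  toFun x := (x.1 + 1, x.2)
  invFun x := (x.1 - 1, x.2)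
  left_inv x := by simp
  right_inv x := by simp

/-- The action of `σ`, as a function. -/
noncomputable def flipFun (x : Conf m) : Conf m :=
  if h : 0 < x.1 % m ∧ x.1 % m < m then (x.1 - x.1 % m, ⟨x.1 % m, h⟩ :: x.2)
  else match x.2 with
    | [] => x
    | j :: T => (x.1 + j.1, T)

lemma flipFun_push (k j : ℤ) (h : 0 < j ∧ j < m) (T : List (Run m)) :
    flipFun (k * m + j, T) = (k * m, ⟨j, h⟩ :: T) := by
  have e : (k * m + j) % m = j := by
    rw [add_comm, Int.add_mul_emod_self_right]
    exact Int.emod_eq_of_lt h.1.le h.2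
  simp [flipFun, e, h]

lemma flipFun_pop (k : ℤ) (j : Run m) (T : List (Run m)) :
    flipFun (k * m, j :: T) = (k * m + j.1, T) := by
  simp [flipFun]

lemma flipFun_nil (k : ℤ) : flipFun (k * m, ([] : List (Run m))) = (k * m, []) := by
  simp [flipFun]

/-- Case analysis on configurations (for `m` positive). -/
lemma conf_cases (hm : 0 < m) (x : Conf m) :
    (∃ k j : ℤ, ∃ _ : 0 < j ∧ j < m, ∃ T : List (Run m), x = (k * m + j, T)) ∨
    (∃ (k : ℤ) (j : Run m) (T : List (Run m)), x = (k * m, j :: T)) ∨ ∃ k : ℤ, x = (k * m, []) := by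
  obtain ⟨e, T⟩ := x
  have h1 := Int.emod_nonneg e (b := (m : ℤ)) (by omega)
  have h2 := Int.emod_lt_of_pos e (b := (m : ℤ)) (by omega)
  have h3 := Int.ediv_mul_add_emod e m
  rcases h1.eq_or_lt with h | h
  · rw [← h, add_zero] at h3
    cases T with
    | nil => exact Or.inr (Or.inr ⟨e / m, by rw [h3]⟩)
    | cons j T => exact Or.inr (Or.inl ⟨e / m, j, T, by rw [h3]⟩)
  · exact Or.inl ⟨e / m, e % m, ⟨h, h2⟩, T, by rw [h3]⟩

lemma flipFun_involutive : Function.Involutive (flipFun (m := m)) := by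
  intro x
  rcases Nat.eq_zero_or_pos m with hm | hm
  · subst hm
    obtain ⟨e, T⟩ := x
    cases T with
    | nil =>
      have : flipFun (m := 0) (e, []) = (e, []) := by
        simp only [flipFun]; rw [dif_neg (by simp; omega)]
      rw [this, this]
    | cons j T => exact absurd j.2 (by simp; omega)
  · rcases conf_cases hm x with ⟨k, j, h, T, rfl⟩ | ⟨k, j, T, rfl⟩ | ⟨k, rfl⟩
    · rw [flipFun_push _ _ h, flipFun_pop]
    · rw [flipFun_pop, flipFun_push _ _ j.2]
    · rw [flipFun_nil, flipFun_nil]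

/-- The action of `σ`. -/
noncomputable def flip (m : ℕ) : Equiv.Perm (Conf m) := flipFun_involutive.toPerm

lemma flip_push (k j : ℤ) (h : 0 < j ∧ j < m) (T : List (Run m)) :
    flip m (k * m + j, T) = (k * m, ⟨j, h⟩ :: T) := flipFun_push k j h T

lemma flip_pop (k : ℤ) (j : Run m) (T : List (Run m)) :
    flip m (k * m, j :: T) = (k * m + j.1, T) := flipFun_pop k j T

lemma flip_nil (k : ℤ) : flip m (k * m, []) = (k * m, []) := flipFun_nil k

lemma flip_mul_self : flip m * flip m = 1 := by
  ext1 x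
  exact flipFun_involutive x

lemma flip_flip (x : Conf m) : flip m (flip m x) = x := flipFun_involutive x

lemma flip_inv : (flip m)⁻¹ = flip m := inv_eq_of_mul_eq_one_left flip_mul_self

lemma rot_apply (x : Conf m) : rot m x = (x.1 + 1, x.2) := rfl

lemma rot_inv_apply (x : Conf m) : (rot m)⁻¹ x = (x.1 - 1, x.2) := rfl

lemma rot_zpow_apply (n : ℤ) (x : Conf m) : (rot m ^ n) x = (x.1 + n, x.2) := by
  induction n with
  | zero => simp
  | succ n ih =>
    rw [add_comm, zpow_add, Equiv.Perm.mul_apply, ih, zpow_one, rot_apply]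
    ext1 <;> simp; ring
  | pred n ih =>
    rw [sub_eq_neg_add, zpow_add, Equiv.Perm.mul_apply, ih, zpow_neg_one, rot_inv_apply]
    ext1 <;> simp; ring

lemma flip_comm (hm : 0 < m) (k : ℤ) : flip m * rot m ^ (k * m) = rot m ^ (k * m) * flip m := by
  ext1 x
  simp only [Equiv.Perm.mul_apply, rot_zpow_apply]
  rcases conf_cases hm x with ⟨l, j, h, T, rfl⟩ | ⟨l, j, T, rfl⟩ | ⟨l, rfl⟩
  · have : (l * m + j + k * m : ℤ) = (l + k) * m + j := by ring
    simp only [this, flip_push _ _ h]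
    ext1 <;> simp; ring
  · have : (l * m + k * m : ℤ) = (l + k) * m := by ring
    simp only [this, flip_pop]
    ext1 <;> simp; ring
  · have : (l * m + k * m : ℤ) = (l + k) * m := by ring
    simp only [this, flip_nil]

/-- The generators of the dihedral Artin group. -/
noncomputable def gen (m : ℕ) : Bool → Equiv.Perm (Conf m)
  | false => rot m * flip m
  | true => flip m * rot m

/-- The permutation given by a signed letter. -/
noncomputable def lev (m : ℕ) (l : Bool × Bool) : Equiv.Perm (Conf m) :=
  if l.2 then gen m l.1 else (gen m l.1)⁻¹

/-- The element of the dihedral group represented by a word. -/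
noncomputable def ev (m : ℕ) (v : Word Bool) : Equiv.Perm (Conf m) := (v.map (lev m)).prod

@[simp] lemma ev_nil : ev m [] = 1 := rfl

@[simp] lemma ev_cons (l : Bool × Bool) (v : Word Bool) : ev m (l :: v) = lev m l * ev m v := by
  simp [ev]

@[simp] lemma ev_append (u v : Word Bool) : ev m (u ++ v) = ev m u * ev m v := by
  simp [ev]

lemma lev_not (x b : Bool) : lev m (x, !b) = (lev m (x, b))⁻¹ := by
  cases b <;> simp [lev]

lemma ev_wordInv (v : Word Bool) : ev m (wordInv v) = (ev m v)⁻¹ := by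
  induction v with
  | nil => simp [wordInv]
  | cons l v ih =>
    have : wordInv (l :: v) = wordInv v ++ [(l.1, !l.2)] := by simp [wordInv]
    rw [this, ev_append, ih, ev_cons, ev_cons, ev_nil, lev_not]
    simp

/-- The base configuration. -/
def base (m : ℕ) : Conf m := (0, [])

lemma flip_base : flip m (base m) = base m := by
  have := flip_nil (m := m) 0
  rwa [zero_mul] at this

/-- The standard lift of the run list of a configuration. -/
noncomputable def tailLift : List (Run m) → Equiv.Perm (Conf m)
  | [] => 1
  | j :: T => flip m * rot m ^ j.1 * tailLift T

/-- The parity exponent of a configuration. -/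
def par (x : Conf m) : ℤ := x.1 + (x.2.map fun j => j.1 + 1).sum

/-- The group element attached to a configuration. -/
noncomputable def lift (x : Conf m) : Equiv.Perm (Conf m) :=
  rot m ^ x.1 * tailLift x.2 * flip m ^ par x

lemma flip_zpow_succ (n : ℤ) : flip m ^ (n + 1) = flip m ^ n * flip m := zpow_add_one _ _

lemma flip_zpow_add_two (n : ℤ) : flip m ^ (n + 1 + 1) = flip m ^ n := by
  rw [flip_zpow_succ, flip_zpow_succ, mul_assoc, flip_mul_self, mul_one]

lemma rot_mul_lift (x : Conf m) : rot m * lift x = lift (rot m x) * flip m := by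
  have hp : par (rot m x) = par x + 1 := by simp [par, rot_apply]; ring
  rw [lift, lift, hp, rot_apply, mul_assoc _ (flip m ^ _), ← flip_zpow_succ, flip_zpow_add_two,
    add_comm x.1, zpow_add, zpow_one]
  simp only [mul_assoc]

lemma flip_mul_lift (hm : 0 < m) (x : Conf m) : flip m * lift x = lift (flip m x) * flip m := by
  rcases conf_cases hm x with ⟨k, j, h, T, rfl⟩ | ⟨k, j, T, rfl⟩ | ⟨k, rfl⟩
  · have hp : par (flip m (k * m + j, T)) = par (m := m) (k * m + j, T) + 1 := by
      rw [flip_push _ _ h]; simp [par]; ring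
    rw [lift, lift, hp, flip_push _ _ h, mul_assoc _ (flip m ^ _), ← flip_zpow_succ,
      flip_zpow_add_two, zpow_add]
    simp only [tailLift, ← mul_assoc]
    rw [flip_comm hm]
  · have hp : par (m := m) (k * m, j :: T) = par (flip m (k * m, j :: T)) + 1 := by
      rw [flip_pop]; simp [par]; ring
    rw [lift, lift, hp, flip_pop, mul_assoc _ (flip m ^ _), ← flip_zpow_succ]
    simp only [tailLift, ← mul_assoc]
    rw [flip_comm hm, mul_assoc _ (flip m) (flip m), flip_mul_self, mul_one, zpow_add (rot m)]
  · rw [flip_nil, lift]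
    simp only [tailLift, mul_one]
    rw [← mul_assoc, flip_comm hm, mul_assoc, mul_assoc, (Commute.self_zpow (flip m) _).eq]

lemma gen_mul_lift (hm : 0 < m) (b : Bool) (x : Conf m) :
    gen m b * lift x = lift (gen m b x) := by
  cases b
  · simp only [gen, Equiv.Perm.mul_apply]
    rw [mul_assoc, flip_mul_lift hm, ← mul_assoc, rot_mul_lift, mul_assoc, flip_mul_self, mul_one]
  · simp only [gen, Equiv.Perm.mul_apply]
    rw [mul_assoc, rot_mul_lift, ← mul_assoc, flip_mul_lift hm, mul_assoc, flip_mul_self, mul_one]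

lemma lev_mul_lift (hm : 0 < m) (l : Bool × Bool) (x : Conf m) :
    lev m l * lift x = lift (lev m l x) := by
  obtain ⟨y, b⟩ := l
  cases b
  · simp only [lev, Bool.false_eq_true, if_false]
    rw [inv_mul_eq_iff_eq_mul, gen_mul_lift hm, ← Equiv.Perm.mul_apply, mul_inv_cancel, Equiv.Perm.one_apply]
  · simpa [lev] using gen_mul_lift hm y x

lemma lift_ev (hm : 0 < m) (v : Word Bool) : lift (ev m v (base m)) = ev m v := by
  induction v with
  | nil => simp [lift, base, tailLift, par]
  | cons l v ih => rw [ev_cons, Equiv.Perm.mul_apply, ← lev_mul_lift hm, ih]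

/-- An element of the dihedral group is determined by its action on the base configuration. -/
lemma ev_eq_of_base (hm : 0 < m) {u v : Word Bool} (h : ev m u (base m) = ev m v (base m)) :
    ev m u = ev m v := by
  rw [← lift_ev hm u, ← lift_ev hm v, h]

lemma ev_altWord (n : ℕ) :
    ev m (altWord false true n) = rot m ^ n * flip m ^ n ∧
      ev m (altWord true false n) = flip m * rot m ^ n * flip m ^ (n + 1) := by
  induction n with
  | zero => simp [altWord, flip_mul_self]
  | succ n ih =>
    constructor
    · rw [altWord, ev_cons, ih.2]
      simp only [lev, gen, if_true]
      rw [show rot m * flip m * (flip m * rot m ^ n * flip m ^ (n + 1)) =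
        rot m * (flip m * flip m) * rot m ^ n * flip m ^ (n + 1) by simp only [mul_assoc],
        flip_mul_self, mul_one, pow_succ' (rot m)]
    · rw [altWord, ev_cons, ih.1]
      simp only [lev, gen, if_true]
      rw [pow_succ (flip m) (n + 1), pow_succ (flip m) n, mul_assoc (flip m ^ n), flip_mul_self,
        mul_one, pow_succ' (rot m)]
      simp only [mul_assoc]

lemma ev_altWord_comm (hm : 0 < m) (x : Bool) :
    ev m (altWord x (!x) m) = ev m (altWord (!x) x m) := by
  have h := flip_comm hm 1
  rw [one_mul, zpow_natCast] at h
  have : ev m (altWord false true m) = ev m (altWord true false m) := by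
    rw [(ev_altWord m).1, (ev_altWord m).2, h, mul_assoc, pow_succ' _ m, ← mul_assoc (flip m),
      flip_mul_self, one_mul]
  cases x
  · exact this
  · exact this.symm

end Dihedral

namespace Dihedral

variable {m : ℕ}

/-! ### Length function on configurations -/

/-- The number of runs longer than `j`. -/
def cnt : List (Run m) → ℤ → ℤ
  | [], _ => 0
  | t :: T, j => (if j < t.1 then 1 else 0) + cnt T j

lemma cnt_nonneg (T : List (Run m)) (j : ℤ) : 0 ≤ cnt T j := by
  induction T with
  | nil => simp [cnt]
  | cons t T ih => simp only [cnt]; split_ifs <;> omega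

lemma cnt_le_length (T : List (Run m)) (j : ℤ) : cnt T j ≤ T.length := by
  induction T with
  | nil => simp [cnt]
  | cons t T ih => simp only [cnt, List.length_cons]; split_ifs <;> push_cast <;> omega

lemma cnt_anti (T : List (Run m)) {i j : ℤ} (h : i ≤ j) : cnt T j ≤ cnt T i := by
  induction T with
  | nil => simp [cnt]
  | cons t T ih => simp only [cnt]; split_ifs <;> omega

lemma cnt_of_ge (T : List (Run m)) {j : ℤ} (h : (m : ℤ) - 1 ≤ j) : cnt T j = 0 := by
  induction T with
  | nil => simp [cnt]
  | cons t T ih =>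
    have := t.2
    simp only [cnt, ih]; split_ifs <;> omega

lemma cnt_of_le (T : List (Run m)) {j : ℤ} (h : j ≤ 0) : cnt T j = T.length := by
  induction T with
  | nil => simp [cnt]
  | cons t T ih =>
    have := t.2
    simp only [cnt, ih, List.length_cons]; split_ifs <;> push_cast <;> omega

lemma cnt_replicate (t : Run m) (n : ℕ) (j : ℤ) :
    cnt (List.replicate n t) j = if j < t.1 then (n : ℤ) else 0 := by
  induction n with
  | zero => simp [cnt]
  | succ n ih => simp only [List.replicate_succ, cnt, ih]; split_ifs <;> push_cast <;> omega

/-- The contribution of the run list to the height. -/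
def tailHgt (θ : ℤ) : List (Run m) → ℤ
  | [] => 0
  | t :: T => min t.1 (2 * θ - t.1) + tailHgt θ T

/-- The height function with parameter `θ`. -/
def hgt (θ : ℤ) (x : Conf m) : ℤ :=
  min (x.1 % m) (2 * θ - x.1 % m) + x.1 / m * (2 * θ - m) + tailHgt θ x.2

lemma divmod (k j : ℤ) (h : 0 ≤ j ∧ j < m) : (k * m + j) / m = k ∧ (k * m + j) % m = j := by
  constructor
  · rw [add_comm, Int.add_mul_ediv_right _ _ (by omega), Int.ediv_eq_zero_of_lt h.1 h.2, zero_add]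
  · rw [add_comm, Int.add_mul_emod_self_right]
    exact Int.emod_eq_of_lt h.1 h.2

lemma divmod_zero (hm : 0 < m) (k : ℤ) : (k * m) / m = k ∧ (k * m) % m = 0 := by
  have := divmod (m := m) k 0 ⟨le_rfl, by omega⟩
  rwa [add_zero] at this

lemma hgt_eq (θ k j : ℤ) (h0 : 0 ≤ θ ∧ θ ≤ m) (h : 0 ≤ j ∧ j ≤ m) (hm : 0 < m)
    (T : List (Run m)) :
    hgt θ (k * m + j, T) = min j (2 * θ - j) + k * (2 * θ - m) + tailHgt θ T := by
  rcases h.2.lt_or_eq with h' | rfl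
  · obtain ⟨e1, e2⟩ := divmod (m := m) k j ⟨h.1, h'⟩
    simp only [hgt, e1, e2]
  · obtain ⟨e1, e2⟩ := divmod_zero hm (k + 1)
    have e : k * m + m = (k + 1) * (m : ℤ) := by ring
    simp only [hgt, e, e1, e2, sub_zero]
    rw [min_eq_left (by omega), min_eq_right (by omega)]
    ring

lemma hgt_eq_zero (θ k : ℤ) (h0 : 0 ≤ θ ∧ θ ≤ m) (hm : 0 < m) (T : List (Run m)) :
    hgt θ (k * m, T) = k * (2 * θ - m) + tailHgt θ T := by
  have := hgt_eq θ k 0 h0 ⟨le_rfl, by omega⟩ hm T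
  rw [add_zero, sub_zero, min_eq_left (by omega), zero_add] at this
  exact this

lemma hgt_flip (hm : 0 < m) (θ : ℤ) (h0 : 0 ≤ θ ∧ θ ≤ m) (x : Conf m) :
    hgt θ (flip m x) = hgt θ x := by
  rcases conf_cases hm x with ⟨k, j, h, T, rfl⟩ | ⟨k, j, T, rfl⟩ | ⟨k, rfl⟩
  · rw [flip_push _ _ h, hgt_eq _ _ _ h0 ⟨h.1.le, h.2.le⟩ hm, hgt_eq_zero _ _ h0 hm]
    simp only [tailHgt]; ring
  · rw [flip_pop, hgt_eq _ _ _ h0 ⟨j.2.1.le, j.2.2.le⟩ hm, hgt_eq_zero _ _ h0 hm]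
    simp only [tailHgt]; ring
  · rw [flip_nil]

lemma conf_divmod (hm : 0 < m) (x : Conf m) :
    ∃ (k j : ℤ) (T : List (Run m)), (0 ≤ j ∧ j < m) ∧ x = (k * m + j, T) :=
  ⟨x.1 / m, x.1 % m, x.2, ⟨Int.emod_nonneg _ (by omega), Int.emod_lt_of_pos _ (by omega)⟩,
    by rw [Int.ediv_mul_add_emod]⟩

lemma hgt_rot (hm : 0 < m) (θ : ℤ) (h0 : 0 ≤ θ ∧ θ ≤ m) (x : Conf m) :
    hgt θ (rot m x) = hgt θ x + if x.1 % m < θ then 1 else -1 := by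
  obtain ⟨k, j, T, h, rfl⟩ := conf_divmod hm x
  simp only [rot_apply, (divmod k j h).2]
  rw [add_assoc, hgt_eq _ _ _ h0 ⟨by omega, by omega⟩ hm, hgt_eq _ _ _ h0 ⟨by omega, by omega⟩ hm]
  split_ifs <;> omega

lemma tailHgt_succ (θ : ℤ) (T : List (Run m)) :
    tailHgt (θ + 1) T = tailHgt θ T + 2 * cnt T θ := by
  induction T with
  | nil => simp [tailHgt, cnt]
  | cons t T ih => simp only [tailHgt, cnt, ih]; split_ifs <;> omega

lemma hgt_succ (θ : ℤ) (x : Conf m) :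
    hgt (θ + 1) x = hgt θ x + 2 * (cnt x.2 θ + (if θ < x.1 % m then 1 else 0) + x.1 / m) := by
  have h : x.1 / m * (2 * (θ + 1) - m) = x.1 / m * (2 * θ - m) + 2 * (x.1 / m) := by ring
  simp only [hgt, tailHgt_succ, h]
  split_ifs <;> omega

/-- The length of a configuration: the maximal height. -/
def nrm (x : Conf m) : ℤ :=
  (Finset.range (m + 1)).sup' ⟨0, by simp⟩ fun θ => hgt (θ : ℤ) x

lemma hgt_le_nrm (x : Conf m) (θ : ℤ) (h0 : 0 ≤ θ ∧ θ ≤ m) : hgt θ x ≤ nrm x := by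
  have := Finset.le_sup' (fun θ : ℕ => hgt (θ : ℤ) x)
    (show θ.toNat ∈ Finset.range (m + 1) by simp; omega)
  simp only [Int.toNat_of_nonneg h0.1] at this
  exact this

lemma exists_hgt_eq_nrm (x : Conf m) : ∃ θ : ℤ, (0 ≤ θ ∧ θ ≤ m) ∧ hgt θ x = nrm x := by
  obtain ⟨θ, h, e⟩ := Finset.exists_mem_eq_sup' (s := Finset.range (m + 1)) ⟨0, by simp⟩
    (fun θ : ℕ => hgt (θ : ℤ) x)
  simp only [Finset.mem_range] at h
  exact ⟨θ, ⟨by omega, by omega⟩, e.symm⟩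

lemma nrm_eq (x : Conf m) (c : ℤ) (h : ∀ θ : ℤ, 0 ≤ θ ∧ θ ≤ m → hgt θ x ≤ c)
    (h' : ∃ θ : ℤ, (0 ≤ θ ∧ θ ≤ m) ∧ hgt θ x = c) : nrm x = c := by
  obtain ⟨θ, h0, e⟩ := h'
  obtain ⟨θ', h0', e'⟩ := exists_hgt_eq_nrm x
  exact le_antisymm (e' ▸ h θ' h0') (e ▸ hgt_le_nrm x θ h0)

lemma nrm_flip (hm : 0 < m) (x : Conf m) : nrm (flip m x) = nrm x := by
  apply nrm_eq
  · intro θ h0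
    rw [hgt_flip hm θ h0]
    exact hgt_le_nrm x θ h0
  · obtain ⟨θ, h0, e⟩ := exists_hgt_eq_nrm x
    exact ⟨θ, h0, by rw [hgt_flip hm θ h0, e]⟩

lemma nrm_base (hm : 0 < m) : nrm (base m) = 0 := by
  have key : ∀ θ : ℤ, 0 ≤ θ ∧ θ ≤ m → hgt θ (base m) = 0 := by
    intro θ h0
    have := hgt_eq_zero (m := m) θ 0 h0 hm []
    rwa [zero_mul, zero_mul, tailHgt, add_zero] at this
  exact nrm_eq _ _ (fun θ h => (key θ h).le) ⟨0, ⟨le_rfl, by omega⟩, key 0 ⟨le_rfl, by omega⟩⟩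

/-- The condition that `r` decreases the length. -/
def Up (x : Conf m) : Prop := cnt x.2 (x.1 % m) + x.1 / m < 0

/-- The condition that `r⁻¹` decreases the length. -/
def Dn (x : Conf m) : Prop := ¬ Up ((rot m)⁻¹ x)

lemma nrm_rot (hm : 0 < m) (x : Conf m) :
    nrm (rot m x) = nrm x + if Up x then -1 else 1 := by
  have hj0 := Int.emod_nonneg x.1 (b := (m : ℤ)) (by omega)
  have hj1 := Int.emod_lt_of_pos x.1 (b := (m : ℤ)) (by omega)
  set j := x.1 % m with hj
  obtain ⟨θ₀, h0, e0⟩ := exists_hgt_eq_nrm x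
  by_cases hu : Up x
  · rw [if_pos hu]
    have hu' : cnt x.2 j + x.1 / m < 0 := hu
    have mono : ∀ n : ℕ, hgt (j + 1 + n) x ≤ hgt j x - 2 := by
      intro n
      induction n with
      | zero =>
        have := hgt_succ j x
        rw [← hj, if_neg (lt_irrefl _)] at this
        push_cast
        rw [add_zero]
        omega
      | succ n ih =>
        have := hgt_succ (j + 1 + n) x
        have h2 := cnt_anti x.2 (show j ≤ j + 1 + n by omega)
        rw [← hj, if_neg (by omega)] at this
        push_cast
        rw [← add_assoc]
        omega
    have big : ∀ θ, j < θ → hgt θ x ≤ hgt j x - 2 := by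
      intro θ hθ
      have := mono (θ - (j + 1)).toNat
      rwa [Int.toNat_of_nonneg (by omega), add_sub_cancel] at this
    have hjN := hgt_le_nrm x j ⟨hj0, hj1.le⟩
    apply nrm_eq
    · intro θ h
      rw [hgt_rot hm θ h, ← hj]
      have := hgt_le_nrm x θ h
      split_ifs with hc
      · have := big θ hc; omega
      · omega
    · refine ⟨θ₀, h0, ?_⟩
      rw [hgt_rot hm θ₀ h0, ← hj, if_neg, e0]
      intro hc
      have := big θ₀ hc
      omega
  · rw [if_neg hu]
    have hu' : 0 ≤ cnt x.2 j + x.1 / m := not_lt.1 hu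
    have mono : ∀ n : ℕ, hgt (j - n) x ≤ hgt (j + 1) x := by
      intro n
      induction n with
      | zero =>
        have := hgt_succ j x
        rw [← hj, if_neg (lt_irrefl _)] at this
        push_cast
        rw [sub_zero]
        omega
      | succ n ih =>
        have := hgt_succ (j - (n + 1)) x
        have h2 := cnt_anti x.2 (show j - (n + 1) ≤ j by omega)
        rw [← hj, if_pos (by omega), show j - (n + 1) + 1 = j - n by ring] at this
        push_cast
        omega
    apply nrm_eq
    · intro θ h
      rw [hgt_rot hm θ h, ← hj]
      have := hgt_le_nrm x θ h
      split_ifs with hc <;> omega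
    · by_cases hc : j < θ₀
      · exact ⟨θ₀, h0, by rw [hgt_rot hm θ₀ h0, ← hj, if_pos hc, e0]⟩
      · have h1 := mono (j - θ₀).toNat
        rw [Int.toNat_of_nonneg (by omega), sub_sub_cancel] at h1
        have h2 := hgt_le_nrm x (j + 1) ⟨by omega, by omega⟩
        exact ⟨j + 1, ⟨by omega, by omega⟩, by
          rw [hgt_rot hm _ ⟨by omega, by omega⟩, ← hj, if_pos (by omega)]; omega⟩

lemma nrm_rot_inv (hm : 0 < m) (x : Conf m) :
    nrm ((rot m)⁻¹ x) = nrm x + if Dn x then -1 else 1 := by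
  have h := nrm_rot hm ((rot m)⁻¹ x)
  rw [← Equiv.Perm.mul_apply, mul_inv_cancel, Equiv.Perm.one_apply] at h
  by_cases hu : Up ((rot m)⁻¹ x)
  · rw [if_pos hu] at h
    rw [if_neg (show ¬ Dn x from not_not.2 hu)]
    omega
  · rw [if_neg hu] at h
    rw [if_pos (show Dn x from hu)]
    omega

lemma up_iff (k j : ℤ) (h : 0 ≤ j ∧ j < m) (T : List (Run m)) :
    Up (k * m + j, T) ↔ cnt T j + k < 0 := by
  simp only [Up, (divmod k j h).1, (divmod k j h).2]

lemma up_iff_zero (hm : 0 < m) (k : ℤ) (T : List (Run m)) :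
    Up (k * m, T) ↔ T.length + k < 0 := by
  simp only [Up, (divmod_zero hm k).1, (divmod_zero hm k).2, cnt_of_le T le_rfl]

lemma dn_iff (k j : ℤ) (h : 0 < j ∧ j ≤ m) (T : List (Run m)) :
    Dn (k * m + j, T) ↔ 0 ≤ cnt T (j - 1) + k := by
  rw [Dn, rot_inv_apply, add_sub_assoc, up_iff k (j - 1) ⟨by omega, by omega⟩, not_lt]

lemma dn_iff_zero (hm : 0 < m) (k : ℤ) (T : List (Run m)) :
    Dn (k * m, T) ↔ 1 ≤ k := by
  have := dn_iff (k - 1) m ⟨by omega, le_rfl⟩ T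
  rw [cnt_of_ge T le_rfl, show (k - 1) * (m : ℤ) + m = k * m by ring] at this
  rw [this]; omega

lemma not_up_and_dn_flip (hm : 0 < m) (x : Conf m) : ¬ (Up x ∧ Dn (flip m x)) := by
  rintro ⟨h1, h2⟩
  rcases conf_cases hm x with ⟨k, j, h, T, rfl⟩ | ⟨k, j, T, rfl⟩ | ⟨k, rfl⟩
  · rw [up_iff _ _ ⟨h.1.le, h.2⟩] at h1
    rw [flip_push _ _ h, dn_iff_zero hm] at h2
    have := cnt_nonneg T j
    omega
  · rw [up_iff_zero hm] at h1
    rw [flip_pop, dn_iff _ _ ⟨j.2.1, j.2.2.le⟩] at h2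
    have := cnt_le_length T (j.1 - 1)
    simp only [List.length_cons] at h1
    push_cast at h1
    omega
  · rw [up_iff_zero hm] at h1
    rw [flip_nil, dn_iff_zero hm] at h2
    simp at h1
    omega

lemma exists_decrease (hm : 0 < m) (x : Conf m) (hx : x ≠ base m) :
    Up x ∨ Dn x ∨ Up (flip m x) ∨ Dn (flip m x) := by
  have key : ∀ (k j : ℤ) (h : 0 < j ∧ j < m) (T : List (Run m)),
      Up (k * m + j, T) ∨ Dn (k * m + j, T) := by
    intro k j h T
    rw [up_iff _ _ ⟨h.1.le, h.2⟩, dn_iff _ _ ⟨h.1, h.2.le⟩]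
    have := cnt_anti T (show j - 1 ≤ j by omega)
    omega
  rcases conf_cases hm x with ⟨k, j, h, T, rfl⟩ | ⟨k, j, T, rfl⟩ | ⟨k, rfl⟩
  · rcases key k j h T with h | h <;> simp [h]
  · rw [flip_pop]
    rcases key k j j.2 T with h | h <;> simp [h]
  · rw [up_iff_zero hm, dn_iff_zero hm]
    have : k ≠ 0 := by rintro rfl; exact hx (by simp [base])
    simp only [List.length_nil]
    push_cast
    omega

lemma up_step (hm : 3 ≤ m) (x : Conf m) (h1 : Up x) (h2 : Up (flip m x) ∨ Dn x) :
    Up (rot m x) ∨ Dn (flip m (rot m x)) := by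
  have key : ∀ (k : ℤ) (T : List (Run m)), T.length + k < 0 →
      Up (rot m (k * m, T)) := by
    intro k T h
    rw [rot_apply, up_iff _ _ ⟨by omega, by omega⟩]
    have := cnt_le_length T 1
    simp only
    omega
  rcases conf_cases (by omega) x with ⟨k, j, h, T, rfl⟩ | ⟨k, j, T, rfl⟩ | ⟨k, rfl⟩
  · rw [up_iff _ _ ⟨h.1.le, h.2⟩] at h1
    rw [flip_push _ _ h, up_iff_zero (by omega), dn_iff _ _ ⟨h.1, h.2.le⟩] at h2
    simp only [List.length_cons] at h2
    push_cast at h2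
    rw [rot_apply]
    simp only
    rcases lt_or_ge (j + 1) m with hj | hj
    · left
      rw [add_assoc, up_iff _ _ ⟨by omega, by omega⟩]
      have := cnt_anti T (show j ≤ j + 1 by omega)
      omega
    · rw [show k * m + j + 1 = (k + 1) * (m : ℤ) by
        have : j = m - 1 := by omega
        rw [this]; ring]
      cases T with
      | nil =>
        simp only [cnt] at h1 h2
        left
        rw [up_iff_zero (by omega)]
        simp only [List.length_nil] at h2 ⊢
        push_cast at h2 ⊢
        omega
      | cons t T =>
        rw [up_iff_zero (by omega), flip_pop, dn_iff _ _ ⟨t.2.1, t.2.2.le⟩]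
        simp only [List.length_cons, cnt] at h2 ⊢
        push_cast at h2 ⊢
        have ht := t.2
        have := cnt_anti T (show t.1 - 1 ≤ j - 1 by omega)
        split_ifs at h2 <;> omega
  · rw [up_iff_zero (by omega)] at h1
    exact Or.inl (key _ _ h1)
  · rw [up_iff_zero (by omega)] at h1
    exact Or.inl (key _ _ h1)

lemma dn_step (hm : 3 ≤ m) (x : Conf m) (h1 : Dn x) (h2 : Up x ∨ Dn (flip m x)) :
    Dn ((rot m)⁻¹ x) ∨ Up (flip m ((rot m)⁻¹ x)) := by
  have key : ∀ (k : ℤ) (T : List (Run m)), 1 ≤ k → Dn ((rot m)⁻¹ (k * m, T)) := by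
    intro k T h
    rw [rot_inv_apply, show ((k * m, T) : Conf m).1 - 1 = (k - 1) * (m : ℤ) + (m - 1) by
      simp only; ring, dn_iff _ _ ⟨by omega, by omega⟩]
    have := cnt_nonneg T (m - 1 - 1)
    simp only
    omega
  rcases conf_cases (by omega) x with ⟨k, j, h, T, rfl⟩ | ⟨k, j, T, rfl⟩ | ⟨k, rfl⟩
  · rw [flip_push _ _ h, dn_iff_zero (by omega), up_iff _ _ ⟨h.1.le, h.2⟩] at h2
    rw [dn_iff _ _ ⟨h.1, h.2.le⟩] at h1
    rw [rot_inv_apply]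
    simp only
    rcases lt_or_ge 1 j with hj | hj
    · left
      rw [add_sub_assoc, dn_iff _ _ ⟨by omega, by omega⟩]
      have := cnt_anti T (show j - 1 - 1 ≤ j - 1 by omega)
      omega
    · obtain rfl : j = 1 := by omega
      rw [add_sub_cancel_right, dn_iff_zero (by omega)]
      rw [cnt_of_le _ (by omega)] at h1
      cases T with
      | nil =>
        simp only [cnt, List.length_nil] at h1 h2
        push_cast at h1
        omega
      | cons t T =>
        rw [flip_pop, up_iff _ _ ⟨t.2.1.le, t.2.2⟩]
        simp only [cnt] at h2
        have := cnt_anti T (show 1 ≤ t.1 by have := t.2; omega)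
        split_ifs at h2 <;> omega
  · rw [dn_iff_zero (by omega)] at h1
    exact Or.inl (key _ _ h1)
  · rw [dn_iff_zero (by omega)] at h1
    exact Or.inl (key _ _ h1)

end Dihedral

namespace Dihedral

variable {m : ℕ}

/-! ### Geodesic words in the dihedral group -/

/-- The letter `l` decreases the length of the configuration. -/
def Dec (l : Bool × Bool) (x : Conf m) : Prop :=
  match l with
  | (false, true) => Up (flip m x)
  | (false, false) => Dn x
  | (true, true) => Up x
  | (true, false) => Dn (flip m x)

lemma lev_ft : lev m (false, true) = rot m * flip m := rfl

lemma lev_tt : lev m (true, true) = flip m * rot m := rfl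

lemma lev_ff : lev m (false, false) = flip m * (rot m)⁻¹ := by
  simp [lev, gen, flip_inv]

lemma lev_tf : lev m (true, false) = (rot m)⁻¹ * flip m := by
  simp [lev, gen, flip_inv]

lemma nrm_lev (hm : 0 < m) (l : Bool × Bool) (x : Conf m) :
    nrm (lev m l x) = nrm x + if Dec l x then -1 else 1 := by
  obtain ⟨a, b⟩ := l
  cases a <;> cases b
  · rw [lev_ff, Equiv.Perm.mul_apply, nrm_flip hm, nrm_rot_inv hm]; rfl
  · rw [lev_ft, Equiv.Perm.mul_apply, nrm_rot hm, nrm_flip hm]; rfl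
  · rw [lev_tf, Equiv.Perm.mul_apply, nrm_rot_inv hm, nrm_flip hm]; rfl
  · rw [lev_tt, Equiv.Perm.mul_apply, nrm_flip hm, nrm_rot hm]; rfl

lemma dec_iff (hm : 0 < m) (l : Bool × Bool) (x : Conf m) :
    Dec l x ↔ nrm (lev m l x) < nrm x := by
  rw [nrm_lev hm]
  split_ifs with h <;> simp [h]

/-- Exchange the two generators. -/
def swap (l : Bool × Bool) : Bool × Bool := (!l.1, l.2)

lemma lev_swap (l : Bool × Bool) : lev m (swap l) = flip m * lev m l * flip m := by
  have key : ∀ g : Equiv.Perm (Conf m), flip m * (flip m * g) = g := fun g => by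
    rw [← mul_assoc, flip_mul_self, one_mul]
  obtain ⟨a, b⟩ := l
  cases a <;> cases b <;> simp [swap, lev_ft, lev_ff, lev_tf, lev_tt, mul_assoc, key, flip_mul_self]

lemma lev_swap_flip (l : Bool × Bool) (x : Conf m) :
    lev m (swap l) (flip m x) = flip m (lev m l x) := by
  rw [lev_swap]
  simp [Equiv.Perm.mul_apply, flip_flip]

lemma dec_swap (hm : 0 < m) (l : Bool × Bool) (x : Conf m) :
    Dec (swap l) (flip m x) ↔ Dec l x := by
  rw [dec_iff hm, dec_iff hm, lev_swap_flip, nrm_flip hm, nrm_flip hm]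

lemma not_dec_and_dec (hm : 0 < m) (a b : Bool) (x : Conf m) :
    ¬ (Dec (a, b) x ∧ Dec (a, !b) x) := by
  have h1 := not_up_and_dn_flip hm x
  have h2 := not_up_and_dn_flip hm (flip m x)
  rw [flip_flip] at h2
  cases a <;> cases b <;> simp only [Bool.not_true, Bool.not_false] <;> rintro ⟨h3, h4⟩
  exacts [h2 ⟨h4, h3⟩, h2 ⟨h3, h4⟩, h1 ⟨h4, h3⟩, h1 ⟨h3, h4⟩]

lemma exists_dec (hm : 0 < m) (x : Conf m) (hx : x ≠ base m) : ∃ l, Dec l x := by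
  rcases exists_decrease hm x hx with h | h | h | h
  exacts [⟨(true, true), h⟩, ⟨(false, false), h⟩, ⟨(false, true), h⟩, ⟨(true, false), h⟩]

lemma dec_step (hm : 3 ≤ m) (l l' : Bool × Bool) (x : Conf m) (hl : l'.1 = !l.1) (h : Dec l x)
    (h' : Dec l' x) : ∃ l'', l''.1 = l'.1 ∧ Dec l'' (lev m l x) := by
  have key : ∀ (l l' : Bool × Bool) (x : Conf m), l.1 = true → l'.1 = false → Dec l x →
      Dec l' x → ∃ l'', l''.1 = l'.1 ∧ Dec l'' (lev m l x) := by
    rintro ⟨a, b⟩ ⟨a', b'⟩ x h1 h2 h h'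
    simp only at h1 h2
    subst h1 h2
    cases b
    · rw [lev_tf]
      have := dn_step hm (flip m x) h (by
        rw [flip_flip]; cases b'
        · exact Or.inr h'
        · exact Or.inl h')
      rcases this with h | h
      exacts [⟨(false, false), rfl, h⟩, ⟨(false, true), rfl, h⟩]
    · rw [lev_tt]
      have := up_step hm x h (by
        cases b'
        · exact Or.inr h'
        · exact Or.inl h')
      rcases this with h | h
      · exact ⟨(false, true), rfl, by simpa [Dec, flip_flip] using h⟩
      · exact ⟨(false, false), rfl, h⟩
  rcases hb : l.1 with _ | _
  · obtain ⟨l'', h1, h2⟩ := key (swap l) (swap l') (flip m x) (by simp [swap, hb])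
      (by simp [swap, hl, hb]) ((dec_swap (by omega) _ _).2 h) ((dec_swap (by omega) _ _).2 h')
    rw [lev_swap_flip] at h2
    refine ⟨swap l'', by simp [swap] at h1 ⊢; rw [h1], ?_⟩
    rw [← dec_swap (by omega)]
    simpa [swap] using h2
  · exact key l l' x hb (by rw [hl, hb]; rfl) h h'

lemma gen_pow_base (hm : 3 ≤ m) (n : ℕ) :
    (lev m (true, true) ^ n) (base m) = (0, List.replicate n ⟨1, by omega⟩) := by
  induction n with
  | zero => rfl
  | succ n ih =>
    rw [pow_succ', Equiv.Perm.mul_apply, ih, lev_tt, Equiv.Perm.mul_apply, rot_apply]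
    have := flip_push (m := m) 0 1 (by omega) (List.replicate n ⟨1, by omega⟩)
    rwa [zero_mul] at this

lemma gen_inv_pow_base (hm : 3 ≤ m) (n : ℕ) :
    (lev m (true, false) ^ (n + 1)) (base m) =
      ((-(n + 1 : ℤ)) * m + (m - 1), List.replicate n ⟨m - 1, by omega⟩) := by
  induction n with
  | zero =>
    rw [zero_add, pow_one, lev_tf, Equiv.Perm.mul_apply, flip_base, rot_inv_apply, base]
    simp
    ring
  | succ n ih =>
    rw [pow_succ', Equiv.Perm.mul_apply, ih, lev_tf, Equiv.Perm.mul_apply,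
      flip_push _ _ (by omega), rot_inv_apply]
    ext1
    · simp only; push_cast; ring
    · rfl

lemma not_dec_of_pow (hm : 3 ≤ m) (b : Bool) (n : ℕ) (y : Bool) (l l' : Bool × Bool)
    (hl : l.1 = !y) (hl' : l'.1 = y) :
    ¬ Dec l' (lev m l ((lev m (y, b) ^ n) (base m))) := by
  have key : ∀ (b b1 b2 : Bool) (n : ℕ),
      ¬ Dec (true, b2) (lev m (false, b1) ((lev m (true, b) ^ n) (base m))) := by
    intro b b1 b2 n
    have hpos : ∀ n : ℕ, ¬ Dec (true, b2) (lev m (false, b1) ((lev m (true, true) ^ n) (base m))) := by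
      intro n
      rw [gen_pow_base hm]
      cases b1
      · have e : ((0 : ℤ), List.replicate n (⟨1, by omega⟩ : Run m)).1 - 1 =
          (-1) * m + (m - 1) := by simp only; ring
        rw [lev_ff, Equiv.Perm.mul_apply, rot_inv_apply, e]
        cases b2
        · simp only [Dec, flip_flip]
          rw [dn_iff _ _ ⟨by omega, by omega⟩, cnt_replicate, if_neg (by simp only; omega)]
          omega
        · simp only [Dec]
          rw [flip_push _ _ ⟨by omega, by omega⟩, up_iff_zero (by omega)]
          simp only [List.length_cons, List.length_replicate]
          push_cast
          omega
      · rw [lev_ft, Equiv.Perm.mul_apply]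
        cases n with
        | zero =>
          have := flip_base (m := m)
          rw [List.replicate_zero, show ((0 : ℤ), ([] : List (Run m))) = base m from rfl, this,
            rot_apply, show (base m).1 + 1 = 0 * (m : ℤ) + 1 by simp [base]]
          cases b2
          · simp only [Dec, base]
            rw [flip_push _ _ ⟨by omega, by omega⟩, dn_iff_zero (by omega)]
            omega
          · simp only [Dec, base]
            rw [up_iff _ _ ⟨by omega, by omega⟩]
            simp [cnt]
        | succ n =>
          have := flip_pop (m := m) 0 ⟨1, by omega⟩ (List.replicate n ⟨1, by omega⟩)
          rw [zero_mul] at this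
          rw [List.replicate_succ, this, rot_apply,
            show ∀ z : ℤ, 0 + z + 1 = 0 * (m : ℤ) + (z + 1) by intro z; ring]
          simp only
          cases b2
          · simp only [Dec]
            rw [flip_push _ _ ⟨by omega, by omega⟩, dn_iff_zero (by omega)]
            omega
          · simp only [Dec]
            rw [up_iff _ _ ⟨by omega, by omega⟩]
            have := cnt_nonneg (List.replicate n (⟨1, by omega⟩ : Run m)) (1 + 1)
            omega
    cases b
    · cases n with
      | zero => exact hpos 0
      | succ n =>
        rw [gen_inv_pow_base hm]
        cases b1
        · rw [lev_ff, Equiv.Perm.mul_apply, rot_inv_apply]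
          simp only [add_sub_assoc]
          cases b2
          · simp only [Dec, flip_flip]
            rw [dn_iff _ _ ⟨by omega, by omega⟩, cnt_replicate, if_pos (by simp only; omega)]
            omega
          · simp only [Dec]
            rw [flip_push _ _ ⟨by omega, by omega⟩, up_iff_zero (by omega)]
            simp only [List.length_cons, List.length_replicate]
            push_cast
            omega
        · rw [lev_ft, Equiv.Perm.mul_apply, flip_push _ _ ⟨by omega, by omega⟩, rot_apply]
          simp only
          cases b2
          · simp only [Dec]
            rw [flip_push _ _ ⟨by omega, by omega⟩, dn_iff_zero (by omega)]
            omega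
          · simp only [Dec]
            rw [up_iff _ _ ⟨by omega, by omega⟩, ← List.replicate_succ, cnt_replicate,
              if_pos (by simp only; omega)]
            push_cast
            omega
    · exact hpos n
  obtain ⟨a, b1⟩ := l
  obtain ⟨a', b2⟩ := l'
  simp only at hl hl'
  subst hl hl'
  cases a'
  · intro h
    refine key b b1 b2 n ?_
    have e : ∀ (n : ℕ), (lev m (true, b) ^ n) (base m) =
        flip m ((lev m (false, b) ^ n) (base m)) := by
      intro n
      induction n with
      | zero => simp [flip_base]
      | succ n ih =>
        rw [pow_succ', Equiv.Perm.mul_apply, ih, pow_succ', Equiv.Perm.mul_apply, ← lev_swap_flip]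
        rfl
    rw [e, show ((false, b1) : Bool × Bool) = swap (true, b1) from rfl, lev_swap_flip,
      show ((true, b2) : Bool × Bool) = swap (false, b2) from rfl, dec_swap (by omega)]
    exact h
  · exact key b b1 b2 n

end Dihedral

namespace Dihedral

variable {m : ℕ}

/-- The length of the group element represented by a word. -/
noncomputable def len (m : ℕ) (v : Word Bool) : ℤ := nrm (ev m v (base m))

/-- A word is geodesic if it has minimal length among the words representing the same element. -/
def Geo (m : ℕ) (v : Word Bool) : Prop := (v.length : ℤ) = len m v

lemma hgt_zero_add_hgt (hm : 0 < m) (x : Conf m) : hgt 0 x + hgt m x = 0 := by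
  have h1 : ∀ T : List (Run m), tailHgt 0 T + tailHgt m T = 0 := by
    intro T
    induction T with
    | nil => rfl
    | cons t T ih =>
      have := t.2
      simp only [tailHgt]
      omega
  obtain ⟨k, j, T, h, rfl⟩ := conf_divmod hm x
  rw [hgt_eq _ _ _ ⟨le_rfl, by omega⟩ ⟨h.1, h.2.le⟩ hm,
    hgt_eq _ _ _ ⟨by omega, le_rfl⟩ ⟨h.1, h.2.le⟩ hm, min_eq_right (by omega),
    min_eq_left (by omega)]
  linarith [h1 T]

lemma nrm_nonneg (hm : 0 < m) (x : Conf m) : 0 ≤ nrm x := by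
  have h1 := hgt_zero_add_hgt hm x
  have h2 := hgt_le_nrm x 0 ⟨le_rfl, by omega⟩
  have h3 := hgt_le_nrm x m ⟨by omega, le_rfl⟩
  omega

lemma nrm_ev_le (hm : 0 < m) (v : Word Bool) (x : Conf m) :
    nrm (ev m v x) ≤ v.length + nrm x := by
  induction v with
  | nil => simp
  | cons l v ih =>
    rw [ev_cons, Equiv.Perm.mul_apply, nrm_lev hm, List.length_cons]
    push_cast
    split_ifs <;> omega

lemma len_le_length (hm : 0 < m) (v : Word Bool) : len m v ≤ v.length := by
  have := nrm_ev_le hm v (base m)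
  rwa [nrm_base hm, add_zero] at this

lemma len_congr {u v : Word Bool} (h : ev m u = ev m v) : len m u = len m v := by
  rw [len, h, len]

lemma len_cons (hm : 0 < m) (l : Bool × Bool) (v : Word Bool) :
    len m (l :: v) = len m v + if Dec l (ev m v (base m)) then -1 else 1 := by
  rw [len, ev_cons, Equiv.Perm.mul_apply, nrm_lev hm, len]

lemma geo_nil (hm : 0 < m) : Geo m [] := by
  simp [Geo, len, nrm_base hm]

lemma geo_cons (hm : 0 < m) (l : Bool × Bool) (v : Word Bool) :
    Geo m (l :: v) ↔ Geo m v ∧ ¬ Dec l (ev m v (base m)) := by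
  have := len_le_length hm v
  rw [Geo, Geo, len_cons hm, List.length_cons]
  push_cast
  split_ifs with h <;> simp only [h, not_true, not_false_iff, and_true, and_false, iff_false] <;>
    omega

lemma Geo.append_right (hm : 0 < m) {u v : Word Bool} (h : Geo m (u ++ v)) : Geo m v := by
  induction u with
  | nil => exact h
  | cons l u ih => exact ih ((geo_cons hm _ _).1 h).1

lemma ev_not_cons (a b : Bool) (v : Word Bool) : ev m ((a, b) :: (a, !b) :: v) = ev m v := by
  rw [ev_cons, ev_cons, lev_not, mul_inv_cancel_left]

lemma ev_not_cons' (a b : Bool) (v : Word Bool) : ev m ((a, !b) :: (a, b) :: v) = ev m v := by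
  have := ev_not_cons (m := m) a (!b) v
  rwa [Bool.not_not] at this

lemma exists_geo (hm : 0 < m) (v : Word Bool) : ∃ v', ev m v' = ev m v ∧ Geo m v' := by
  obtain ⟨n, hn⟩ : ∃ n : ℕ, len m v = n := ⟨_, (Int.toNat_of_nonneg (nrm_nonneg hm _)).symm⟩
  induction n generalizing v with
  | zero =>
    refine ⟨[], ev_eq_of_base hm ?_, geo_nil hm⟩
    by_contra hne
    obtain ⟨l, hl⟩ := exists_dec hm (ev m v (base m)) (fun h => hne h.symm)
    have h1 := len_cons hm l v
    have h2 : 0 ≤ len m (l :: v) := nrm_nonneg hm _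
    rw [if_pos hl, hn] at h1
    omega
  | succ n ih =>
    obtain ⟨l, hl⟩ := exists_dec hm (ev m v (base m)) (by
      intro h
      rw [len, h, nrm_base hm] at hn
      omega)
    have h1 := len_cons hm l v
    rw [if_pos hl, hn] at h1
    obtain ⟨v', h2, h3⟩ := ih (l :: v) (by rw [h1]; push_cast; ring)
    obtain ⟨a, b⟩ := l
    have h4 : ev m ((a, !b) :: v') = ev m v := by
      rw [ev_cons, h2, ← ev_cons, ev_not_cons']
    refine ⟨(a, !b) :: v', h4, ?_⟩
    have h5 : (v'.length : ℤ) = _ := h3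
    rw [Geo, len_congr h4, hn, List.length_cons]
    push_cast
    rw [h5, len_congr h2, h1]
    push_cast
    ring

lemma Geo.append_left (hm : 0 < m) {u v : Word Bool} (h : Geo m (u ++ v)) : Geo m u := by
  obtain ⟨u', h1, h2⟩ := exists_geo hm u
  have h3 : ev m (u' ++ v) = ev m (u ++ v) := by rw [ev_append, h1, ev_append]
  have h4 := len_le_length hm (u' ++ v)
  rw [len_congr h3, ← h, List.length_append, List.length_append] at h4
  have h5 := len_le_length hm u
  rw [Geo] at h2 ⊢
  rw [len_congr h1] at h2
  push_cast at h4
  omega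

lemma Geo.length_eq {u v : Word Bool} (hu : Geo m u) (hv : Geo m v) (h : ev m u = ev m v) :
    u.length = v.length := by
  have := len_congr h
  rw [← hu, ← hv] at this
  exact_mod_cast this

lemma Geo.length_le (hm : 0 < m) {u v : Word Bool} (hu : Geo m u) (h : ev m u = ev m v) :
    u.length ≤ v.length := by
  have h1 := len_le_length hm v
  rw [← len_congr h, ← hu] at h1
  exact_mod_cast h1

lemma not_geo_cancel (hm : 0 < m) (a b : Bool) (v : Word Bool) :
    ¬ Geo m ((a, b) :: (a, !b) :: v) := by
  intro h
  have := h.length_le hm (ev_not_cons a b v)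
  simp at this

lemma geo_cons_or (hm : 0 < m) (a b : Bool) {h : Word Bool} (hh : Geo m h) :
    Geo m ((a, b) :: h) ∨ ∃ h', Geo m ((a, !b) :: h') ∧ ev m ((a, !b) :: h') = ev m h := by
  by_cases hd : Dec (a, b) (ev m h (base m))
  · right
    obtain ⟨h', h1, h2⟩ := exists_geo hm ((a, b) :: h)
    have h3 : ev m ((a, !b) :: h') = ev m h := by rw [ev_cons, h1, ← ev_cons, ev_not_cons']
    refine ⟨h', ?_, h3⟩
    have h4 := len_cons hm (a, b) h
    rw [if_pos hd, ← len_congr h1, ← h2, ← hh] at h4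
    rw [Geo, len_congr h3, ← hh, List.length_cons]
    push_cast
    omega
  · exact Or.inl ((geo_cons hm _ _).2 ⟨hh, hd⟩)

/-- The inverse of the first letter of a geodesic decreases the length. -/
lemma dec_of_geo (hm : 0 < m) {a b : Bool} {h : Word Bool} (hh : Geo m ((a, b) :: h)) :
    Dec (a, !b) (ev m ((a, b) :: h) (base m)) := by
  by_contra hd
  exact not_geo_cancel hm a (!b) h (by
    rw [Bool.not_not]; exact (geo_cons hm _ _).2 ⟨hh, hd⟩)

lemma not_geo_both (hm : 0 < m) {a b : Bool} {h h' : Word Bool} (h1 : Geo m ((a, b) :: h))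
    (h2 : Geo m ((a, !b) :: h')) (e : ev m ((a, b) :: h) = ev m ((a, !b) :: h')) : False := by
  have h3 := dec_of_geo hm h1
  have h4 := dec_of_geo hm h2
  rw [← e, Bool.not_not] at h4
  exact not_dec_and_dec hm a b _ ⟨h4, h3⟩

lemma geo_of_dec (hm : 0 < m) {a b : Bool} {h : Word Bool} (hh : Geo m h)
    (hd : Dec (a, !b) (ev m h (base m))) :
    ∃ h', Geo m ((a, b) :: h') ∧ ev m ((a, b) :: h') = ev m h := by
  have h1 := geo_cons_or hm a (!b) hh
  rw [geo_cons hm, Bool.not_not] at h1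
  exact h1.resolve_left fun h => h.2 hd

/-- If two geodesics representing the same element start with letters of distinct names, then
the remainder of the first one has a geodesic starting with the name of the second,
followed by the name of the first. -/
lemma geo_fork (hm : 3 ≤ m) {a d : Bool × Bool} {h h' : Word Bool} (ha : Geo m (a :: h))
    (hd : Geo m (d :: h')) (hne : a.1 ≠ d.1) (e : ev m (a :: h) = ev m (d :: h')) :
    ∃ (d' e' : Bool × Bool) (k : ℕ) (h₃ : Word Bool), d'.1 = d.1 ∧ e'.1 = a.1 ∧
      Geo m (List.replicate (k + 1) d' ++ e' :: h₃) ∧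
      ev m (List.replicate (k + 1) d' ++ e' :: h₃) = ev m h := by
  have hm0 : 0 < m := by omega
  obtain ⟨a, b⟩ := a
  obtain ⟨d, c⟩ := d
  simp only at hne ⊢
  have h1 := dec_of_geo hm0 ha
  have h2 := dec_of_geo hm0 hd
  rw [← e] at h2
  obtain ⟨⟨d₁, c'⟩, h3, h4⟩ := dec_step hm (a, !b) (d, !c) _ (Bool.eq_not.2 hne.symm) h1 h2
  simp only at h3
  subst h3
  rw [← Equiv.Perm.mul_apply, ← ev_cons, ev_not_cons'] at h4
  rw [← Bool.not_not c'] at h4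
  obtain ⟨w, h5, h6⟩ := geo_of_dec hm0 ((geo_cons hm0 _ _).1 ha).1 h4
  have key : ∀ (w : Word Bool), ∃ k, w = List.replicate k (d₁, !c') ∨
      ∃ e' w', w = List.replicate k (d₁, !c') ++ e' :: w' ∧ e' ≠ (d₁, !c') := by
    intro w
    induction w with
    | nil => exact ⟨0, Or.inl rfl⟩
    | cons l w ih =>
      by_cases hl : l = (d₁, !c')
      · obtain ⟨k, rfl | ⟨e', w', rfl, h⟩⟩ := ih
        · exact ⟨k + 1, Or.inl (by rw [hl]; rfl)⟩
        · exact ⟨k + 1, Or.inr ⟨e', w', by rw [hl]; rfl, h⟩⟩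
      · exact ⟨0, Or.inr ⟨l, w, rfl, hl⟩⟩
  obtain ⟨k, hk | ⟨⟨e₁, c''⟩, w', hk, hne'⟩⟩ := key w
  · exfalso
    have h7 : ev m h = lev m (d₁, !c') ^ (k + 1) := by
      rw [← h6, hk, ← List.replicate_succ, ev, List.map_replicate, List.prod_replicate]
    rw [ev_cons, Equiv.Perm.mul_apply, h7] at h2
    exact not_dec_of_pow hm _ _ _ _ _ (Bool.eq_not.2 hne) rfl h2
  · subst hk
    refine ⟨(d₁, !c'), (e₁, c''), k, w', rfl, ?_, h5, h6⟩
    simp only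
    by_contra hc
    have h7 : e₁ = d₁ := by
      revert hc hne; cases e₁ <;> cases d₁ <;> cases a <;> simp
    subst h7
    have h8 : c'' = !!c' := by
      revert hne'; cases c'' <;> cases c' <;> simp
    subst h8
    have h9 : Geo m (List.replicate k (e₁, !c') ++ (e₁, !c') :: (e₁, !!c') :: w') := by
      rw [← List.cons_append, ← List.replicate_succ, List.replicate_succ', List.append_assoc] at h5
      exact h5
    exact not_geo_cancel hm0 _ _ _ (h9.append_right hm0)

end Dihedral

/-! ### Families of dihedral pairs -/

/-- A family of pairs of letters with labels at least `3`, such that distinct members share at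
most one letter. -/
structure PairSystem (S : Type*) where
  ι : Type*
  emb : ι → Bool → S
  M : ι → ℕ
  three_le : ∀ i, 3 ≤ M i
  inj : ∀ i, Function.Injective (emb i)
  unique : ∀ i j (x y x' y' : Bool), x ≠ y → emb i x = emb j x' → emb i y = emb j y' → i = j

namespace PairSystem

open Dihedral

variable (P : PairSystem S)

/-- The signed letter attached to a signed letter of a pair. -/
def em (i : P.ι) (l : Bool × Bool) : S × Bool := (P.emb i l.1, l.2)

/-- The word attached to a word in a pair. -/
def emw (i : P.ι) (v : Word Bool) : Word S := v.map (P.em i)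

@[simp] lemma emw_nil (i : P.ι) : P.emw i [] = [] := rfl

@[simp] lemma emw_cons (i : P.ι) (l : Bool × Bool) (v : Word Bool) :
    P.emw i (l :: v) = P.em i l :: P.emw i v := rfl

@[simp] lemma emw_append (i : P.ι) (u v : Word Bool) :
    P.emw i (u ++ v) = P.emw i u ++ P.emw i v := List.map_append

@[simp] lemma length_emw (i : P.ι) (v : Word Bool) : (P.emw i v).length = v.length :=
  List.length_map _

lemma emw_replicate (i : P.ι) (n : ℕ) (l : Bool × Bool) :
    P.emw i (List.replicate n l) = List.replicate n (P.em i l) := List.map_replicate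

lemma em_injective (i : P.ι) : Function.Injective (P.em i) := by
  rintro ⟨a, b⟩ ⟨a', b'⟩ h
  simp only [em, Prod.mk.injEq] at h
  rw [P.inj i h.1, h.2]

lemma M_pos (i : P.ι) : 0 < P.M i := by have := P.three_le i; omega

/-- Replacement of a geodesic factor in a pair by another geodesic. -/
def Move (w w' : Word S) : Prop :=
  ∃ (u z : Word S) (i : P.ι) (v v' : Word Bool), Geo (P.M i) v ∧ Geo (P.M i) v' ∧
    ev (P.M i) v = ev (P.M i) v' ∧ w = u ++ P.emw i v ++ z ∧ w' = u ++ P.emw i v' ++ z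

/-- Equivalence generated by replacements of geodesic factors. -/
def Eqv : Word S → Word S → Prop := Relation.ReflTransGen P.Move

variable {P}

lemma Eqv.refl (w : Word S) : P.Eqv w w := Relation.ReflTransGen.refl

lemma Eqv.trans {w₁ w₂ w₃ : Word S} (h : P.Eqv w₁ w₂) (h' : P.Eqv w₂ w₃) : P.Eqv w₁ w₃ :=
  Relation.ReflTransGen.trans h h'

lemma Eqv.symm {w w' : Word S} (h : P.Eqv w w') : P.Eqv w' w := by
  induction h with
  | refl => exact Eqv.refl _
  | tail _ h ih =>
    obtain ⟨u, z, i, v, v', h1, h2, h3, h4, h5⟩ := h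
    exact Relation.ReflTransGen.head ⟨u, z, i, v', v, h2, h1, h3.symm, h5, h4⟩ ih

lemma Eqv.length_eq {w w' : Word S} (h : P.Eqv w w') : w.length = w'.length := by
  induction h with
  | refl => rfl
  | tail _ h ih =>
    obtain ⟨u, z, i, v, v', h1, h2, h3, rfl, rfl⟩ := h
    rw [ih]
    simp [h1.length_eq h2 h3]

lemma Eqv.context {w w' : Word S} (h : P.Eqv w w') (u z : Word S) :
    P.Eqv (u ++ w ++ z) (u ++ w' ++ z) := by
  induction h with
  | refl => exact Eqv.refl _
  | tail _ h ih =>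
    obtain ⟨u', z', i, v, v', h1, h2, h3, rfl, rfl⟩ := h
    exact Relation.ReflTransGen.tail ih ⟨u ++ u', z' ++ z, i, v, v', h1, h2, h3, by simp, by simp⟩

lemma Eqv.append_left {w w' : Word S} (h : P.Eqv w w') (u : Word S) :
    P.Eqv (u ++ w) (u ++ w') := by
  simpa using h.context u []

lemma Eqv.append_right {w w' : Word S} (h : P.Eqv w w') (z : Word S) :
    P.Eqv (w ++ z) (w' ++ z) := by
  simpa using h.context [] z

lemma Eqv.cons {w w' : Word S} (h : P.Eqv w w') (a : S × Bool) :
    P.Eqv (a :: w) (a :: w') := h.append_left [a]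

lemma eqv_emw {i : P.ι} {v v' : Word Bool} (h1 : Geo (P.M i) v) (h2 : Geo (P.M i) v')
    (h3 : ev (P.M i) v = ev (P.M i) v') : P.Eqv (P.emw i v) (P.emw i v') :=
  Relation.ReflTransGen.single ⟨[], [], i, v, v', h1, h2, h3, by simp, by simp⟩

variable (P)

/-- Reduced words: those not equivalent to a word with a cancellation. -/
def Red (w : Word S) : Prop :=
  ∀ (u z : Word S) (x : S) (b : Bool), ¬ P.Eqv w (u ++ (x, b) :: (x, !b) :: z)

/-- `w` is equivalent to a word starting with `a`. -/
def St (w : Word S) (a : S × Bool) : Prop := ∃ y, P.Eqv w (a :: y)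

/-- No word equivalent to `x` starts with a letter of the pair `i`. -/
def Xi (i : P.ι) (x : Word S) : Prop := ∀ l : Bool × Bool, ¬ P.St x (P.em i l)

variable {P}

lemma red_nil : P.Red [] := by
  intro u z x b h
  have := h.length_eq
  simp at this

lemma Red.congr {w w' : Word S} (h : P.Red w) (e : P.Eqv w w') : P.Red w' :=
  fun u z x b h' => h u z x b (e.trans h')

lemma Red.infix {u w z : Word S} (h : P.Red (u ++ w ++ z)) : P.Red w := by
  intro u' z' x b h'
  refine h (u ++ u') (z' ++ z) x b ?_
  simpa using h'.context u z

lemma Red.append_right {u w : Word S} (h : P.Red (u ++ w)) : P.Red w := by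
  have : P.Red (u ++ w ++ []) := by simpa using h
  exact this.infix

lemma Red.append_left {u w : Word S} (h : P.Red (u ++ w)) : P.Red u := by
  have : P.Red ([] ++ u ++ w) := by simpa using h
  exact this.infix

lemma Red.tail {a : S × Bool} {w : Word S} (h : P.Red (a :: w)) : P.Red w :=
  Red.append_right (u := [a]) h

lemma Red.not_st {a : S} {b : Bool} {w : Word S} (h : P.Red ((a, b) :: w)) :
    ¬ P.St w (a, !b) := by
  rintro ⟨y, hy⟩
  exact h [] y a b (hy.cons _)

lemma St.congr {w w' : Word S} {a : S × Bool} (h : P.St w a) (e : P.Eqv w w') : P.St w' a := by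
  obtain ⟨y, hy⟩ := h
  exact ⟨y, e.symm.trans hy⟩

lemma Xi.congr {i : P.ι} {w w' : Word S} (h : P.Xi i w) (e : P.Eqv w w') : P.Xi i w' :=
  fun l hl => h l (hl.congr e.symm)

lemma geo_of_red {i : P.ι} {v : Word Bool} (h : P.Red (P.emw i v)) : Geo (P.M i) v := by
  induction v with
  | nil => exact geo_nil (P.M_pos i)
  | cons l v ih =>
    obtain ⟨a, b⟩ := l
    have hv := ih h.tail
    rcases geo_cons_or (P.M_pos i) a b hv with h1 | ⟨h', h1, h2⟩
    · exact h1
    · exact absurd ⟨_, eqv_emw hv h1 h2.symm⟩ (Red.not_st h)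

lemma exists_decomp (i : P.ι) {y : Word S} (hy : P.Red y) :
    ∃ h x, P.Xi i x ∧ Geo (P.M i) h ∧ P.Eqv y (P.emw i h ++ x) := by
  induction hn : y.length generalizing y with
  | zero =>
    refine ⟨[], y, ?_, geo_nil (P.M_pos i), Eqv.refl _⟩
    rintro l ⟨y', h⟩
    have := h.length_eq
    simp [hn] at this
  | succ n ih =>
    by_cases hX : P.Xi i y
    · exact ⟨[], y, hX, geo_nil (P.M_pos i), Eqv.refl _⟩
    · simp only [Xi, not_forall, not_not] at hX
      obtain ⟨l, y', h1⟩ := hX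
      have h2 := h1.length_eq
      rw [hn, List.length_cons] at h2
      have h3 := hy.congr h1
      obtain ⟨h, x, h4, h5, h6⟩ := ih h3.tail (by omega)
      have h7 : P.Eqv y (P.emw i (l :: h) ++ x) := h1.trans (h6.cons _)
      exact ⟨l :: h, x, h4, geo_of_red (hy.congr h7).append_left, h7⟩

end PairSystem

namespace PairSystem

open Dihedral

variable (P : PairSystem S)

/-- The words `a :: y` and `b :: y'` have distinct first names and are related by a single
equivalence in a pair. -/
def EndForm (a : S × Bool) (y : Word S) (b : S × Bool) (y' : Word S) : Prop :=
  ∃ (i : P.ι) (α β : Bool × Bool) (h h' : Word Bool) (x : Word S),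
    a = P.em i α ∧ b = P.em i β ∧ α.1 ≠ β.1 ∧ P.Xi i x ∧
    Geo (P.M i) (α :: h) ∧ Geo (P.M i) (β :: h') ∧
    ev (P.M i) (α :: h) = ev (P.M i) (β :: h') ∧
    P.Eqv y (P.emw i h ++ x) ∧ P.Eqv y' (P.emw i h' ++ x)

/-- The possible relations between `a :: y` and `b :: y'` when they are equivalent. -/
def HeadRel (a : S × Bool) (y : Word S) (b : S × Bool) (y' : Word S) : Prop :=
  (a = b ∧ P.Eqv y y') ∨ P.EndForm a y b y'

/-- The structure of equivalences between reduced words, up to length `n`. -/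
structure Good (n : ℕ) : Prop where
  headRel : ∀ (a b : S × Bool) (y y' : Word S), (a :: y).length ≤ n → P.Red (a :: y) →
    P.Eqv (a :: y) (b :: y') → P.HeadRel a y b y'
  red_cons : ∀ (a : S) (e : Bool) (w : Word S), w.length < n → P.Red w → ¬ P.St w (a, !e) →
    P.Red ((a, e) :: w)

variable {P}

lemma emb_ne {i : P.ι} {x y : Bool} (h : x ≠ y) : P.emb i x ≠ P.emb i y :=
  fun e => h (P.inj i e)

lemma Good.unique {n : ℕ} (G : P.Good n) {i : P.ι} {h h' : Word Bool} {x x' : Word S}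
    (hn : (P.emw i h ++ x).length ≤ n) (hr : P.Red (P.emw i h ++ x)) (hx : P.Xi i x)
    (hx' : P.Xi i x') (hh : Geo (P.M i) h) (hh' : Geo (P.M i) h')
    (e : P.Eqv (P.emw i h ++ x) (P.emw i h' ++ x')) :
    P.Eqv x x' ∧ ev (P.M i) h = ev (P.M i) h' := by
  have hm := P.M_pos i
  induction hk : (P.emw i h ++ x).length using Nat.strong_induction_on
    generalizing h h' x x' with
  | _ k ih =>
  cases h with
  | nil =>
    cases h' with
    | nil => exact ⟨e, rfl⟩
    | cons β h' => exact absurd ⟨_, e⟩ (hx β)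
  | cons α h =>
    cases h' with
    | nil => exact absurd ⟨_, e.symm⟩ (hx' α)
    | cons β h' =>
      have hl := e.length_eq
      simp only [emw_cons, List.cons_append, List.length_cons] at hl hn hk
      have hg := ((geo_cons hm _ _).1 hh).1
      have hg' := ((geo_cons hm _ _).1 hh').1
      have hr' : P.Red (P.emw i h ++ x) := hr.tail
      rcases G.headRel _ _ _ _ hn hr e with ⟨e1, e2⟩ | ⟨j, γ, δ, g, g', z, e1, e2, hne, hz, h1, h2,
        h3, h4, h5⟩
      · obtain rfl := P.em_injective i e1
        obtain ⟨h6, h7⟩ := ih _ (by omega) (by omega) hr' hx hx' hg hg' e2 rfl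
        exact ⟨h6, by rw [ev_cons, ev_cons, h7]⟩
      · obtain rfl : i = j := by
          have e1' := congrArg Prod.fst e1
          have e2' := congrArg Prod.fst e2
          refine (P.unique j i γ.1 δ.1 α.1 β.1 hne e1'.symm e2'.symm).symm
        obtain rfl := P.em_injective i e1
        obtain rfl := P.em_injective i e2
        obtain ⟨h6, h7⟩ := ih _ (by omega) (by omega) hr' hx hz hg ((geo_cons hm _ _).1 h1).1 h4 rfl
        have hr'' : P.Red (P.emw i h' ++ x') := (hr.congr e).tail
        obtain ⟨h8, h9⟩ := ih _ (by omega) (by omega) hr'' hx' hz hg' ((geo_cons hm _ _).1 h2).1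
          h5 rfl
        refine ⟨h6.trans h8.symm, ?_⟩
        rw [ev_cons, h7, ← ev_cons, h3, ev_cons, ev_cons, h9]

lemma Good.not_st {n : ℕ} (G : P.Good n) {i : P.ι} {a e : Bool} {h : Word Bool} {x : Word S}
    (hn : (P.emw i h ++ x).length ≤ n) (hr : P.Red (P.emw i h ++ x)) (hx : P.Xi i x)
    (hh : Geo (P.M i) ((a, e) :: h)) : ¬ P.St (P.emw i h ++ x) (P.em i (a, !e)) := by
  rintro ⟨y, hy⟩
  have hm := P.M_pos i
  have hr' := hr.congr hy
  obtain ⟨g, x', h1, h2, h3⟩ := exists_decomp i hr'.tail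
  have h4 : P.Eqv (P.emw i h ++ x) (P.emw i ((a, !e) :: g) ++ x') := hy.trans (h3.cons _)
  have h5 : Geo (P.M i) ((a, !e) :: g) := geo_of_red (hr.congr h4).append_left
  have h6 := (G.unique hn hr hx h1 ((geo_cons hm _ _).1 hh).1 h5 h4).2
  have h7 : ev (P.M i) ((a, e) :: h) = ev (P.M i) g := by
    rw [ev_cons, h6, ← ev_cons, ev_not_cons]
  have h8 := hh.length_le hm h7
  have h9 := ((geo_cons hm _ _).1 hh).1.length_eq h5 h6
  simp at h8 h9
  omega

lemma Good.red_append {n : ℕ} (G : P.Good n) {i : P.ι} {h : Word Bool} {x : Word S}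
    (hn : (P.emw i h ++ x).length ≤ n) (hr : P.Red x) (hx : P.Xi i x) (hh : Geo (P.M i) h) :
    P.Red (P.emw i h ++ x) := by
  induction h with
  | nil => exact hr
  | cons α h ih =>
    obtain ⟨a, e⟩ := α
    simp only [emw_cons, List.cons_append, List.length_cons] at hn
    have h1 := ih (by omega) ((geo_cons (P.M_pos i) _ _).1 hh).1
    exact G.red_cons _ _ (P.emw i h ++ x) (by omega) h1 (G.not_st (by omega) h1 hx hh)

lemma Good.no_triple {n : ℕ} (G : P.Good n) {c : Word S} (hn : c.length ≤ n) (hr : P.Red c)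
    {a b d : S × Bool} {k : ℕ} {rest : Word S}
    (e : P.Eqv c (List.replicate (k + 1) a ++ b :: rest)) (hd : P.St c d)
    (hab : a.1 ≠ b.1) (hbd : b.1 ≠ d.1) (had : a.1 ≠ d.1) : False := by
  induction hk : c.length using Nat.strong_induction_on generalizing c a b d k rest with
  | _ l ih =>
  subst hk
  obtain ⟨q, hq⟩ := hd
  have hl := e.length_eq
  have hr1 := hr.congr e
  rw [List.replicate_succ, List.cons_append] at hr1 e hl
  rcases G.headRel _ _ _ _ (hl ▸ hn) hr1 (e.symm.trans hq) with ⟨e1, -⟩ |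
    ⟨i, α, β, h, h', x, e1, e2, hne, hz, h1, h2, h3, h4, h5⟩
  · exact had (congrArg Prod.fst e1)
  · obtain ⟨δ, ε, k', h₃, h6, h7, h8, h9⟩ := geo_fork (P.three_le i) h1 h2 hne h3
    have h10 := h4.trans ((eqv_emw ((geo_cons (P.M_pos i) _ _).1 h1).1 h8 h9.symm).append_right x)
    rw [emw_append, emw_replicate, emw_cons, List.append_assoc, List.cons_append] at h10
    have h11 : (P.em i δ).1 = d.1 := by rw [e2]; simp [em, h6]
    have h12 : (P.em i ε).1 = a.1 := by rw [e1]; simp [em, h7]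
    rw [List.length_cons] at hl
    cases k with
    | zero =>
      refine ih _ ?_ ?_ hr1.tail h10 (d := b) ⟨rest, Eqv.refl _⟩ ?_ ?_ ?_ rfl
      · omega
      · omega
      · rw [h11, h12]; exact had.symm
      · rw [h12]; exact hab
      · rw [h11]; exact hbd.symm
    | succ k =>
      refine ih _ ?_ ?_ hr1.tail (Eqv.refl _) (d := P.em i δ) ⟨_, h10⟩ hab ?_ ?_ rfl
      · omega
      · omega
      · rw [h11]; exact hbd
      · rw [h11]; exact had

lemma Good.headRel_trans {n : ℕ} (G : P.Good n) {a b c : S × Bool} {y₁ y₂ y₃ : Word S}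
    (hn : y₂.length ≤ n) (hr : P.Red y₂) (h₁ : P.HeadRel a y₁ b y₂) (h₂ : P.HeadRel b y₂ c y₃) :
    P.HeadRel a y₁ c y₃ := by
  rcases h₁ with ⟨rfl, e⟩ | ⟨i, α, β, h, h', x, rfl, rfl, hne, hx, h1, h2, h3, h4, h5⟩
  · rcases h₂ with ⟨rfl, e'⟩ | ⟨i, α, β, h, h', x, e1, e2, hne, hx, h1, h2, h3, h4, h5⟩
    · exact Or.inl ⟨rfl, e.trans e'⟩
    · exact Or.inr ⟨i, α, β, h, h', x, e1, e2, hne, hx, h1, h2, h3, e.trans h4, h5⟩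
  · rcases h₂ with ⟨rfl, e'⟩ | ⟨j, γ, δ, g, g', z, e1, rfl, hne', hz, h6, h7, h8, h9, h10⟩
    · exact Or.inr ⟨i, α, β, h, h', x, rfl, rfl, hne, hx, h1, h2, h3, h4, e'.symm.trans h5⟩
    · by_cases hij : i = j
      · subst hij
        left
        have hm := P.M_pos i
        obtain rfl := P.em_injective i e1
        obtain ⟨h11, h12⟩ := G.unique (h5.length_eq ▸ hn) (hr.congr h5) hx hz
          ((geo_cons hm _ _).1 h2).1 ((geo_cons hm _ _).1 h6).1 (h5.symm.trans h9)
        have h13 : ev (P.M i) (α :: h) = ev (P.M i) (δ :: g') := by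
          rw [h3, ev_cons, h12, ← ev_cons, h8]
        have h14 : α = δ := by
          obtain ⟨a, e⟩ := α
          obtain ⟨d, e'⟩ := δ
          have h15 : a = d := by
            revert hne hne'
            cases a <;> cases d <;> cases β.1 <;> simp
          subst h15
          by_cases hee : e = e'
          · rw [hee]
          · obtain rfl : e' = !e := Bool.eq_not.2 (Ne.symm hee)
            exact (not_geo_both hm h1 h7 h13).elim
        subst h14
        refine ⟨rfl, h4.trans (Eqv.trans ?_ h10.symm)⟩
        refine Eqv.trans ((eqv_emw ((geo_cons hm _ _).1 h1).1 ((geo_cons hm _ _).1 h7).1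
          ?_).append_right x) (h11.append_left _)
        rw [ev_cons, ev_cons] at h13
        exact mul_left_cancel h13
      · exfalso
        obtain ⟨δ', ε, k, h₃, h11, h12, h13, h14⟩ :=
          geo_fork (P.three_le i) h2 h1 hne.symm h3.symm
        have h15 := h5.trans ((eqv_emw ((geo_cons (P.M_pos i) _ _).1 h2).1 h13
          h14.symm).append_right x)
        rw [emw_append, emw_replicate, emw_cons, List.append_assoc, List.cons_append] at h15
        obtain ⟨δ'', ε', k', h₃', h16, h17, h18, h19⟩ :=
          geo_fork (P.three_le j) h6 h7 hne' h8
        have h20 := h9.trans ((eqv_emw ((geo_cons (P.M_pos j) _ _).1 h6).1 h18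
          h19.symm).append_right z)
        rw [emw_append, emw_replicate, emw_cons, List.append_assoc, List.replicate_succ,
          List.cons_append] at h20
        have e1' : P.emb i β.1 = P.emb j γ.1 := congrArg Prod.fst e1
        refine G.no_triple hn hr h15 ⟨_, h20⟩ ?_ ?_ ?_
        · simp only [em, h11, h12]; exact emb_ne hne
        · simp only [em, h12, h16, e1']; exact emb_ne hne'
        · simp only [em, h11, h16]
          intro e3
          exact hij (P.unique i j α.1 β.1 δ.1 γ.1 hne e3 e1')

/-- Words which become reduced after prepending a letter. -/
def Pre (P : PairSystem S) (n : ℕ) (a : S × Bool) (y : Word S) : Prop :=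
  P.Red y ∧ y.length = n ∧ ¬ P.St y (a.1, !a.2)

lemma Good.pre_move {n : ℕ} (G : P.Good n) {b : S × Bool} {y w' : Word S} (hp : P.Pre n b y)
    (hm : P.Move (b :: y) w') : ∃ b' y', w' = b' :: y' ∧ P.Pre n b' y' ∧ P.HeadRel b y b' y' := by
  obtain ⟨hr, hn, hst⟩ := hp
  obtain ⟨u, z, i, v, v', h1, h2, h3, h4, h5⟩ := hm
  have hM := P.M_pos i
  cases u with
  | cons c u =>
    obtain ⟨rfl, rfl⟩ : b = c ∧ y = u ++ P.emw i v ++ z := by simpa using h4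
    have e : P.Eqv (u ++ P.emw i v ++ z) (u ++ P.emw i v' ++ z) :=
      Relation.ReflTransGen.single ⟨u, z, i, v, v', h1, h2, h3, rfl, rfl⟩
    exact ⟨b, u ++ P.emw i v' ++ z, h5, ⟨hr.congr e, by rw [← e.length_eq, hn], fun h => hst (h.congr e.symm)⟩,
      Or.inl ⟨rfl, e⟩⟩
  | nil =>
    rw [List.nil_append] at h4 h5
    have hl := h1.length_eq h2 h3
    cases v with
    | nil =>
      obtain rfl : v' = [] := List.eq_nil_of_length_eq_zero hl.symm
      exact ⟨b, y, by rw [h5, ← h4], ⟨hr, hn, hst⟩, Or.inl ⟨rfl, Eqv.refl _⟩⟩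
    | cons α h =>
      cases v' with
      | nil => simp at hl
      | cons β h' =>
        obtain ⟨rfl, rfl⟩ : b = P.em i α ∧ y = P.emw i h ++ z := by simpa using h4
        obtain ⟨g, x, hx, hg, hz⟩ := exists_decomp i hr.append_right
        obtain ⟨a, e⟩ := α
        have e1 : P.Eqv (P.emw i h ++ z) (P.emw i (h ++ g) ++ x) := by
          rw [emw_append, List.append_assoc]; exact hz.append_left _
        have hr1 := hr.congr e1
        have hn1 := e1.length_eq.symm.trans hn
        have h6 : Geo (P.M i) ((a, e) :: (h ++ g)) := by
          rcases geo_cons_or hM a e (geo_of_red hr1.append_left) with h6 | ⟨k, h6, h7⟩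
          · exact h6
          · refine absurd ?_ hst
            exact ⟨_, e1.trans ((eqv_emw (geo_of_red hr1.append_left) h6 h7.symm).append_right x)⟩
        have h7 : ev (P.M i) ((a, e) :: (h ++ g)) = ev (P.M i) (β :: (h' ++ g)) := by
          rw [← List.cons_append, ev_append, h3, ← ev_append, List.cons_append]
        have h8 : Geo (P.M i) (β :: (h' ++ g)) := by
          have h9 : (β :: (h' ++ g)).length = ((a, e) :: (h ++ g)).length := by
            simp at hl ⊢; exact hl.symm
          rw [Geo, h9, ← len_congr h7]
          exact h6
        have e2 : P.Eqv (P.emw i h' ++ z) (P.emw i (h' ++ g) ++ x) := by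
          rw [emw_append, List.append_assoc]; exact hz.append_left _
        have hn2 : (P.emw i (h' ++ g) ++ x).length = n := by
          rw [← hn1]; simp at hl ⊢; exact hl.symm
        have hr2 := G.red_append hn2.le hr1.append_right hx ((geo_cons hM _ _).1 h8).1
        refine ⟨P.em i β, P.emw i h' ++ z, by simpa using h5, ⟨hr2.congr e2.symm, ?_, ?_⟩, ?_⟩
        · rw [e2.length_eq, hn2]
        · intro hs
          obtain ⟨b', e'⟩ := β
          exact G.not_st hn2.le hr2 hx h8 (hs.congr e2)
        · by_cases hab : (a, e) = β
          · subst hab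
            refine Or.inl ⟨rfl, (eqv_emw ((geo_cons hM _ _).1 h1).1 ((geo_cons hM _ _).1 h2).1
              ?_).append_right z⟩
            rw [ev_cons, ev_cons] at h3
            exact mul_left_cancel h3
          · refine Or.inr ⟨i, (a, e), β, _, _, x, rfl, rfl, ?_, hx, h6, h8, h7, e1, e2⟩
            obtain ⟨a', e'⟩ := β
            rintro (rfl : a = a')
            obtain rfl : e' = !e := by
              apply Bool.eq_not.2
              rintro rfl
              exact hab rfl
            exact not_geo_both hM h1 h2 h3

lemma Good.pre_eqv {n : ℕ} (G : P.Good n) {b : S × Bool} {y w' : Word S} (hp : P.Pre n b y)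
    (hm : P.Eqv (b :: y) w') : ∃ b' y', w' = b' :: y' ∧ P.Pre n b' y' ∧ P.HeadRel b y b' y' := by
  induction hm with
  | refl => exact ⟨b, y, rfl, hp, Or.inl ⟨rfl, Eqv.refl _⟩⟩
  | tail _ h ih =>
    obtain ⟨b₁, y₁, rfl, hp₁, hr₁⟩ := ih
    obtain ⟨b₂, y₂, rfl, hp₂, hr₂⟩ := G.pre_move hp₁ h
    exact ⟨b₂, y₂, rfl, hp₂, G.headRel_trans hp₁.2.1.le hp₁.1 hr₁ hr₂⟩

lemma Good.succ {n : ℕ} (G : P.Good n) : P.Good (n + 1) where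
  headRel a b y y' hn hr e := by
    rcases Nat.lt_or_ge y.length n with h | h
    · exact G.headRel a b y y' (by simpa using h) hr e
    · simp only [List.length_cons] at hn
      obtain ⟨b', y₁, h1, -, h2⟩ := G.pre_eqv ⟨hr.tail, by omega, hr.not_st⟩ e
      obtain ⟨rfl, rfl⟩ : b = b' ∧ y' = y₁ := by simpa using h1
      exact h2
  red_cons a e w hn hr hs := by
    rcases Nat.lt_or_ge w.length n with h | h
    · exact G.red_cons a e w h hr hs
    · intro u z x b h1
      obtain ⟨b', y', h2, ⟨h3, -, h4⟩, -⟩ := G.pre_eqv (b := (a, e)) ⟨hr, by omega, hs⟩ h1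
      cases u with
      | nil =>
        obtain ⟨rfl, rfl⟩ : (x, b) = b' ∧ (x, !b) :: z = y' := by simpa using h2
        exact h4 ⟨_, Eqv.refl _⟩
      | cons c u =>
        obtain ⟨-, rfl⟩ : c = b' ∧ u ++ (x, b) :: (x, !b) :: z = y' := by simpa using h2
        exact h3 u z x b (Eqv.refl _)

lemma good (n : ℕ) : P.Good n := by
  induction n with
  | zero => exact ⟨fun a b y y' h => by simp at h, fun a e w h => by simp at h⟩
  | succ n ih => exact ih.succ

end PairSystem

namespace PairSystem

open Dihedral

variable {P : PairSystem S}

lemma eqv_of_cons {a : S × Bool} {y y' : Word S} (hr : P.Red (a :: y))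
    (h : P.Eqv (a :: y) (a :: y')) : P.Eqv y y' := by
  rcases (good _).headRel a a y y' le_rfl hr h with ⟨-, h⟩ |
    ⟨i, α, β, h, h', x, h1, h2, hne, -⟩
  · exact h
  · exact absurd (congrArg Prod.fst (P.em_injective i (h1.symm.trans h2))) hne

lemma red_cons (a : S × Bool) {w : Word S} (hr : P.Red w) (hs : ¬ P.St w (a.1, !a.2)) :
    P.Red (a :: w) :=
  (good (w.length + 1)).red_cons a.1 a.2 w (Nat.lt_succ_self _) hr hs

variable (P)

/-- The action of a letter on reduced words. -/
noncomputable def act (a : S × Bool) (r : Word S) : Word S :=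
  if h : P.St r (a.1, !a.2) then h.choose else a :: r

variable {P}

lemma act_of_not_st {a : S × Bool} {r : Word S} (h : ¬ P.St r (a.1, !a.2)) :
    P.act a r = a :: r := dif_neg h

lemma act_of_eqv {a : S × Bool} {r y : Word S} (hr : P.Red r)
    (h : P.Eqv r ((a.1, !a.2) :: y)) : P.Eqv (P.act a r) y := by
  have hs : P.St r (a.1, !a.2) := ⟨y, h⟩
  rw [act, dif_pos hs]
  have h1 := hs.choose_spec
  exact eqv_of_cons (hr.congr h1) (h1.symm.trans h)

lemma red_act (a : S × Bool) {r : Word S} (hr : P.Red r) : P.Red (P.act a r) := by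
  by_cases hs : P.St r (a.1, !a.2)
  · obtain ⟨y, h⟩ := hs
    exact (hr.congr h).tail.congr (act_of_eqv hr h).symm
  · rw [act_of_not_st hs]
    exact red_cons a hr hs

lemma act_congr (a : S × Bool) {r r' : Word S} (hr : P.Red r) (h : P.Eqv r r') :
    P.Eqv (P.act a r) (P.act a r') := by
  by_cases hs : P.St r (a.1, !a.2)
  · obtain ⟨y, h'⟩ := hs
    exact (act_of_eqv hr h').trans (act_of_eqv (hr.congr h) (h.symm.trans h')).symm
  · rw [act_of_not_st hs, act_of_not_st fun h' => hs (h'.congr h.symm)]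
    exact h.cons a

lemma act_act (a : S × Bool) {r : Word S} (hr : P.Red r) :
    P.Eqv (P.act (a.1, !a.2) (P.act a r)) r := by
  by_cases hs : P.St r (a.1, !a.2)
  · obtain ⟨y, h⟩ := hs
    have h1 := act_of_eqv hr h
    have hr1 := hr.congr h
    have h2 : ¬ P.St y (a.1, !!a.2) := hr1.not_st
    refine (act_congr _ (red_act a hr) h1).trans ?_
    rw [act_of_not_st h2]
    exact h.symm
  · apply act_of_eqv (red_act a hr)
    rw [act_of_not_st hs, Bool.not_not]
    exact Eqv.refl _

variable (P)

/-- Reduced words up to equivalence. -/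
def redSetoid : Setoid {w : Word S // P.Red w} where
  r w w' := P.Eqv w.1 w'.1
  iseqv := ⟨fun _ => Eqv.refl _, Eqv.symm, Eqv.trans⟩

/-- The set of classes of reduced words. -/
def RedClass := Quotient P.redSetoid

variable {P}

/-- The class of a reduced word. -/
def cls {w : Word S} (hw : P.Red w) : P.RedClass := Quotient.mk P.redSetoid ⟨w, hw⟩

lemma cls_eq {w w' : Word S} (hw : P.Red w) (hw' : P.Red w') :
    cls hw = cls hw' ↔ P.Eqv w w' := Quotient.eq (r := P.redSetoid)

lemma exists_cls (x : P.RedClass) : ∃ (w : Word S) (hw : P.Red w), x = cls hw := by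
  induction x using Quotient.ind with
  | _ w => exact ⟨w.1, w.2, rfl⟩

variable (P)

/-- The action of a letter on classes. -/
noncomputable def actClass (a : S × Bool) : P.RedClass → P.RedClass :=
  Quotient.map (fun w => ⟨P.act a w.1, red_act a w.2⟩) fun w _ h => act_congr a w.2 h

variable {P}

lemma actClass_cls (a : S × Bool) {w : Word S} (hw : P.Red w) :
    P.actClass a (cls hw) = cls (red_act a hw) := rfl

lemma actClass_actClass (a : S × Bool) (x : P.RedClass) :
    P.actClass (a.1, !a.2) (P.actClass a x) = x := by
  obtain ⟨w, hw, rfl⟩ := exists_cls x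
  rw [actClass_cls, actClass_cls, cls_eq]
  exact act_act a hw

variable (P)

/-- The permutation of classes given by a generator. -/
noncomputable def genPerm (s : S) : Equiv.Perm P.RedClass where
  toFun := P.actClass (s, true)
  invFun := P.actClass (s, false)
  left_inv := actClass_actClass (s, true)
  right_inv := actClass_actClass (s, false)

/-- The action of the free group on classes of reduced words. -/
noncomputable def perm : FreeGroup S →* Equiv.Perm P.RedClass := FreeGroup.lift P.genPerm

variable {P}

lemma perm_nil (x : P.RedClass) : P.perm (FreeGroup.mk []) x = x := by
  rw [← FreeGroup.one_eq_mk, map_one]; rfl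

lemma perm_cons (a : S × Bool) (w : Word S) (x : P.RedClass) :
    P.perm (FreeGroup.mk (a :: w)) x = P.actClass a (P.perm (FreeGroup.mk w) x) := by
  obtain ⟨s, b⟩ := a
  rw [perm, FreeGroup.lift_mk, FreeGroup.lift_mk, List.map_cons, List.prod_cons,
    Equiv.Perm.mul_apply]
  cases b <;> rfl

lemma perm_red {w : Word S} (hw : P.Red w) : P.perm (FreeGroup.mk w) (cls red_nil) = cls hw := by
  induction w with
  | nil => exact perm_nil _
  | cons a w ih =>
    rw [perm_cons, ih hw.tail, actClass_cls, cls_eq, act_of_not_st hw.not_st]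
    exact Eqv.refl _

lemma perm_emw {i : P.ι} (v : Word Bool) {h : Word Bool} {x : Word S} (hx : P.Xi i x)
    (hr : P.Red (P.emw i h ++ x)) :
    ∃ (g : Word Bool) (hr' : P.Red (P.emw i g ++ x)), Geo (P.M i) g ∧
      ev (P.M i) g = ev (P.M i) (v ++ h) ∧
      P.perm (FreeGroup.mk (P.emw i v)) (cls hr) = cls hr' := by
  have hm := P.M_pos i
  induction v with
  | nil => exact ⟨h, hr, geo_of_red hr.append_left, rfl, perm_nil _⟩
  | cons α v ih =>
    obtain ⟨a, e⟩ := α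
    obtain ⟨g, hr', h1, h2, h3⟩ := ih
    rw [emw_cons, perm_cons, h3]
    rcases geo_cons_or hm a e h1 with h4 | ⟨g', h4, h5⟩
    · have h6 := (good _).not_st le_rfl hr' hx h4
      have h7 : P.Red (P.emw i ((a, e) :: g) ++ x) :=
        red_cons (P.em i (a, e)) (w := P.emw i g ++ x) hr' h6
      refine ⟨(a, e) :: g, h7, h4, ?_, ?_⟩
      · rw [List.cons_append, ev_cons, ev_cons, h2]
      · refine (cls_eq (red_act (P.em i (a, e)) hr') h7).2 ?_
        rw [act_of_not_st (a := P.em i (a, e)) h6]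
        exact Eqv.refl _
    · have h6 : P.Eqv (P.emw i g ++ x) (P.em i (a, !e) :: (P.emw i g' ++ x)) :=
        (eqv_emw h1 h4 h5.symm).append_right x
      refine ⟨g', (hr'.congr h6).tail, ((geo_cons hm _ _).1 h4).1, ?_, ?_⟩
      · rw [List.cons_append, ev_cons, ← h2, ← h5, ← ev_cons, ev_not_cons]
      · rw [actClass_cls, cls_eq]
        exact act_of_eqv (a := P.em i (a, e)) hr' h6

lemma perm_emw_eq {i : P.ι} {v v' : Word Bool} (h : ev (P.M i) v = ev (P.M i) v') :
    P.perm (FreeGroup.mk (P.emw i v)) = P.perm (FreeGroup.mk (P.emw i v')) := by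
  ext1 c
  obtain ⟨w, hw, rfl⟩ := exists_cls c
  obtain ⟨k, x, hx, hk, e⟩ := exists_decomp i hw
  rw [(cls_eq hw (hw.congr e)).2 e]
  obtain ⟨g, hr, h1, h2, h3⟩ := perm_emw v hx (hw.congr e)
  obtain ⟨g', hr', h1', h2', h3'⟩ := perm_emw v' hx (hw.congr e)
  rw [h3, h3', cls_eq]
  refine (eqv_emw h1 h1' ?_).append_right x
  rw [h2, h2', ev_append, h, ev_append]

/-- Reduced words acting in the same way are equivalent. -/
lemma eqv_of_perm {w w' : Word S} (hw : P.Red w) (hw' : P.Red w')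
    (h : P.perm (FreeGroup.mk w) = P.perm (FreeGroup.mk w')) : P.Eqv w w' := by
  rw [← cls_eq hw hw', ← perm_red hw, ← perm_red hw', h]

end PairSystem

/-! ### Alternating words and block decompositions -/

namespace Dihedral

variable {m : ℕ}

/-- Shift of a name by the parity of `n`. -/
def sh (x : Bool) (n : ℕ) : Bool := xor x n.bodd

@[simp] lemma sh_zero (x : Bool) : sh x 0 = x := by simp [sh]

lemma sh_succ (x : Bool) (n : ℕ) : sh x (n + 1) = !(sh x n) := by simp [sh]

lemma sh_add (x : Bool) (n k : ℕ) : sh x (n + k) = sh (sh x n) k := by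
  simp [sh]

lemma sh_not (x : Bool) (n : ℕ) : sh (!x) n = !(sh x n) := by simp [sh]

lemma sh_sh (x : Bool) (n : ℕ) : sh (sh x n) n = x := by simp [sh]

/-- The alternating word with `n` letters of sign `b`, beginning with `x`. -/
def alts (b x : Bool) : ℕ → Word Bool
  | 0 => []
  | n + 1 => (x, b) :: alts b (!x) n

@[simp] lemma alts_zero (b x : Bool) : alts b x 0 = [] := rfl

lemma alts_succ (b x : Bool) (n : ℕ) : alts b x (n + 1) = (x, b) :: alts b (!x) n := rfl

@[simp] lemma length_alts (b x : Bool) (n : ℕ) : (alts b x n).length = n := by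
  induction n generalizing x with
  | zero => rfl
  | succ n ih => rw [alts_succ, List.length_cons, ih]

lemma alts_add (b x : Bool) (n k : ℕ) : alts b x (n + k) = alts b x n ++ alts b (sh x n) k := by
  induction n generalizing x with
  | zero => simp
  | succ n ih =>
    rw [Nat.succ_add, alts_succ, ih, alts_succ, List.cons_append, sh_succ, sh_not]

lemma alts_succ' (b x : Bool) (n : ℕ) : alts b x (n + 1) = alts b x n ++ [(sh x n, b)] :=
  alts_add b x n 1

lemma altWord_eq_alts (x : Bool) (n : ℕ) : altWord x (!x) n = alts true x n := by
  induction n generalizing x with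
  | zero => rfl
  | succ n ih =>
    have := ih (!x)
    rw [Bool.not_not] at this
    rw [altWord, this, alts_succ]

lemma mem_alts {b x : Bool} {n : ℕ} {l : Bool × Bool} (h : l ∈ alts b x n) : l.2 = b := by
  induction n generalizing x with
  | zero => simp at h
  | succ n ih =>
    rcases List.mem_cons.1 h with rfl | h
    · rfl
    · exact ih h

lemma wordInv_append {S : Type*} (u v : Word S) : wordInv (u ++ v) = wordInv v ++ wordInv u := by
  simp [wordInv]

lemma wordInv_wordInv {S : Type*} (u : Word S) : wordInv (wordInv u) = u := by
  simp [wordInv, Function.comp_def]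

lemma length_wordInv {S : Type*} (u : Word S) : (wordInv u).length = u.length := by
  simp [wordInv]

lemma wordInv_cons {S : Type*} (l : S × Bool) (u : Word S) :
    wordInv (l :: u) = wordInv u ++ [(l.1, !l.2)] := by
  simp [wordInv]

lemma wordInv_alts (b x : Bool) (n : ℕ) :
    wordInv (alts b x n) = alts (!b) (!(sh x n)) n := by
  induction n generalizing x with
  | zero => rfl
  | succ n ih =>
    rw [alts_succ, wordInv_cons, ih, alts_succ']
    simp [sh_succ, sh_not, sh_sh]

/-- `flip` to the power `c`. -/
noncomputable def fp (m : ℕ) (c : Bool) : Equiv.Perm (Conf m) := if c then flip m else 1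

lemma fp_mul_self (c : Bool) : fp m c * fp m c = 1 := by
  cases c <;> simp [fp, flip_mul_self]

lemma fp_fp (c : Bool) (x : Conf m) : fp m c (fp m c x) = x := by
  rw [← Equiv.Perm.mul_apply, fp_mul_self, Equiv.Perm.one_apply]

lemma fp_fp_not (c : Bool) (x : Conf m) : fp m c (fp m (!c) x) = flip m x := by
  cases c <;> simp [fp]

lemma fp_base (c : Bool) : fp m c (base m) = base m := by
  cases c <;> simp [fp, flip_base]

/-- The exponent of a signed block of length `n`. -/
def sgnExp (b : Bool) (n : ℕ) : ℤ := if b then n else -n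

lemma lev_eq (b c : Bool) :
    lev m (xor c !b, b) = fp m c * rot m ^ sgnExp b 1 * fp m (!c) := by
  cases b <;> cases c <;> simp [fp, sgnExp, lev_ff, lev_ft, lev_tf, lev_tt]

lemma ev_alts (b c : Bool) (n : ℕ) :
    ev m (alts b (xor c !b) n) = fp m c * rot m ^ sgnExp b n * fp m (sh c n) := by
  induction n generalizing c with
  | zero => cases b <;> simp [sgnExp, fp_mul_self]
  | succ n ih =>
    have h : (!(xor c !b)) = xor (!c) !b := by simp
    have h' : sgnExp b (n + 1) = sgnExp b 1 + sgnExp b n := by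
      cases b <;> simp [sgnExp]; ring
    rw [alts_succ, ev_cons, lev_eq, h, ih, h', zpow_add, sh_succ, ← sh_not]
    calc _ = fp m c * rot m ^ sgnExp b 1 * (fp m (!c) * fp m (!c)) *
          rot m ^ sgnExp b n * fp m (sh (!c) n) := by simp only [mul_assoc]
      _ = _ := by rw [fp_mul_self]; simp only [mul_assoc, one_mul]

/-- The length of the block with flag `p.1` and run `p.2`. -/
def bl (m : ℕ) (p : Bool × ℕ) : ℕ := if p.1 then p.2 else m - p.2

/-- The word with block data `L` starting on side `c`. -/
def bw (m : ℕ) : Bool → List (Bool × ℕ) → Word Bool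
  | _, [] => []
  | c, p :: L => alts p.1 (xor c !p.1) (bl m p) ++ bw m (sh c (bl m p + 1)) L

/-- Admissible block data. -/
def Adm (m : ℕ) (L : List (Bool × ℕ)) : Prop := ∀ p ∈ L, 0 < p.2 ∧ p.2 < m

lemma Adm.head {p : Bool × ℕ} {L : List (Bool × ℕ)} (h : Adm m (p :: L)) : 0 < p.2 ∧ p.2 < m :=
  h p (by simp)

lemma Adm.tail {p : Bool × ℕ} {L : List (Bool × ℕ)} (h : Adm m (p :: L)) : Adm m L :=
  fun q hq => h q (by simp [hq])

/-- The configuration attached to block data. -/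
noncomputable def stt (m : ℕ) : List (Bool × ℕ) → Conf m
  | [] => base m
  | p :: L => (rot m ^ sgnExp p.1 (bl m p)) (flip m (stt m L))

lemma ev_bw (c : Bool) (L : List (Bool × ℕ)) : ev m (bw m c L) (base m) = fp m c (stt m L) := by
  induction L generalizing c with
  | nil => simp [bw, stt, fp_base]
  | cons p L ih =>
    rw [bw, ev_append, ev_alts, Equiv.Perm.mul_apply, ih, sh_succ, Equiv.Perm.mul_apply,
      Equiv.Perm.mul_apply, fp_fp_not, stt]

/-- The number of negative blocks. -/
def neg (L : List (Bool × ℕ)) : ℕ := (L.map Prod.fst).count false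

lemma stt_cons {p : Bool × ℕ} {L : List (Bool × ℕ)} (hp : 0 < p.2 ∧ p.2 < m) {T : List (Run m)}
    (h : flip m (stt m L) = (-(neg L : ℤ) * m, T)) :
    stt m (p :: L) = (-(neg (p :: L) : ℤ) * m + p.2, T) := by
  obtain ⟨b, j⟩ := p
  rw [stt, h, rot_zpow_apply]
  cases b
  · ext1
    · simp only [sgnExp, bl, neg, List.map_cons, List.count_cons_self]
      push_cast [hp.2.le]
      simp; ring
    · rfl
  · ext1
    · simp [sgnExp, bl, neg]
    · rfl

lemma flip_stt {L : List (Bool × ℕ)} (hL : Adm m L) :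
    ∃ T : List (Run m), flip m (stt m L) = (-(neg L : ℤ) * m, T) ∧
      T.map Subtype.val = L.map fun p => (p.2 : ℤ) := by
  induction L with
  | nil =>
    refine ⟨[], ?_, rfl⟩
    rw [stt, flip_base]
    simp [base, neg]
  | cons p L ih =>
    obtain ⟨T, h1, h2⟩ := ih hL.tail
    have hp := hL.head
    refine ⟨⟨p.2, by omega⟩ :: T, ?_, by simp [h2]⟩
    rw [stt_cons hp h1, flip_push _ _ (by omega)]

lemma bw_data {c c' : Bool} {L L' : List (Bool × ℕ)} (hL : Adm m L) (hL' : Adm m L')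
    (h : ev m (bw m c L) = ev m (bw m c' L')) :
    L.map Prod.snd = L'.map Prod.snd ∧ neg L = neg L' ∧ bw m c L' = bw m c' L' := by
  have h0 : fp m c (stt m L) = fp m c' (stt m L') := by rw [← ev_bw, ← ev_bw, h]
  obtain ⟨T, h1, h2⟩ := flip_stt hL
  obtain ⟨T', h1', h2'⟩ := flip_stt hL'
  have key : ∀ {L L' : List (Bool × ℕ)}, Adm m L → Adm m L' →
      flip m (stt m L) = stt m L' → L' = [] := by
    intro L L' hL hL' h
    obtain ⟨T, h1, h2⟩ := flip_stt hL
    cases L' with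
    | nil => rfl
    | cons p L' =>
      exfalso
      obtain ⟨T', h1', h2'⟩ := flip_stt hL'.tail
      have hp := hL'.head
      rw [stt_cons hp h1', h1, Prod.mk.injEq] at h
      have h3 := divmod_zero (m := m) (by omega) (-(neg L))
      have h4 := divmod (m := m) (-(neg (p :: L'))) p.2 (by omega)
      rw [h.1, h4.2] at h3
      omega
  have hcc : stt m L = stt m L' ∧ bw m c L' = bw m c' L' := by
    by_cases hc : c = c'
    · subst hc
      exact ⟨(fp m c).injective h0, rfl⟩
    · have hc' : c' = !c := by revert hc; cases c <;> cases c' <;> simp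
      subst hc'
      have h3 : stt m L = flip m (stt m L') := by
        rw [← fp_fp_not c, ← h0, fp_fp]
      have e := key hL' hL h3.symm
      have e' : L' = [] := by
        apply key hL hL'
        rw [h3, flip_flip]
      subst e e'
      exact ⟨rfl, rfl⟩
  rw [hcc.1, h1'] at h1
  have h5 : L.map (fun p => (p.2 : ℤ)) = L'.map fun p => (p.2 : ℤ) := by
    rw [← h2, ← h2', (Prod.mk.inj h1).2]
  refine ⟨?_, ?_, hcc.2⟩
  · have := congrArg (List.map Int.toNat) h5
    simpa [Function.comp_def] using this
  · cases L with
    | nil =>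
      cases L' with
      | nil => rfl
      | cons p L' => simp at h5
    | cons p L =>
      have hp := hL.head
      have h6 := (Prod.mk.inj h1).1
      have h7 : (neg L' : ℤ) = neg (p :: L) := by
        have := mul_right_cancel₀ (by have := hp.1; have := hp.2; omega) h6
        omega
      exact_mod_cast h7.symm

end Dihedral

/-! ### Parsing of words in two letters -/

namespace Dihedral

variable {m : ℕ}

/-- The word has a factor `s s⁻¹` or `s⁻¹ s`. -/
def HasCancel (v : Word Bool) : Prop :=
  ∃ (a z : Word Bool) (s b : Bool), v = a ++ (s, b) :: (s, !b) :: z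

/-- The word has an alternating factor of length `m` and sign `b`. -/
def HasDelta (m : ℕ) (b : Bool) (v : Word Bool) : Prop :=
  ∃ (a z : Word Bool) (x : Bool), v = a ++ alts b x m ++ z

lemma HasCancel.cons {v : Word Bool} (h : HasCancel v) (l : Bool × Bool) : HasCancel (l :: v) := by
  obtain ⟨a, z, s, b, rfl⟩ := h
  exact ⟨l :: a, z, s, b, rfl⟩

lemma HasDelta.cons {b : Bool} {v : Word Bool} (h : HasDelta m b v) (l : Bool × Bool) :
    HasDelta m b (l :: v) := by
  obtain ⟨a, z, x, rfl⟩ := h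
  exact ⟨l :: a, z, x, rfl⟩

lemma HasCancel.wordInv {v : Word Bool} (h : HasCancel v) : HasCancel (wordInv v) := by
  obtain ⟨a, z, s, b, rfl⟩ := h
  refine ⟨ArtinTits.wordInv z, ArtinTits.wordInv a, s, b, ?_⟩
  simp [ArtinTits.wordInv]

lemma HasDelta.wordInv {b : Bool} {v : Word Bool} (h : HasDelta m b v) :
    HasDelta m (!b) (wordInv v) := by
  obtain ⟨a, z, x, rfl⟩ := h
  refine ⟨ArtinTits.wordInv z, ArtinTits.wordInv a, !(sh x m), ?_⟩
  rw [wordInv_append, wordInv_append, wordInv_alts, List.append_assoc]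

/-- The block of length one formed by a letter. -/
lemma bw_single (hm : 2 ≤ m) (x b : Bool) (L : List (Bool × ℕ)) :
    bw m (xor x !b) ((b, if b then 1 else m - 1) :: L) = (x, b) :: bw m (xor x !b) L := by
  have h : bl m (b, if b then 1 else m - 1) = 1 := by
    cases b
    · simp only [bl]; simp; omega
    · simp [bl]
  rw [bw, h]
  simp [alts_succ, sh_succ]

lemma bw_extend (b c : Bool) (j j' : ℕ) (L : List (Bool × ℕ)) (h : bl m (b, j') = bl m (b, j) + 1) :
    bw m (!c) ((b, j') :: L) = (xor (!c) !b, b) :: bw m c ((b, j) :: L) := by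
  have h' : (!(xor (!c) !b)) = xor c !b := by simp
  have h'' : (!sh (!c) (bl m (b, j) + 1)) = sh c (bl m (b, j) + 1) := by rw [sh_not, Bool.not_not]
  rw [bw, bw, h]
  simp only [alts_succ _ _ (bl m (b, j)), List.cons_append, h', sh_succ _ (bl m (b, j) + 1), h'']

/-- A word has a cancellation, or a long alternating factor, or is a product of blocks. -/
lemma exists_parse (hm : 2 ≤ m) (v : Word Bool) :
    HasCancel v ∨ (∃ b, HasDelta m b v) ∨ ∃ c L, Adm m L ∧ v = bw m c L := by
  induction v with
  | nil => exact Or.inr (Or.inr ⟨false, [], by simp [Adm], rfl⟩)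
  | cons l v ih =>
    rcases ih with h | ⟨b, h⟩ | ⟨c, L, hL, rfl⟩
    · exact Or.inl (h.cons l)
    · exact Or.inr (Or.inl ⟨b, h.cons l⟩)
    · obtain ⟨x, b⟩ := l
      have hone : ∀ L, Adm m L → Adm m ((b, if b then 1 else m - 1) :: L) := by
        intro L hL p hp
        rcases List.mem_cons.1 hp with rfl | hp
        · cases b <;> simp <;> omega
        · exact hL p hp
      cases L with
      | nil => exact Or.inr (Or.inr ⟨_, _, hone [] (by simp [Adm]), (bw_single hm x b []).symm⟩)
      | cons p L =>
        obtain ⟨b', j⟩ := p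
        by_cases hx : x = xor c !b
        · have hc : c = xor x !b := by rw [hx]; simp
          rw [hc]
          exact Or.inr (Or.inr ⟨_, _, hone _ hL, (bw_single hm x b _).symm⟩)
        · have hx' : x = xor (!c) !b := by
            revert hx; cases x <;> cases c <;> cases b <;> simp
          obtain ⟨n, hn⟩ : ∃ n, bl m (b', j) = n + 1 := by
            have := hL.head
            refine ⟨bl m (b', j) - 1, ?_⟩
            cases b' <;> simp [bl] <;> simp at this <;> omega
          by_cases hb : b' = b
          · subst hb
            have hj := hL.head
            by_cases hd : bl m (b', j) + 1 = m
            · refine Or.inr (Or.inl ⟨b', [], bw m (sh c (bl m (b', j) + 1)) L, x, ?_⟩)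
              rw [← hd, alts_succ, bw, hx']
              simp [hd]
            · refine Or.inr (Or.inr ⟨!c, (b', if b' then j + 1 else j - 1) :: L, ?_, ?_⟩)
              · intro p hp
                rcases List.mem_cons.1 hp with rfl | hp
                · cases b' <;> simp [bl] at * <;> omega
                · exact hL.tail p hp
              · rw [hx']
                refine (bw_extend _ _ _ _ _ ?_).symm
                cases b' <;> simp [bl] at * <;> omega
          · left
            refine ⟨[], alts b' (!x) n ++ bw m (sh c (bl m (b', j) + 1)) L, x, b, ?_⟩
            have hb' : b' = !b := by revert hb; cases b <;> cases b' <;> simp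
            have hx2 : (xor c (!b')) = x := by
              rw [hx', hb']; cases c <;> cases b <;> rfl
            rw [bw]
            simp only [hx2, hn, alts_succ, ← hb', List.nil_append, List.cons_append]

end Dihedral

/-! ### Elementary properties of the transformations -/

section Steps

variable {A : ArtinData S}

lemma mk_wordInv (w : Word S) : FreeGroup.mk (wordInv w) = (FreeGroup.mk w)⁻¹ := by
  rw [FreeGroup.inv_mk, wordInv, FreeGroup.invRev, List.map_reverse]

lemma mk_append (u w : Word S) : FreeGroup.mk (u ++ w) = FreeGroup.mk u * FreeGroup.mk w :=
  FreeGroup.mul_mk.symm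

lemma inv_mul_eq_mul_inv {G : Type*} [Group G] {a b c d : G} (h : a * b = c * d) :
    a⁻¹ * c = b * d⁻¹ := by
  rw [inv_mul_eq_iff_eq_mul, ← mul_assoc, h, mul_inv_cancel_right]

/-- Transformations preserve the image in a group where the defining relations hold. -/
lemma Steps012Star.map_eq {G : Type*} [Group G] {f : FreeGroup S →* G}
    (hf : ∀ u v, IsRel A u v → f (FreeGroup.mk u) = f (FreeGroup.mk v)) {w w' : Word S}
    (h : Steps012Star A w w') : f (FreeGroup.mk w) = f (FreeGroup.mk w') := by
  induction h with
  | refl => rfl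
  | tail _ h ih =>
    rw [ih]
    rcases h with ⟨w₁, w₂, s, b, rfl, rfl⟩ | ⟨w₁, w₂, u, v, hr, ⟨rfl, rfl⟩ | ⟨rfl, rfl⟩⟩ |
      ⟨w₁, w₂, v, u, v', u', hr, -, -, rfl, rfl, -, -⟩ |
      ⟨w₁, w₂, v, u, v', u', hr, -, -, rfl, rfl, -, -⟩
    · have : FreeGroup.mk [(s, b), (s, !b)] = 1 := by
        have h1 := mk_append [(s, b)] (wordInv [(s, b)])
        rw [mk_wordInv, mul_inv_cancel] at h1
        exact h1
      rw [mk_append, mk_append, this, mul_one, ← mk_append]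
    · simp only [mk_append, map_mul, hf _ _ hr]
    · simp only [mk_append, mk_wordInv, map_mul, map_inv, hf _ _ hr]
    · have h1 := hf _ _ hr
      simp only [mk_append, mk_wordInv, map_mul, map_inv] at h1 ⊢
      rw [mul_assoc (f (FreeGroup.mk w₁)), inv_mul_eq_mul_inv h1, ← mul_assoc]
    · have h1 := hf _ _ hr
      simp only [mk_append, mk_wordInv, map_mul, map_inv] at h1 ⊢
      rw [mul_assoc (f (FreeGroup.mk w₁)), ← inv_mul_eq_mul_inv h1, ← mul_assoc]

variable (A)

/-- Transformations of types 0 and 1. -/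
def Steps01 : Word S → Word S → Prop := Relation.ReflTransGen fun x y => Step0 x y ∨ Step1 A x y

/-- Transformations of type 1. -/
def Steps1 : Word S → Word S → Prop := Relation.ReflTransGen (Step1 A)

variable {A}

lemma IsRel.symm {u v : Word S} (h : IsRel A u v) : IsRel A v u := by
  obtain ⟨s, t, k, h1, h2, h3, h4⟩ := h
  exact ⟨t, s, k, h1.symm, by rw [A.symm, h2], h4, h3⟩

lemma Step1.symm {w w' : Word S} (h : Step1 A w w') : Step1 A w' w := by
  obtain ⟨w₁, w₂, u, v, hr, h | h⟩ := h
  · exact ⟨w₁, w₂, v, u, hr.symm, Or.inl ⟨h.2, h.1⟩⟩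
  · exact ⟨w₁, w₂, v, u, hr.symm, Or.inr ⟨h.2, h.1⟩⟩

lemma Step0.context {w w' : Word S} (h : Step0 w w') (a z : Word S) :
    Step0 (a ++ w ++ z) (a ++ w' ++ z) := by
  obtain ⟨w₁, w₂, s, b, rfl, rfl⟩ := h
  exact ⟨a ++ w₁, w₂ ++ z, s, b, by simp, by simp⟩

lemma Step1.context {w w' : Word S} (h : Step1 A w w') (a z : Word S) :
    Step1 A (a ++ w ++ z) (a ++ w' ++ z) := by
  obtain ⟨w₁, w₂, u, v, hr, ⟨rfl, rfl⟩ | ⟨rfl, rfl⟩⟩ := h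
  · exact ⟨a ++ w₁, w₂ ++ z, u, v, hr, Or.inl ⟨by simp, by simp⟩⟩
  · exact ⟨a ++ w₁, w₂ ++ z, u, v, hr, Or.inr ⟨by simp, by simp⟩⟩

lemma Step0.wordInv {w w' : Word S} (h : Step0 w w') : Step0 (wordInv w) (wordInv w') := by
  obtain ⟨w₁, w₂, s, b, rfl, rfl⟩ := h
  exact ⟨ArtinTits.wordInv w₂, ArtinTits.wordInv w₁, s, b, by simp [ArtinTits.wordInv],
    by simp [ArtinTits.wordInv]⟩

lemma Step1.wordInv {w w' : Word S} (h : Step1 A w w') : Step1 A (wordInv w) (wordInv w') := by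
  obtain ⟨w₁, w₂, u, v, hr, ⟨rfl, rfl⟩ | ⟨rfl, rfl⟩⟩ := h
  · exact ⟨ArtinTits.wordInv w₂, ArtinTits.wordInv w₁, u, v, hr,
      Or.inr ⟨by simp [ArtinTits.wordInv], by simp [ArtinTits.wordInv]⟩⟩
  · exact ⟨ArtinTits.wordInv w₂, ArtinTits.wordInv w₁, u, v, hr,
      Or.inl ⟨by simp [ArtinTits.wordInv, Function.comp_def],
        by simp [ArtinTits.wordInv, Function.comp_def]⟩⟩

lemma Steps01.wordInv {w w' : Word S} (h : Steps01 A w w') :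
    Steps01 A (wordInv w) (wordInv w') :=
  h.lift _ fun _ _ h => h.imp Step0.wordInv Step1.wordInv

lemma Steps1.wordInv {w w' : Word S} (h : Steps1 A w w') :
    Steps1 A (wordInv w) (wordInv w') :=
  h.lift _ fun _ _ h => h.wordInv

lemma Steps1.context {w w' : Word S} (h : Steps1 A w w') (a z : Word S) :
    Steps1 A (a ++ w ++ z) (a ++ w' ++ z) :=
  h.lift (fun w => a ++ w ++ z) fun _ _ h => h.context a z

lemma Steps1.append_left {w w' : Word S} (h : Steps1 A w w') (a : Word S) :
    Steps1 A (a ++ w) (a ++ w') := by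
  simpa using h.context a []

lemma Steps1.append_right {w w' : Word S} (h : Steps1 A w w') (z : Word S) :
    Steps1 A (w ++ z) (w' ++ z) := by
  simpa using h.context [] z

lemma Steps1.symm {w w' : Word S} (h : Steps1 A w w') : Steps1 A w' w := by
  induction h with
  | refl => exact Relation.ReflTransGen.refl
  | tail _ h ih => exact Relation.ReflTransGen.head h.symm ih

lemma Steps1.trans {w₁ w₂ w₃ : Word S} (h : Steps1 A w₁ w₂) (h' : Steps1 A w₂ w₃) :
    Steps1 A w₁ w₃ := Relation.ReflTransGen.trans h h'

lemma Steps1.steps01 {w w' : Word S} (h : Steps1 A w w') : Steps01 A w w' :=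
  Relation.ReflTransGen.mono (fun _ _ => Or.inr) _ _ h

lemma Steps01.star {w w' : Word S} (h : Steps01 A w w') : Steps012Star A w w' :=
  Relation.ReflTransGen.mono (fun _ _ h => h.imp id Or.inl) _ _ h

lemma Steps01.tail {w w' w'' : Word S} (h : Steps01 A w w') (h' : Step0 w' w'') :
    Steps01 A w w'' := Relation.ReflTransGen.tail h (Or.inl h')

lemma Step0.steps01 {w w' : Word S} (h : Step0 w w') : Steps01 A w w' :=
  Relation.ReflTransGen.single (Or.inl h)

lemma Step0.length_lt {w w' : Word S} (h : Step0 w w') : w'.length < w.length := by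
  obtain ⟨w₁, w₂, s, b, rfl, rfl⟩ := h
  simp only [List.length_append, List.length_cons, List.length_nil]
  omega

lemma length_altWord (x y : S) (n : ℕ) : (altWord x y n).length = n := by
  induction n generalizing x y with
  | zero => rfl
  | succ n ih => rw [altWord, List.length_cons, ih]

lemma Step1.length_eq {w w' : Word S} (h : Step1 A w w') : w'.length = w.length := by
  obtain ⟨w₁, w₂, u, v, ⟨s, t, k, -, -, rfl, rfl⟩, ⟨rfl, rfl⟩ | ⟨rfl, rfl⟩⟩ := h <;>
  simp [Dihedral.length_wordInv, length_altWord]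

lemma Steps1.length_eq {w w' : Word S} (h : Steps1 A w w') : w'.length = w.length := by
  induction h with
  | refl => rfl
  | tail _ h ih => rw [h.length_eq, ih]

end Steps

/-! ### Words with long alternating factors -/

namespace Dihedral

variable {m : ℕ}

/-- The presentation on two letters with label `m`. -/
def dih (hm : 2 ≤ m) : ArtinData Bool where
  m _ _ := m
  symm _ _ := rfl
  two_le _ _ _ := by exact_mod_cast hm

variable {hm : 2 ≤ m}

lemma isRel_dih (x : Bool) : IsRel (dih hm) (alts true x m) (alts true (!x) m) := by
  refine ⟨x, !x, m, by simp, rfl, (altWord_eq_alts x m).symm, ?_⟩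
  have := altWord_eq_alts (!x) m
  rw [Bool.not_not] at this
  exact this.symm

lemma mk_eq_of_isRel {u v : Word Bool} (h : IsRel (dih hm) u v) : ev m u = ev m v := by
  obtain ⟨s, t, k, h1, h2, rfl, rfl⟩ := h
  have hk : m = k := by
    have h2' : (m : ℕ∞) = (k : ℕ∞) := h2
    exact_mod_cast h2'
  subst hk
  have ht : t = !s := by revert h1; cases s <;> cases t <;> simp
  subst ht
  exact ev_altWord_comm (by omega) s

lemma lift_gen (v : Word Bool) : FreeGroup.lift (gen m) (FreeGroup.mk v) = ev m v := by
  rw [FreeGroup.lift_mk, ev]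
  congr 1
  refine List.map_congr_left fun l _ => ?_
  obtain ⟨x, b⟩ := l
  cases b <;> simp [lev]

lemma star_ev {v v' : Word Bool} (h : Steps012Star (dih hm) v v') : ev m v = ev m v' := by
  rw [← lift_gen, ← lift_gen]
  exact h.map_eq fun u v h => by rw [lift_gen, lift_gen, mk_eq_of_isRel h]

lemma steps1_alts (x y : Bool) : Steps1 (dih hm) (alts true x m) (alts true y m) := by
  by_cases h : x = y
  · rw [h]; exact Relation.ReflTransGen.refl
  · have h' : x = !y := by revert h; cases x <;> cases y <;> simp
    rw [h']
    exact Relation.ReflTransGen.single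
      ⟨[], [], _, _, isRel_dih y, Or.inl ⟨by simp, by simp⟩⟩

/-- Conjugation by the fundamental element. -/
def conj (m : ℕ) (l : Bool × Bool) : Bool × Bool := (sh l.1 m, l.2)

lemma conj_conj (l : Bool × Bool) : conj m (conj m l) = l := by simp [conj, sh_sh]

lemma map_conj_conj (b : Word Bool) : (b.map (conj m)).map (conj m) = b := by
  simp [Function.comp_def, conj_conj]

lemma positive_map_conj {b : Word Bool} (h : Positive b) : Positive (b.map (conj m)) := by
  intro l hl
  obtain ⟨l', h1, rfl⟩ := List.mem_map.1 hl
  exact h l' h1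

lemma steps1_alts_letter (x y : Bool) :
    Steps1 (dih hm) (alts true x m ++ [(y, true)]) (conj m (y, true) :: alts true x m) := by
  have h1 : alts true (sh y m) m ++ [(y, true)] = (sh y m, true) :: alts true (!(sh y m)) m := by
    rw [← alts_succ, alts_succ', sh_sh]
  refine ((steps1_alts x (sh y m)).append_right _).trans ?_
  rw [h1]
  exact (steps1_alts (!(sh y m)) x).append_left [conj m (y, true)]

lemma steps1_alts_pos (x : Bool) {b : Word Bool} (hb : Positive b) :
    Steps1 (dih hm) (alts true x m ++ b) (b.map (conj m) ++ alts true x m) := by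
  induction b with
  | nil =>
    rw [List.append_nil]
    exact Relation.ReflTransGen.refl
  | cons l b ih =>
    obtain ⟨y, s⟩ := l
    obtain rfl : s = true := hb (y, s) (by simp)
    have h1 := (steps1_alts_letter (hm := hm) x y).append_right b
    have h2 := (ih fun l hl => hb l (by simp [hl])).append_left [conj m (y, true)]
    rw [List.append_assoc] at h1
    exact h1.trans h2

lemma steps1_pos_alts (x : Bool) {b : Word Bool} (hb : Positive b) :
    Steps1 (dih hm) (b ++ alts true x m) (alts true x m ++ b.map (conj m)) := by
  have := steps1_alts_pos (hm := hm) x (positive_map_conj (m := m) hb)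
  rw [map_conj_conj] at this
  exact this.symm

lemma exists_first_neg {c : Word Bool} (h : ∃ l ∈ c, l.2 = false) :
    ∃ b y c', c = b ++ (y, false) :: c' ∧ Positive b := by
  induction c with
  | nil => simp at h
  | cons l c ih =>
    obtain ⟨y, s⟩ := l
    cases s
    · exact ⟨[], y, c, rfl, by simp [Positive]⟩
    · obtain ⟨l, h1, h2⟩ := h
      obtain ⟨b, y', c', rfl, hb⟩ := ih ⟨l, by
        rcases List.mem_cons.1 h1 with rfl | h1
        · simp at h2
        · exact h1, h2⟩
      refine ⟨(y, true) :: b, y', c', rfl, fun l hl => ?_⟩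
      rcases List.mem_cons.1 hl with rfl | hl
      · rfl
      · exact hb l hl

lemma exists_last_neg {c : Word Bool} (h : ∃ l ∈ c, l.2 = false) :
    ∃ b y c', c = c' ++ (y, false) :: b ∧ Positive b := by
  obtain ⟨b, y, c', h1, h2⟩ := exists_first_neg (c := c.reverse) (by simpa using h)
  refine ⟨b.reverse, y, c'.reverse, ?_, fun l hl => h2 l (by simpa using hl)⟩
  rw [← List.reverse_reverse c, h1]
  simp

/-- A word with a long positive alternating factor and a negative letter can be shortened. -/
lemma exists_shorter_pos {v : Word Bool} (hd : HasDelta m true v) (hn : ∃ l ∈ v, l.2 = false) :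
    ∃ v', Steps01 (dih hm) v v' ∧ v'.length < v.length := by
  obtain ⟨a, z, x, rfl⟩ := hd
  obtain ⟨n, hn'⟩ : ∃ n, m = n + 1 := ⟨m - 1, by omega⟩
  suffices h : ∃ w v', Steps1 (dih hm) (a ++ alts true x m ++ z) w ∧ Step0 w v' by
    obtain ⟨w, v', h1, h2⟩ := h
    exact ⟨v', h1.steps01.tail h2, h1.length_eq ▸ h2.length_lt⟩
  have hc : (∃ l ∈ z, l.2 = false) ∨ ∃ l ∈ a, l.2 = false := by
    obtain ⟨l, h1, h2⟩ := hn
    simp only [List.mem_append] at h1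
    rcases h1 with (h1 | h1) | h1
    · exact Or.inr ⟨l, h1, h2⟩
    · simp [mem_alts h1] at h2
    · exact Or.inl ⟨l, h1, h2⟩
  rcases hc with hz | ha
  · obtain ⟨b, y, c, rfl, hb⟩ := exists_first_neg hz
    refine ⟨a ++ (b.map (conj m) ++ alts true (sh y n) m) ++ (y, false) :: c,
      a ++ b.map (conj m) ++ alts true (sh y n) n ++ c, ?_, ?_⟩
    · have h1 := (((steps1_alts (hm := hm) x (sh y n)).append_right b).trans
        (steps1_alts_pos _ hb)).context a ((y, false) :: c)
      simpa using h1
    · refine ⟨a ++ b.map (conj m) ++ alts true (sh y n) n, c, y, true, ?_, by simp⟩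
      have : alts true (sh y n) m = alts true (sh y n) n ++ [(y, true)] := by
        rw [hn', alts_succ', sh_sh]
      rw [this]
      simp
  · obtain ⟨b, y, c, rfl, hb⟩ := exists_last_neg ha
    refine ⟨c ++ [(y, false)] ++ (alts true y m ++ b.map (conj m)) ++ z,
      c ++ alts true (!y) n ++ b.map (conj m) ++ z, ?_, ?_⟩
    · have h1 := (((steps1_alts (hm := hm) x y).append_left b).trans
        (steps1_pos_alts _ hb)).context (c ++ [(y, false)]) z
      simpa using h1
    · refine ⟨c, alts true (!y) n ++ b.map (conj m) ++ z, y, false, ?_, by simp⟩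
      have : alts true y m = (y, true) :: alts true (!y) n := by rw [hn', alts_succ]
      rw [this]
      simp

/-- A word with a long alternating factor and a letter of the other sign can be shortened. -/
lemma exists_shorter {b : Bool} {v : Word Bool} (hd : HasDelta m b v) (hn : ∃ l ∈ v, l.2 = !b) :
    ∃ v', Steps01 (dih hm) v v' ∧ v'.length < v.length := by
  cases b
  · obtain ⟨l, h1, h2⟩ := hn
    obtain ⟨v', h3, h4⟩ := exists_shorter_pos (hm := hm) hd.wordInv
      ⟨(l.1, !l.2), by simpa [wordInv] using h1, by simp [h2]⟩
    refine ⟨wordInv v', ?_, by rwa [length_wordInv, ← length_wordInv v]⟩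
    have := h3.wordInv
    rwa [wordInv_wordInv] at this
  · exact exists_shorter_pos hd hn

/-- The exponent sum of a word. -/
def expSum (v : Word Bool) : ℤ := (v.map fun l => if l.2 then (1 : ℤ) else -1).sum

lemma hgt_top_rot (hm : 0 < m) (x : Conf m) : hgt m (rot m x) = hgt m x + 1 := by
  rw [hgt_rot hm _ ⟨by omega, le_rfl⟩, if_pos (Int.emod_lt_of_pos _ (by omega))]

lemma hgt_top_rot_inv (hm : 0 < m) (x : Conf m) : hgt m ((rot m)⁻¹ x) = hgt m x - 1 := by
  have := hgt_top_rot hm ((rot m)⁻¹ x)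
  rw [← Equiv.Perm.mul_apply, mul_inv_cancel, Equiv.Perm.one_apply] at this
  omega

lemma hgt_ev (hm : 0 < m) (v : Word Bool) : hgt m (ev m v (base m)) = expSum v := by
  induction v with
  | nil =>
    have := hgt_eq_zero (m := m) m 0 ⟨by omega, le_rfl⟩ hm []
    simpa [base, expSum, tailHgt] using this
  | cons l v ih =>
    obtain ⟨x, b⟩ := l
    have h0 : (0 : ℤ) ≤ m ∧ (m : ℤ) ≤ m := ⟨by omega, le_rfl⟩
    rw [ev_cons, Equiv.Perm.mul_apply, expSum, List.map_cons, List.sum_cons, ← expSum, ← ih]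
    cases x <;> cases b
    · rw [lev_ff, Equiv.Perm.mul_apply, hgt_flip hm _ h0, hgt_top_rot_inv hm]; simp; ring
    · rw [lev_ft, Equiv.Perm.mul_apply, hgt_top_rot hm, hgt_flip hm _ h0]; simp; ring
    · rw [lev_tf, Equiv.Perm.mul_apply, hgt_top_rot_inv hm, hgt_flip hm _ h0]; simp; ring
    · rw [lev_tt, Equiv.Perm.mul_apply, hgt_flip hm _ h0, hgt_top_rot hm]; simp; ring

lemma expSum_congr (hm : 0 < m) {v v' : Word Bool} (h : ev m v = ev m v') :
    expSum v = expSum v' := by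
  rw [← hgt_ev hm, ← hgt_ev hm, h]

lemma expSum_le (v : Word Bool) : expSum v ≤ v.length := by
  induction v with
  | nil => simp [expSum]
  | cons l v ih =>
    rw [expSum, List.map_cons, List.sum_cons, ← expSum, List.length_cons]
    push_cast
    split_ifs <;> omega

lemma positive_iff (v : Word Bool) : Positive v ↔ expSum v = v.length := by
  induction v with
  | nil => simp [expSum, Positive]
  | cons l v ih =>
    have h := expSum_le v
    have h' : Positive (l :: v) ↔ l.2 = true ∧ Positive v := by simp [Positive]
    have he : expSum (l :: v) = (if l.2 then 1 else -1) + expSum v := by simp [expSum]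
    rw [h', ih, he, List.length_cons]
    push_cast
    cases hl : l.2 <;> simp <;> omega

/-- A geodesic representing the same element as a positive word is positive. -/
lemma Geo.positive (hm : 0 < m) {v v' : Word Bool} (hv : Positive v) (hg : Geo m v')
    (h : ev m v = ev m v') : Positive v' := by
  have h1 := hg.length_le hm h.symm
  have h2 := expSum_congr hm h
  have h3 := expSum_le v'
  rw [positive_iff] at hv ⊢
  omega

lemma flip_ediv (hm : 0 < m) (x : Conf m) : (flip m x).1 / m = x.1 / m := by
  rcases conf_cases hm x with ⟨k, j, h, T, rfl⟩ | ⟨k, j, T, rfl⟩ | ⟨k, rfl⟩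
  · rw [flip_push _ _ h]
    exact (divmod_zero hm k).1.trans (divmod k j ⟨h.1.le, h.2⟩).1.symm
  · rw [flip_pop]
    exact (divmod k j.1 ⟨j.2.1.le, j.2.2⟩).1.trans (divmod_zero hm k).1.symm
  · rw [flip_nil]

lemma fp_ediv (hm : 0 < m) (c : Bool) (x : Conf m) : (fp m c x).1 / m = x.1 / m := by
  cases c
  · rfl
  · exact flip_ediv hm x

lemma pos_ediv (hm : 0 < m) {v : Word Bool} (hv : Positive v) (x : Conf m) :
    x.1 / m ≤ (ev m v x).1 / m := by
  have hr : ∀ x : Conf m, x.1 / m ≤ (rot m x).1 / m := fun x =>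
    Int.ediv_le_ediv (by omega) (by simp [rot_apply])
  induction v with
  | nil => simp
  | cons l v ih =>
    obtain ⟨y, s⟩ := l
    obtain rfl : s = true := hv (y, s) (by simp)
    refine (ih fun l hl => hv l (by simp [hl])).trans ?_
    rw [ev_cons, Equiv.Perm.mul_apply]
    cases y
    · rw [lev_ft, Equiv.Perm.mul_apply]
      exact (flip_ediv hm _).symm.le.trans (hr _)
    · rw [lev_tt, Equiv.Perm.mul_apply, flip_ediv hm]
      exact hr _

lemma delta_ediv (hm : 0 < m) (c : Bool) (x : Conf m) :
    (ev m (alts true c m) x).1 / m = x.1 / m + 1 := by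
  have h := ev_alts (m := m) true c m
  simp only [Bool.not_true, Bool.xor_false] at h
  rw [h, Equiv.Perm.mul_apply, Equiv.Perm.mul_apply, fp_ediv hm, rot_zpow_apply,
    ← fp_ediv hm (sh c m) x]
  simp only [sgnExp, if_true]
  rw [Int.add_ediv_of_dvd_right (dvd_refl _), Int.ediv_self (by omega)]

lemma one_le_ediv (hm : 0 < m) {v : Word Bool} (hv : Positive v) (hd : HasDelta m true v) :
    1 ≤ (ev m v (base m)).1 / m := by
  obtain ⟨a, z, x, rfl⟩ := hd
  have hz := pos_ediv hm (v := z) (fun l hl => hv l (by simp [hl])) (base m)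
  have ha := pos_ediv hm (v := a) (fun l hl => hv l (by simp [hl]))
    (ev m (alts true x m ++ z) (base m))
  rw [ev_append, Equiv.Perm.mul_apply, delta_ediv hm] at ha
  have h0 : (base m).1 / (m : ℤ) = 0 := by simp [base]
  rw [List.append_assoc, ev_append, ev_append, Equiv.Perm.mul_apply, Equiv.Perm.mul_apply]
  omega

lemma bw_ediv (hm : 0 < m) {c : Bool} {L : List (Bool × ℕ)} (hL : Adm m L) :
    (ev m (bw m c L) (base m)).1 / m = -(neg L : ℤ) := by
  obtain ⟨T, h, -⟩ := flip_stt hL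
  rw [ev_bw, fp_ediv hm, ← flip_ediv hm, h]
  exact (divmod_zero hm _).1

end Dihedral

section Factors

/-- Common left factors detected on first letters. -/
lemma isLCPrefix_iff (v u w : Word S) :
    IsLCPrefix v (v ++ u) (v ++ w) ↔ ∀ l, u.head? = some l → w.head? ≠ some l := by
  constructor
  · rintro ⟨-, -, h⟩ l h1 h2
    obtain ⟨u', rfl⟩ : ∃ u', u = l :: u' := List.head?_eq_some_iff.1 h1
    obtain ⟨w', rfl⟩ : ∃ w', w = l :: w' := List.head?_eq_some_iff.1 h2
    have := h (v ++ [l]) ⟨u', by simp⟩ ⟨w', by simp⟩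
    simp at this
  · intro h
    refine ⟨List.prefix_append _ _, List.prefix_append _ _, fun q h1 h2 => ?_⟩
    by_contra! hlt
    obtain ⟨q', rfl⟩ := List.prefix_of_prefix_length_le (List.prefix_append v u) h1 hlt.le
    rw [List.prefix_append_right_inj] at h1 h2
    cases q' with
    | nil => simp at hlt
    | cons l q' =>
      obtain ⟨u', rfl⟩ := h1
      obtain ⟨w', rfl⟩ := h2
      exact h l rfl rfl

lemma isLCSuffix_iff_reverse (p x y : Word S) :
    IsLCSuffix p x y ↔ IsLCPrefix p.reverse x.reverse y.reverse := by
  constructor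
  · rintro ⟨h1, h2, h3⟩
    refine ⟨List.reverse_prefix.2 h1, List.reverse_prefix.2 h2, fun q h4 h5 => ?_⟩
    have := h3 q.reverse (List.reverse_prefix.1 (by simpa using h4))
      (List.reverse_prefix.1 (by simpa using h5))
    simpa using this
  · rintro ⟨h1, h2, h3⟩
    refine ⟨List.reverse_prefix.1 h1, List.reverse_prefix.1 h2, fun q h4 h5 => ?_⟩
    have := h3 q.reverse (List.reverse_prefix.2 h4) (List.reverse_prefix.2 h5)
    simpa using this

/-- Common right factors detected on last letters. -/
lemma isLCSuffix_iff (v u w : Word S) :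
    IsLCSuffix v (u ++ v) (w ++ v) ↔ ∀ l, u.getLast? = some l → w.getLast? ≠ some l := by
  rw [isLCSuffix_iff_reverse, List.reverse_append, List.reverse_append, isLCPrefix_iff]
  simp only [List.head?_reverse]

end Factors

namespace Dihedral

variable {m : ℕ} {hm : 2 ≤ m}

lemma exists_bw_of_positive (hm : 2 ≤ m) {v : Word Bool} (hv : Positive v)
    (hd : ¬HasDelta m true v) : ∃ c L, Adm m L ∧ v = bw m c L := by
  rcases exists_parse hm v with ⟨a, z, s, b, rfl⟩ | ⟨b, h⟩ | h
  · have h1 := hv (s, b) (by simp)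
    have h2 := hv (s, !b) (by simp)
    simp only at h1 h2
    simp [h1] at h2
  · cases b
    · obtain ⟨a, z, x, rfl⟩ := h
      obtain ⟨n, rfl⟩ : ∃ n, m = n + 1 := ⟨m - 1, by omega⟩
      have h1 := hv (x, false) (by simp [alts_succ])
      simp at h1
    · exact absurd h hd
  · exact h

lemma hasDelta_of_ev_eq {v v' : Word Bool} (hm : 2 ≤ m) (hv : Positive v) (hv' : Positive v')
    (h : ev m v = ev m v') (hd : HasDelta m true v) : HasDelta m true v' := by
  by_contra hd'
  obtain ⟨c, L, hL, rfl⟩ := exists_bw_of_positive hm hv' hd'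
  have h1 := one_le_ediv (by omega) hv hd
  have h2 := bw_ediv (by omega) (c := c) hL
  rw [h] at h1
  omega

lemma fst_eq_true_of_neg {L : List (Bool × ℕ)} (h : neg L = 0) :
    L.map Prod.fst = List.replicate L.length true := by
  rw [neg, List.count_eq_zero] at h
  rw [List.eq_replicate_iff]
  refine ⟨by simp, fun b hb => ?_⟩
  cases b
  · exact absurd hb h
  · rfl

lemma eq_of_map_eq {L L' : List (Bool × ℕ)} (h1 : L.map Prod.fst = L'.map Prod.fst)
    (h2 : L.map Prod.snd = L'.map Prod.snd) : L = L' := by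
  rw [← List.zip_unzip L, ← List.zip_unzip L', List.unzip_eq_map, List.unzip_eq_map, h1, h2]

lemma HasDelta.steps1 {v : Word Bool} (hv : Positive v) (hd : HasDelta m true v) :
    ∃ v₁, Positive v₁ ∧ v₁.length < v.length ∧ Steps1 (dih hm) v (alts true true m ++ v₁) := by
  obtain ⟨a, z, x, rfl⟩ := hd
  have ha : Positive a := fun l hl => hv l (by simp [hl])
  refine ⟨a.map (conj m) ++ z, fun l hl => ?_, ?_, ?_⟩
  · rcases List.mem_append.1 hl with h | h
    · exact positive_map_conj ha l h
    · exact hv l (by simp [h])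
  · simp; omega
  · have := ((((steps1_alts (hm := hm) x true)).append_left a).trans
      (steps1_pos_alts true ha)).append_right z
    simpa using this

/-- Positive words representing the same element are linked by transformations of type 1. -/
lemma steps1_of_positive {v v' : Word Bool} (hv : Positive v) (hv' : Positive v')
    (h : ev m v = ev m v') : Steps1 (dih hm) v v' := by
  induction hn : v.length using Nat.strong_induction_on generalizing v v' with
  | _ n ih =>
    by_cases hd : HasDelta m true v
    · obtain ⟨v₁, h1, h2, h3⟩ := hd.steps1 (hm := hm) hv
      obtain ⟨v₁', h1', h2', h3'⟩ :=
        (hasDelta_of_ev_eq hm hv hv' h hd).steps1 (hm := hm) hv'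
      have e := star_ev h3.steps01.star
      have e' := star_ev h3'.steps01.star
      rw [e, e', ev_append, ev_append] at h
      exact h3.trans (((ih _ (hn ▸ h2) h1 h1' (mul_left_cancel h) rfl).append_left _).trans
        h3'.symm)
    · have hd' : ¬HasDelta m true v' := fun hd' => hd (hasDelta_of_ev_eq hm hv' hv h.symm hd')
      obtain ⟨c, L, hL, rfl⟩ := exists_bw_of_positive hm hv hd
      obtain ⟨c', L', hL', rfl⟩ := exists_bw_of_positive hm hv' hd'
      obtain ⟨h1, h2, h3⟩ := bw_data hL hL' h
      have h4 := bw_ediv (by omega) (c := c) hL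
      have h5 := pos_ediv (by omega) hv (base m)
      have h6 : (base m).1 / (m : ℤ) = 0 := by simp [base]
      have h7 : neg L = 0 := by omega
      have h8 : L = L' := eq_of_map_eq (by
        rw [fst_eq_true_of_neg h7, fst_eq_true_of_neg (h2 ▸ h7)]
        have := congrArg List.length h1
        simp only [List.length_map] at this
        rw [this]) h1
      subst h8
      rw [h3]
      exact Relation.ReflTransGen.refl

lemma sh_congr {n k : ℕ} (h : n % 2 = k % 2) (x : Bool) : sh x n = sh x k := by
  have : n.bodd = k.bodd := by
    rw [Nat.mod_two_of_bodd, Nat.mod_two_of_bodd] at h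
    revert h
    cases n.bodd <;> cases k.bodd <;> simp
  rw [sh, sh, this]

/-- The side on which block data end. -/
def bend (m : ℕ) (c : Bool) (L : List (Bool × ℕ)) : Bool :=
  L.foldl (fun c p => sh c (bl m p + 1)) c

lemma bw_append (c : Bool) (L L' : List (Bool × ℕ)) :
    bw m c (L ++ L') = bw m c L ++ bw m (bend m c L) L' := by
  induction L generalizing c with
  | nil => rfl
  | cons p L ih => simp [bw, bend, ih]

lemma bl_pos {p : Bool × ℕ} (hp : 0 < p.2 ∧ p.2 < m) : 0 < bl m p := by
  rw [bl]; split_ifs <;> omega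

lemma head_bw {c : Bool} {L : List (Bool × ℕ)} (hL : Adm m L) {l : Bool × Bool}
    (h : (bw m c L).head? = some l) : l = (c, true) ∨ l = (!c, false) := by
  cases L with
  | nil => simp [bw] at h
  | cons p L =>
    obtain ⟨n, hn⟩ : ∃ n, bl m p = n + 1 := ⟨bl m p - 1, by have := bl_pos hL.head; omega⟩
    rw [bw, hn, alts_succ] at h
    obtain ⟨b, j⟩ := p
    cases b <;> simp at h <;> simp [← h]

lemma last_bw {c : Bool} {L : List (Bool × ℕ)} (hL : Adm m L) {l : Bool × Bool}
    (h : (bw m c L).getLast? = some l) :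
    l = (bend m c L, true) ∨ l = (!(bend m c L), false) := by
  rcases List.eq_nil_or_concat L with rfl | ⟨L, p, rfl⟩
  · simp [bw] at h
  · rw [List.concat_eq_append] at *
    have hp := hL p (by simp)
    obtain ⟨n, hn⟩ : ∃ n, bl m p = n + 1 := ⟨bl m p - 1, by have := bl_pos hp; omega⟩
    have hb : bend m c (L ++ [p]) = sh (bend m c L) n := by
      have h' : bend m c (L ++ [p]) = sh (bend m c L) (bl m p + 1) := by simp [bend]
      rw [h', hn]
      exact sh_congr (by omega) _
    rw [bw_append, bw, hn, alts_succ', bw, List.append_nil, ← List.append_assoc,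
      List.getLast?_concat] at h
    rw [hb]
    obtain ⟨b, j⟩ := p
    cases b <;> simp [sh_not] at h <;> simp [← h]

lemma head_wordInv {S : Type*} (w : Word S) {l : S × Bool} (h : (wordInv w).head? = some l) :
    w.getLast? = some (l.1, !l.2) := by
  rcases List.eq_nil_or_concat w with rfl | ⟨w, p, rfl⟩
  · simp [wordInv] at h
  · rw [List.concat_eq_append, wordInv_append] at h
    have h' : (p.1, !p.2) = l := by simpa [wordInv] using h
    simp [← h']

lemma last_wordInv {S : Type*} (w : Word S) {l : S × Bool} (h : (wordInv w).getLast? = some l) :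
    w.head? = some (l.1, !l.2) := by
  cases w with
  | nil => simp [wordInv] at h
  | cons p w =>
    rw [wordInv_cons] at h
    simp at h
    simp [← h]

lemma alts_ne_nil {b x : Bool} {n : ℕ} (h : 0 < n) : alts b x n ≠ [] := by
  intro h'
  have := congrArg List.length h'
  simp at this
  omega

lemma head_alts {b x : Bool} {n : ℕ} (h : 0 < n) : (alts b x n).head? = some (x, b) := by
  obtain ⟨k, rfl⟩ : ∃ k, n = k + 1 := ⟨n - 1, by omega⟩
  rfl

lemma last_alts {b x : Bool} {n : ℕ} (h : 0 < n) :
    (alts b x n).getLast? = some (sh x (n - 1), b) := by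
  obtain ⟨k, rfl⟩ : ∃ k, n = k + 1 := ⟨n - 1, by omega⟩
  rw [alts_succ', List.getLast?_concat, Nat.add_sub_cancel]

section Swap

variable {c : Bool} {P Q : List (Bool × ℕ)} {j j' : ℕ}

lemma bend_swap (d : Bool) (hj : 0 < j ∧ j < m) (hj' : 0 < j' ∧ j' < m) :
    sh (sh d (j + 1)) (m - j' + 1) = sh d (m - j + j') := by
  rw [← sh_add]
  exact sh_congr (by omega) _

/-- Adjacent blocks of opposite signs can be exchanged. -/
lemma star_swap (hP : Adm m P) (hQ : Adm m Q) (hj : 0 < j ∧ j < m) (hj' : 0 < j' ∧ j' < m) :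
    Steps012Star (dih hm) (bw m c (P ++ (true, j) :: (false, j') :: Q))
        (bw m c (P ++ (false, j) :: (true, j') :: Q)) ∧
      Steps012Star (dih hm) (bw m c (P ++ (false, j) :: (true, j') :: Q))
        (bw m c (P ++ (true, j) :: (false, j') :: Q)) := by
  set d := bend m c P with hd
  set f := sh d (m - j + j') with hf
  have e1 : bw m c (P ++ (true, j) :: (false, j') :: Q) =
      bw m c P ++ alts true d j ++ wordInv (alts true (!f) (m - j')) ++ bw m f Q := by
    have h1 : (!sh (!f) (m - j')) = sh d j := by
      rw [sh_not, Bool.not_not, hf, ← sh_add]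
      exact sh_congr (by omega) _
    have h2 : (!sh d (j + 1)) = sh d j := by rw [sh_succ, Bool.not_not]
    rw [bw_append, bw, bw, wordInv_alts, h1]
    simp only [bl, ← hd, Bool.not_true, Bool.xor_false, Bool.not_false, Bool.xor_true, if_true,
      h2, Bool.false_eq_true, if_false, bend_swap d hj hj', ← hf, List.append_assoc]
  have e2 : bw m c (P ++ (false, j) :: (true, j') :: Q) =
      bw m c P ++ wordInv (alts true (sh d (m - j)) (m - j)) ++
        alts true (sh d (m - j + 1)) j' ++ bw m f Q := by
    have h3 : sh (sh d (m - j + 1)) (j' + 1) = f := by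
      rw [← sh_add]
      exact sh_congr (by omega) _
    rw [bw_append, bw, bw, wordInv_alts]
    simp only [bl, ← hd, Bool.not_true, Bool.xor_false, Bool.not_false, Bool.xor_true, if_true,
      h3, Bool.false_eq_true, if_false, List.append_assoc, sh_sh]
  have r1 : alts true (sh d (m - j)) (m - j) ++ alts true d j = alts true (sh d (m - j)) m := by
    have := alts_add true (sh d (m - j)) (m - j) j
    rw [sh_sh, Nat.sub_add_cancel hj.2.le] at this
    exact this.symm
  have r2 : alts true (sh d (m - j + 1)) j' ++ alts true (!f) (m - j') =
      alts true (!(sh d (m - j))) m := by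
    have h := alts_add true (sh d (m - j + 1)) j' (m - j')
    have h' : sh (sh d (m - j + 1)) j' = !f := by
      rw [hf, ← sh_succ, ← sh_add]
      exact sh_congr (by omega) _
    rw [h', Nat.add_sub_cancel' hj'.2.le] at h
    rw [← h, sh_succ]
  have hr : IsRel (dih hm) (alts true (sh d (m - j)) (m - j) ++ alts true d j)
      (alts true (sh d (m - j + 1)) j' ++ alts true (!f) (m - j')) := by
    rw [r1, r2]
    exact isRel_dih _
  have n1 : alts true d j ≠ [] := alts_ne_nil hj.1
  have n2 : alts true (!f) (m - j') ≠ [] := alts_ne_nil (by omega)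
  have n3 : alts true (sh d (m - j)) (m - j) ≠ [] := alts_ne_nil (by omega)
  have n4 : alts true (sh d (m - j + 1)) j' ≠ [] := alts_ne_nil hj'.1
  rw [e1, e2]
  refine ⟨Relation.ReflTransGen.single (Or.inr (Or.inr (Or.inr
    ⟨_, _, _, _, _, _, hr, n1, n2, rfl, rfl, ?_, ?_⟩))),
    Relation.ReflTransGen.single (Or.inr (Or.inr (Or.inl
    ⟨_, _, _, _, _, _, hr, n3, n4, rfl, rfl, ?_, ?_⟩)))⟩
  · rw [isLCSuffix_iff]
    intro l h1 h2
    rw [last_alts (by omega), ← sh_add, sh_congr (k := 1) (by omega), sh_succ, sh_zero] at h1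
    have := last_bw hP h2
    simp at h1
    simp [← h1, ← hd] at this
  · rw [isLCSuffix_iff]
    intro l h1 h2
    rw [last_alts (by omega), ← sh_add, sh_congr (k := m - j + j') (by omega), ← hf] at h1
    have := head_bw hQ (last_wordInv _ h2)
    simp at h1
    simp [← h1] at this
  · rw [isLCPrefix_iff]
    intro l h1 h2
    rw [head_alts hj.1] at h1
    have := last_bw hP (head_wordInv _ h2)
    simp at h1
    simp [← h1, ← hd] at this
  · rw [isLCPrefix_iff]
    intro l h1 h2
    rw [head_alts (by omega)] at h1
    have := head_bw hQ h2
    simp at h1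
    simp [← h1] at this

end Swap

lemma adm_zip {F : List Bool} {J : List ℕ} (h : ∀ j ∈ J, 0 < j ∧ j < m) : Adm m (F.zip J) := by
  rintro ⟨b, j⟩ hp
  exact h j (List.of_mem_zip hp).2

lemma star_zip {F F' : List Bool} (h : F ~ F') {P : List (Bool × ℕ)} {J : List ℕ} (c : Bool)
    (hJ : J.length = F.length) (hP : Adm m P) (ha : ∀ j ∈ J, 0 < j ∧ j < m) :
    Steps012Star (dih hm) (bw m c (P ++ F.zip J)) (bw m c (P ++ F'.zip J)) := by
  induction h generalizing P J with
  | nil => exact Relation.ReflTransGen.refl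
  | cons x h ih =>
    cases J with
    | nil => simp at hJ
    | cons j J =>
      have := ih (P := P ++ [(x, j)]) (J := J) (by simpa using hJ) (fun p hp => by
        rcases List.mem_append.1 hp with hp | hp
        · exact hP p hp
        · rw [List.mem_singleton.1 hp]
          exact ha j (by simp)) (fun k hk => ha k (by simp [hk]))
      simpa using this
  | swap x y F =>
    match J, hJ with
    | j :: j' :: J, hJ =>
      simp only [List.zip_cons_cons]
      have hQ : Adm m (F.zip J) := adm_zip fun k hk => ha k (by simp [hk])
      have hj := ha j (by simp)
      have hj' := ha j' (by simp)
      cases x <;> cases y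
      · exact Relation.ReflTransGen.refl
      · exact (star_swap hP hQ hj hj').1
      · exact (star_swap hP hQ hj hj').2
      · exact Relation.ReflTransGen.refl
  | trans h₁ h₂ ih₁ ih₂ =>
    exact (ih₁ hJ hP ha).trans (ih₂ (hJ.trans h₁.length_eq) hP ha)

lemma perm_of_count {F F' : List Bool} (h : F.count false = F'.count false)
    (hl : F.length = F'.length) : F ~ F' := by
  have e : ∀ F : List Bool, F.count true + F.count false = F.length := fun F => by
    induction F with
    | nil => rfl
    | cons b F ih => cases b <;> simp <;> omega
  rw [List.perm_iff_count]
  intro b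
  have h1 := e F
  have h2 := e F'
  cases b <;> omega

lemma star_bw {c c' : Bool} {L L' : List (Bool × ℕ)} (hL : Adm m L) (hL' : Adm m L')
    (h : ev m (bw m c L) = ev m (bw m c' L')) :
    Steps012Star (dih hm) (bw m c L) (bw m c' L') := by
  obtain ⟨h1, h2, h3⟩ := bw_data hL hL' h
  rw [← h3]
  have h4 := congrArg List.length h1
  simp only [List.length_map] at h4
  have := star_zip (hm := hm) (perm_of_count h2 (by simpa using h4)) (P := []) (J := L.map Prod.snd) c
    (by simp) (by simp [Adm]) (fun j hj => by
      obtain ⟨p, hp, rfl⟩ := List.mem_map.1 hj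
      exact hL p hp)
  have e : ∀ L : List (Bool × ℕ), (L.map Prod.fst).zip (L.map Prod.snd) = L := fun L => by
    induction L with
    | nil => rfl
    | cons p L ih => simp [ih]
  have e' := e L'
  rw [← h1] at e'
  rwa [e, e'] at this

lemma positive_wordInv {v : Word Bool} : Positive (wordInv v) ↔ Negative v := by
  simp [Positive, Negative, wordInv]

lemma Geo.wordInv {v : Word Bool} (hm : 0 < m) (h : Geo m v) : Geo m (wordInv v) := by
  obtain ⟨u, h1, h2⟩ := exists_geo hm (ArtinTits.wordInv v)
  have h3 : ev m v = ev m (ArtinTits.wordInv u) := by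
    rw [ev_wordInv, h1, ev_wordInv, inv_inv]
  have h4 := h.length_le hm h3
  have h5 := h2.length_le hm h1
  rw [length_wordInv] at h4 h5
  rw [Geo, ← len_congr h1, ← h2, length_wordInv]
  omega

/-- Any word can be transformed into any geodesic word representing the same element. -/
theorem star_geo {v v' : Word Bool} (h : ev m v = ev m v') (hg : Geo m v') :
    Steps012Star (dih hm) v v' := by
  induction hn : v.length using Nat.strong_induction_on generalizing v with
  | _ n ih =>
    have hm0 : 0 < m := by omega
    by_cases hc : HasCancel v
    · obtain ⟨a, z, s, b, rfl⟩ := hc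
      have h0 : Step0 (a ++ (s, b) :: (s, !b) :: z) (a ++ z) := ⟨a, z, s, b, by simp, rfl⟩
      have h1 : Steps012Star (dih hm) _ _ := h0.steps01.star
      exact h1.trans (ih _ (hn ▸ h0.length_lt) ((star_ev h1).symm.trans h) rfl)
    by_cases hs : ∃ b, HasDelta m b v ∧ ∃ l ∈ v, l.2 = !b
    · obtain ⟨b, hd, hl⟩ := hs
      obtain ⟨v₁, h1, h2⟩ := exists_shorter (hm := hm) hd hl
      exact h1.star.trans (ih _ (hn ▸ h2) ((star_ev h1.star).symm.trans h) rfl)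
    have hi : ev m (wordInv v) = ev m (wordInv v') := by rw [ev_wordInv, ev_wordInv, h]
    by_cases hp : Positive v
    · exact (steps1_of_positive hp (hg.positive hm0 hp h) h).steps01.star
    by_cases hq : Negative v
    · have := steps1_of_positive (hm := hm) (positive_wordInv.2 hq)
        ((hg.wordInv hm0).positive hm0 (positive_wordInv.2 hq) hi) hi
      have := this.wordInv
      rw [wordInv_wordInv, wordInv_wordInv] at this
      exact this.steps01.star
    have hd : ∀ b, ¬HasDelta m b v := by
      intro b hd
      refine hs ⟨b, hd, ?_⟩
      cases b
      · by_contra! h'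
        exact hq fun l hl => by simpa using h' l hl
      · by_contra! h'
        exact hp fun l hl => by simpa using h' l hl
    have hbw : ∀ {u : Word Bool}, ¬HasCancel u → (∀ b, ¬HasDelta m b u) →
        ∃ c L, Adm m L ∧ u = bw m c L := fun {u} h1 h2 => by
      rcases exists_parse hm u with h | ⟨b, h⟩ | h
      · exact absurd h h1
      · exact absurd h (h2 b)
      · exact h
    have hpd : ∀ {u u' : Word Bool}, (∃ c L, Adm m L ∧ u = bw m c L) → ev m u = ev m u' →
        Positive u' → ¬HasDelta m true u' := by
      rintro u u' ⟨c, L, hL, rfl⟩ h hp' hd'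
      have h1 := one_le_ediv hm0 hp' hd'
      have h2 := bw_ediv hm0 (c := c) hL
      rw [h] at h2
      omega
    obtain ⟨c, L, hL, e⟩ := hbw hc hd
    have hc' : ¬HasCancel v' := by
      rintro ⟨a, z, s, b, rfl⟩
      exact not_geo_cancel hm0 s b z (hg.append_right hm0)
    have hd' : ∀ b, ¬HasDelta m b v' := by
      intro b hd'
      have hpos : ∀ l ∈ v', l.2 = b := by
        by_contra! hl
        obtain ⟨l, h1, h2⟩ := hl
        obtain ⟨v₁, h3, h4⟩ := exists_shorter (hm := hm) hd' ⟨l, h1, by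
          revert h2; cases l.2 <;> cases b <;> simp⟩
        have := hg.length_le hm0 (star_ev h3.star)
        omega
      cases b
      · refine hpd (hbw (u := wordInv v) (fun h => hc ?_) fun b h => hd (!b) ?_) hi
          (positive_wordInv.2 hpos) hd'.wordInv
        · have := h.wordInv
          rwa [wordInv_wordInv] at this
        · have := h.wordInv
          rwa [wordInv_wordInv] at this
      · exact hpd ⟨c, L, hL, e⟩ h hpos hd'
    obtain ⟨c', L', hL', e'⟩ := hbw hc' hd'
    rw [e, e'] at h ⊢
    exact star_bw hL hL' h

end Dihedral

namespace PairSystem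

open Dihedral

variable {P : PairSystem S} {A : ArtinData S}

/-- No letter of the pair `i` occurs in the option `o`. -/
def Off (P : PairSystem S) (i : P.ι) (o : Option (S × Bool)) : Prop :=
  ∀ l, o = some l → ∀ x, P.emb i x ≠ l.1

lemma emw_wordInv (i : P.ι) (v : Word Bool) : P.emw i (wordInv v) = wordInv (P.emw i v) := by
  simp [emw, wordInv, em, Function.comp_def]

lemma emw_altWord (i : P.ι) (s t : Bool) (n : ℕ) :
    P.emw i (altWord s t n) = altWord (P.emb i s) (P.emb i t) n := by
  induction n generalizing s t with
  | zero => rfl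
  | succ n ih => rw [altWord, altWord, emw_cons, ih, em]

lemma emw_alts (i : P.ι) (x : Bool) (n : ℕ) :
    P.emw i (alts true x n) = altWord (P.emb i x) (P.emb i !x) n := by
  rw [← altWord_eq_alts, emw_altWord]

lemma isRel_emw (hP : ∀ i x, A.m (P.emb i x) (P.emb i !x) = P.M i) {i : P.ι} {hm : 2 ≤ P.M i}
    {u v : Word Bool} (h : IsRel (dih hm) u v) : IsRel A (P.emw i u) (P.emw i v) := by
  obtain ⟨s, t, k, h1, h2, rfl, rfl⟩ := h
  have ht : t = !s := by revert h1; cases s <;> cases t <;> simp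
  subst ht
  have hk : ((P.M i : ℕ) : ℕ∞) = (k : ℕ∞) := h2
  refine ⟨P.emb i s, P.emb i !s, k, fun h => h1 (P.inj i h), by rw [hP, hk], emw_altWord _ _ _ _,
    emw_altWord _ _ _ _⟩

lemma Off.wordInv_head {i : P.ι} {w : Word S} (h : Off P i w.getLast?) :
    Off P i (wordInv w).head? := fun _ hl x => h _ (head_wordInv w hl) x

lemma Off.wordInv_last {i : P.ι} {w : Word S} (h : Off P i w.head?) :
    Off P i (wordInv w).getLast? := fun _ hl x => h _ (last_wordInv w hl) x

lemma head_emw_ne {i : P.ι} {u w : Word Bool} {z : Word S}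
    (h : ∀ l, u.head? = some l → w.head? ≠ some l) (hz : Off P i z.head?) (l : S × Bool)
    (h1 : (P.emw i u).head? = some l) : (P.emw i w ++ z).head? ≠ some l := by
  cases u with
  | nil => simp at h1
  | cons a u =>
    simp only [emw_cons, List.head?_cons, Option.some.injEq] at h1
    cases w with
    | nil =>
      intro h2
      exact hz l h2 a.1 (by rw [← h1, em])
    | cons b w =>
      intro h2
      simp only [emw_cons, List.cons_append, List.head?_cons, Option.some.injEq] at h2
      rw [← h1] at h2
      exact h a rfl (by rw [P.em_injective i h2]; rfl)

lemma last_emw_ne {i : P.ι} {u w : Word Bool} {z : Word S}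
    (h : ∀ l, u.getLast? = some l → w.getLast? ≠ some l) (hz : Off P i z.getLast?) (l : S × Bool)
    (h1 : (P.emw i u).getLast? = some l) : (z ++ P.emw i w).getLast? ≠ some l := by
  have e : ∀ v : Word Bool, (P.emw i v).reverse = P.emw i v.reverse := fun v =>
    List.map_reverse.symm
  have := head_emw_ne (P := P) (i := i) (u := u.reverse) (w := w.reverse) (z := z.reverse)
    (by simpa only [List.head?_reverse] using h) (by simpa only [List.head?_reverse] using hz) l
    (by rw [← e, List.head?_reverse, h1])
  rwa [← e, ← List.reverse_append, List.head?_reverse] at this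

/-- Transformations of words in a pair yield transformations in a maximal context. -/
lemma star_emw (hP : ∀ i x, A.m (P.emb i x) (P.emb i !x) = P.M i) {i : P.ι} {hm : 2 ≤ P.M i}
    {v v' : Word Bool} {w₁ w₂ : Word S} (h₁ : Off P i w₁.getLast?) (h₂ : Off P i w₂.head?)
    (h : Steps012Star (dih hm) v v') :
    Steps012Star A (w₁ ++ P.emw i v ++ w₂) (w₁ ++ P.emw i v' ++ w₂) := by
  refine h.lift (fun v => w₁ ++ P.emw i v ++ w₂) fun v v' h => ?_
  have hne : ∀ v : Word Bool, v ≠ [] → P.emw i v ≠ [] := fun v hv h' => hv (by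
    simpa [emw] using h')
  rcases h with ⟨a, z, s, b, rfl, rfl⟩ | ⟨a, z, u, v, hr, ⟨rfl, rfl⟩ | ⟨rfl, rfl⟩⟩ |
    ⟨a, z, v, u, v', u', hr, n1, n2, rfl, rfl, c1, c2⟩ |
    ⟨a, z, v, u, v', u', hr, n1, n2, rfl, rfl, c1, c2⟩
  · exact Or.inl ⟨w₁ ++ P.emw i a, P.emw i z ++ w₂, P.emb i s, b, by simp [em], by simp⟩
  · exact Or.inr (Or.inl ⟨w₁ ++ P.emw i a, P.emw i z ++ w₂, _, _, isRel_emw hP hr,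
      Or.inl ⟨by simp, by simp⟩⟩)
  · exact Or.inr (Or.inl ⟨w₁ ++ P.emw i a, P.emw i z ++ w₂, _, _, isRel_emw hP hr,
      Or.inr ⟨by simp [emw_wordInv], by simp [emw_wordInv]⟩⟩)
  · have hr' := isRel_emw hP hr
    rw [emw_append, emw_append] at hr'
    refine Or.inr (Or.inr (Or.inl ⟨w₁ ++ P.emw i a, P.emw i z ++ w₂, _, _, _, _, hr',
      hne _ n1, hne _ n2, by simp [emw_wordInv], by simp [emw_wordInv], ?_, ?_⟩))
    · rw [isLCPrefix_iff] at c1 ⊢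
      rw [wordInv_append, ← emw_wordInv]
      exact head_emw_ne c1 h₁.wordInv_head
    · rw [isLCPrefix_iff] at c2 ⊢
      exact head_emw_ne c2 h₂
  · have hr' := isRel_emw hP hr
    rw [emw_append, emw_append] at hr'
    refine Or.inr (Or.inr (Or.inr ⟨w₁ ++ P.emw i a, P.emw i z ++ w₂, _, _, _, _, hr',
      hne _ n1, hne _ n2, by simp [emw_wordInv], by simp [emw_wordInv], ?_, ?_⟩))
    · rw [isLCSuffix_iff] at c1 ⊢
      exact last_emw_ne c1 h₁
    · rw [isLCSuffix_iff] at c2 ⊢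
      rw [wordInv_append, ← emw_wordInv]
      exact last_emw_ne c2 h₂.wordInv_last

/-- A longest left factor of `z` in the pair `i`. -/
lemma exists_maximal_left (i : P.ι) (z : Word S) :
    ∃ b z', z = P.emw i b ++ z' ∧ Off P i z'.head? := by
  induction z with
  | nil => exact ⟨[], [], rfl, by simp [Off]⟩
  | cons l z ih =>
    by_cases h : ∃ x, P.emb i x = l.1
    · obtain ⟨x, hx⟩ := h
      obtain ⟨b, z', rfl, h'⟩ := ih
      exact ⟨(x, l.2) :: b, z', by simp [em, hx], h'⟩
    · refine ⟨[], l :: z, rfl, fun l' hl x hx => h ⟨x, ?_⟩⟩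
      simp only [List.head?_cons, Option.some.injEq] at hl
      rw [hl, hx]

/-- A longest right factor of `z` in the pair `i`. -/
lemma exists_maximal_right (i : P.ι) (z : Word S) :
    ∃ b z', z = z' ++ P.emw i b ∧ Off P i z'.getLast? := by
  obtain ⟨b, z', h1, h2⟩ := exists_maximal_left i z.reverse
  refine ⟨b.reverse, z'.reverse, ?_, by rwa [List.getLast?_reverse]⟩
  rw [← List.reverse_reverse z, h1, List.reverse_append]
  simp [emw]

/-- A replacement of a geodesic factor either is a sequence of transformations, or the word can be
shortened. -/
lemma Move.star (hP : ∀ i x, A.m (P.emb i x) (P.emb i !x) = P.M i) {w w' : Word S}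
    (h : P.Move w w') :
    Steps012Star A w w' ∨ ∃ w₁, Steps012Star A w w₁ ∧ w₁.length < w.length := by
  obtain ⟨u, z, i, v, v', h1, h2, h3, rfl, rfl⟩ := h
  obtain ⟨b, z, rfl, hz⟩ := exists_maximal_left i z
  obtain ⟨a, u, rfl, hu⟩ := exists_maximal_right i u
  have hm : 2 ≤ P.M i := by have := P.three_le i; omega
  have h4 : ev (P.M i) (a ++ v ++ b) = ev (P.M i) (a ++ v' ++ b) := by
    simp only [ev_append, h3]
  have e : ∀ v, u ++ P.emw i a ++ P.emw i v ++ (P.emw i b ++ z) =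
      u ++ P.emw i (a ++ v ++ b) ++ z := fun v => by simp
  rw [e, e]
  by_cases hg : Geo (P.M i) (a ++ v' ++ b)
  · exact Or.inl (star_emw hP hu hz (star_geo (hm := hm) h4 hg))
  · obtain ⟨y, h5, h6⟩ := exists_geo (P.M_pos i) (a ++ v ++ b)
    refine Or.inr ⟨_, star_emw hP hu hz (star_geo (hm := hm) h5.symm h6), ?_⟩
    have h7 := h6.length_le (P.M_pos i) h5
    have h8 : y.length ≠ (a ++ v ++ b).length := fun h8 => hg (by
      have h9 := h1.length_eq h2 h3
      rw [Geo, ← len_congr h4, ← len_congr h5, ← h6, h8]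
      simp [h9])
    simp only [List.length_append, length_emw] at *
    omega

lemma Eqv.star (hP : ∀ i x, A.m (P.emb i x) (P.emb i !x) = P.M i) {w w' : Word S}
    (h : P.Eqv w w') :
    Steps012Star A w w' ∨ ∃ w₁, Steps012Star A w w₁ ∧ w₁.length < w.length := by
  induction h with
  | refl => exact Or.inl Relation.ReflTransGen.refl
  | tail h1 h2 ih =>
    rcases ih with ih | ih
    · rcases h2.star hP with h3 | ⟨w₁, h3, h4⟩
      · exact Or.inl (ih.trans h3)
      · exact Or.inr ⟨w₁, ih.trans h3, by rwa [Eqv.length_eq h1]⟩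
    · exact Or.inr ih

/-- A word which can not be shortened by transformations. -/
def Tight (A : ArtinData S) (w : Word S) : Prop :=
  ∀ w', Steps012Star A w w' → w.length ≤ w'.length

lemma exists_tight (A : ArtinData S) (w : Word S) : ∃ w', Steps012Star A w w' ∧ Tight A w' := by
  induction hn : w.length using Nat.strong_induction_on generalizing w with
  | _ n ih =>
    by_cases h : Tight A w
    · exact ⟨w, Relation.ReflTransGen.refl, h⟩
    · simp only [Tight, not_forall, not_le] at h
      obtain ⟨w₁, h1, h2⟩ := h
      obtain ⟨w₂, h3, h4⟩ := ih _ (hn ▸ h2) w₁ rfl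
      exact ⟨w₂, h1.trans h3, h4⟩

lemma Eqv.star_of_tight (hP : ∀ i x, A.m (P.emb i x) (P.emb i !x) = P.M i) {w w' : Word S}
    (h : P.Eqv w w') (hw : Tight A w) : Steps012Star A w w' := by
  rcases h.star hP with h | ⟨w₁, h1, h2⟩
  · exact h
  · exact absurd (hw _ h1) (by omega)

lemma red_of_tight (hP : ∀ i x, A.m (P.emb i x) (P.emb i !x) = P.M i) {w : Word S}
    (hw : Tight A w) : P.Red w := by
  intro u z x b h
  have h1 := h.star_of_tight hP hw
  have h2 : Step0 (u ++ (x, b) :: (x, !b) :: z) (u ++ z) := ⟨u, z, x, b, by simp, rfl⟩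
  have h3 := hw _ (h1.trans h2.steps01.star)
  have h4 := h.length_eq
  have h5 := h2.length_lt
  omega

/-- Words with the same image in the group can be transformed into a common tight word. -/
theorem star_of_wbar_eq (hP : ∀ i x, A.m (P.emb i x) (P.emb i !x) = P.M i)
    (hP' : ∀ u v, IsRel A u v → ∃ i x, u = P.emw i (alts true x (P.M i)) ∧
      v = P.emw i (alts true (!x) (P.M i)))
    {w w₀ : Word S} (h : wbar A w = wbar A w₀) :
    ∃ w', Steps012Star A w w' ∧ Steps012Star A w₀ w' := by
  obtain ⟨w', h1, h2⟩ := exists_tight A w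
  obtain ⟨w₀', h3, h4⟩ := exists_tight A w₀
  refine ⟨w', h1, h3.trans (Eqv.star_of_tight hP ?_ h4)⟩
  refine eqv_of_perm (red_of_tight hP h4) (red_of_tight hP h2) ?_
  have hf : ∀ u v, IsRel A u v →
      P.perm (FreeGroup.mk u) = P.perm (FreeGroup.mk v) := by
    intro u v huv
    obtain ⟨i, x, rfl, rfl⟩ := hP' u v huv
    exact perm_emw_eq (mk_eq_of_isRel (isRel_dih (hm := by have := P.three_le i; omega) x))
  rw [← h1.map_eq hf, ← h3.map_eq hf]
  have hr : Subgroup.normalClosure (rels A) ≤ P.perm.ker := by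
    refine Subgroup.normalClosure_le_normal ?_
    rintro r ⟨u, v, huv, rfl⟩
    rw [SetLike.mem_coe, MonoidHom.mem_ker, map_mul, map_inv, hf u v huv, mul_inv_cancel]
  have h5 := hr (QuotientGroup.eq.1 h)
  rw [MonoidHom.mem_ker, map_mul, map_inv, inv_mul_eq_one] at h5
  exact h5.symm

end PairSystem

section Support

open Dihedral

variable {P : PairSystem S} {A : ArtinData S}

lemma wordOver_append {T : Set S} {u v : Word S} :
    WordOver T (u ++ v) ↔ WordOver T u ∧ WordOver T v := by
  simp only [WordOver, List.mem_append, or_imp, forall_and]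

lemma wordOver_wordInv {T : Set S} {u : Word S} : WordOver T (wordInv u) ↔ WordOver T u := by
  constructor
  · intro h l hl
    exact h (l.1, !l.2) (List.mem_map.2 ⟨l, List.mem_reverse.2 hl, rfl⟩)
  · intro h l hl
    obtain ⟨l', h', rfl⟩ := List.mem_map.1 hl
    exact h l' (List.mem_reverse.1 h')

lemma WordOver.emw {T : Set S} {i : P.ι} {y : Bool} (h1 : P.emb i y ∈ T) (h2 : P.emb i (!y) ∈ T)
    (v : Word Bool) : WordOver T (P.emw i v) := by
  intro l hl
  obtain ⟨⟨z, b⟩, -, rfl⟩ := List.mem_map.1 hl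
  cases y <;> cases z <;> assumption

/-- Transformations do not introduce new letters. -/
lemma WordOver.star (hP' : ∀ u v, IsRel A u v → ∃ i x, u = P.emw i (alts true x (P.M i)) ∧
      v = P.emw i (alts true (!x) (P.M i))) {T : Set S} {w w' : Word S}
    (h : Steps012Star A w w') (hw : WordOver T w) : WordOver T w' := by
  have hhead : ∀ {v u : Word S} {i : P.ι} {x : Bool}, v ++ u = P.emw i (alts true x (P.M i)) →
      v ≠ [] → WordOver T v → P.emb i x ∈ T := by
    intro v u i x h1 h2 h3
    have h4 := congrArg List.head? h1
    rw [PairSystem.emw, List.head?_map, head_alts (P.M_pos i)] at h4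
    cases v with
    | nil => exact absurd rfl h2
    | cons l v =>
      simp at h4
      have := h3 l (by simp)
      rwa [h4] at this
  have hlast : ∀ {v u : Word S} {i : P.ι} {x : Bool}, u ++ v = P.emw i (alts true x (P.M i)) →
      v ≠ [] → WordOver T v → P.emb i (sh x (P.M i - 1)) ∈ T := by
    intro v u i x h1 h2 h3
    have h4 := congrArg List.getLast? h1
    rw [PairSystem.emw, List.getLast?_map, last_alts (P.M_pos i),
      List.getLast?_append_of_ne_nil _ h2] at h4
    exact h3 _ (List.mem_of_getLast? h4)
  induction h with
  | refl => exact hw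
  | tail _ h ih =>
    clear hw
    rcases h with ⟨a, z, s, b, rfl, rfl⟩ | ⟨a, z, u, v, hr, h⟩ |
      ⟨a, z, v, u, v', u', hr, n1, n2, rfl, rfl, -, -⟩ |
      ⟨a, z, v, u, v', u', hr, n1, n2, rfl, rfl, -, -⟩
    · simp only [wordOver_append] at ih ⊢
      exact ⟨ih.1.1, ih.2⟩
    · obtain ⟨i, x, rfl, rfl⟩ := hP' u v hr
      have key : WordOver T (P.emw i (alts true (!x) (P.M i))) →
          WordOver T (P.emw i (alts true x (P.M i))) := by
        intro h
        obtain ⟨n, hn⟩ : ∃ n, P.M i = n + 1 + 1 := ⟨P.M i - 2, by have := P.three_le i; omega⟩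
        have h1 := h (P.em i (!x, true)) (by simp [hn, alts_succ])
        have h2 := h (P.em i (!(!x), true)) (by simp [hn, alts_succ])
        exact WordOver.emw h1 h2 _
      rcases h with ⟨rfl, rfl⟩ | ⟨rfl, rfl⟩ <;>
      · simp only [wordOver_append, wordOver_wordInv] at ih ⊢
        exact ⟨⟨ih.1.1, key ih.1.2⟩, ih.2⟩
    · obtain ⟨i, x, h1, h2⟩ := hP' _ _ hr
      simp only [wordOver_append, wordOver_wordInv] at ih ⊢
      obtain ⟨⟨⟨ha, hv⟩, hv'⟩, hz⟩ := ih
      have key := fun y => WordOver.emw (hhead h1 n1 hv) (hhead h2 n2 hv') y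
      have k1 := key (alts true x (P.M i))
      have k2 := key (alts true (!x) (P.M i))
      rw [← h1, wordOver_append] at k1
      rw [← h2, wordOver_append] at k2
      exact ⟨⟨⟨ha, k1.2⟩, k2.2⟩, hz⟩
    · obtain ⟨i, x, h1, h2⟩ := hP' _ _ hr
      simp only [wordOver_append, wordOver_wordInv] at ih ⊢
      obtain ⟨⟨⟨ha, hv⟩, hv'⟩, hz⟩ := ih
      have hl := hlast h2 n2 hv'
      rw [sh_not] at hl
      have key := fun y => WordOver.emw (hlast h1 n1 hv) hl y
      have k1 := key (alts true x (P.M i))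
      have k2 := key (alts true (!x) (P.M i))
      rw [← h1, wordOver_append] at k1
      rw [← h2, wordOver_append] at k2
      exact ⟨⟨⟨ha, k1.1⟩, k2.1⟩, hz⟩

lemma exists_wordOver_of_mem_parab {T : Set S} {g : ArtinGroup A} (h : g ∈ parab A T) :
    ∃ w, WordOver T w ∧ wbar A w = g := by
  induction h using Subgroup.closure_induction with
  | mem x hx =>
    obtain ⟨s, hs, rfl⟩ := hx
    exact ⟨_, by simpa [WordOver] using hs, rfl⟩
  | one => exact ⟨[], by simp [WordOver], rfl⟩
  | mul x y _ _ hx hy =>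
    obtain ⟨w, h1, rfl⟩ := hx
    obtain ⟨w', h2, rfl⟩ := hy
    exact ⟨w ++ w', wordOver_append.2 ⟨h1, h2⟩, by rw [wbar, mk_append, map_mul]; rfl⟩
  | inv x _ hx =>
    obtain ⟨w, h1, rfl⟩ := hx
    exact ⟨wordInv w, wordOver_wordInv.2 h1, by rw [wbar, mk_wordInv, map_inv]; rfl⟩

end Support

/-- The pairs with finite label of a presentation of large type. -/
noncomputable def pairSystem (A : ArtinData S) (hlarge : ∀ s t : S, s ≠ t → 3 ≤ A.m s t) :
    PairSystem S where
  ι := {p : S × S // WellOrderingRel p.1 p.2 ∧ A.m p.1 p.2 ≠ ⊤}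
  emb i x := if x then i.1.1 else i.1.2
  M i := (A.m i.1.1 i.1.2).toNat
  three_le i := by
    have h := hlarge i.1.1 i.1.2 fun h => irrefl (r := WellOrderingRel) i.1.2 (h ▸ i.2.1)
    rw [← ENat.natCast_toNat i.2.2] at h
    exact_mod_cast h
  inj i := by
    have h : i.1.1 ≠ i.1.2 := fun h => irrefl (r := WellOrderingRel) i.1.2 (h ▸ i.2.1)
    intro x y
    cases x <;> cases y <;> simp [h, h.symm]
  unique i j x y x' y' hxy h1 h2 := by
    revert h1 h2
    obtain ⟨⟨a, b⟩, hab, -⟩ := i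
    obtain ⟨⟨c, d⟩, hcd, -⟩ := j
    intro h1 h2
    have h : ∀ a : S, ¬WellOrderingRel a a := fun a => irrefl a
    have h' := fun h : WellOrderingRel b a => asymm (r := WellOrderingRel) hab h
    simp only at hab hcd h1 h2
    simp only [Subtype.mk.injEq, Prod.mk.injEq]
    cases x <;> cases y <;> cases x' <;> cases y' <;> simp at h1 h2 hxy <;> grind

lemma pairSystem_label (A : ArtinData S) (hlarge : ∀ s t : S, s ≠ t → 3 ≤ A.m s t)
    (i : (pairSystem A hlarge).ι) (x : Bool) :
    A.m ((pairSystem A hlarge).emb i x) ((pairSystem A hlarge).emb i !x) =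
      (pairSystem A hlarge).M i := by
  have h : ((A.m i.1.1 i.1.2).toNat : ℕ∞) = A.m i.1.1 i.1.2 := ENat.natCast_toNat i.2.2
  cases x
  · exact (A.symm _ _).trans h.symm
  · exact h.symm

lemma pairSystem_isRel (A : ArtinData S) (hlarge : ∀ s t : S, s ≠ t → 3 ≤ A.m s t)
    {u v : Word S} (h : IsRel A u v) : ∃ i x,
      u = (pairSystem A hlarge).emw i (Dihedral.alts true x ((pairSystem A hlarge).M i)) ∧
      v = (pairSystem A hlarge).emw i (Dihedral.alts true (!x) ((pairSystem A hlarge).M i)) := by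
  obtain ⟨s, t, k, h1, h2, rfl, rfl⟩ := h
  obtain ⟨i, x, rfl, rfl⟩ : ∃ i x, (pairSystem A hlarge).emb i x = s ∧
      (pairSystem A hlarge).emb i (!x) = t := by
    rcases trichotomous_of WellOrderingRel s t with h | h | h
    · exact ⟨⟨(s, t), h, by simp [h2]⟩, true, rfl, rfl⟩
    · exact absurd h h1
    · exact ⟨⟨(t, s), h, by simp [A.symm t s, h2]⟩, false, rfl, rfl⟩
  rw [pairSystem_label] at h2
  obtain rfl : _ = k := by exact_mod_cast h2
  have e := fun y => PairSystem.emw_alts i y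
  exact ⟨i, x, by rw [e], by rw [e, Bool.not_not]⟩

/-- Corollary 2.28: every Artin–Tits presentation of large type satisfies
Property `H⁺`. -/
theorem stmt13 {S : Type*} [Finite S] (A : ArtinData S)
    (hlarge : ∀ s t : S, s ≠ t → 3 ≤ A.m s t) :
    PropertyHPlus A := by
  intro T w hw
  obtain ⟨w₀, h1, h2⟩ := exists_wordOver_of_mem_parab hw
  obtain ⟨w', h3, h4⟩ := PairSystem.star_of_wbar_eq (pairSystem_label A hlarge)
    (fun _ _ => pairSystem_isRel A hlarge) h2.symm
  exact ⟨w', h1.star (fun _ _ => pairSystem_isRel A hlarge) h4, h3⟩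

end ArtinTits
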